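/- arXiv:math/0608245 — 2 statements merged into one kernel-verified Lean document; each statement's English description precedes it below -/
import Mathlib

section
/- Let r ≥ 4 and n ≥ 5r+16 be integers. Then σ(K_{r+1} − K_4, n) = σ(K_{r+1} − (K_4 − e), n) = σ(K_{r+1} − Z_4, n), and this common value equals (r−1)(2n−r) − 3(n−r) + 1 if n−r is odd, and (r−1)(2n−r) − 3(n−r) + 2 if n−r is even. -/
open SimpleGraph Finset
open scoped Classical

/-- `G` contains a copy of `H` as a subgraph. -/
def ContainsCopy {α β : Type*} (G : SimpleGraph α) (H : SimpleGraph β) : Prop :=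
  ∃ f : β ↪ α, ∀ u v, H.Adj u v → G.Adj (f u) (f v)

/-- `G` is a realization of the degree sequence `d` (vertex `i` has degree `d i`). -/
def IsRealization {n : ℕ} (G : SimpleGraph (Fin n)) (d : Fin n → ℕ) : Prop :=
  ∀ i, G.degree i = d i

/-- `d` is a graphic sequence: it is nonincreasing and is the degree sequence of a
simple graph on `n` vertices. -/
def IsGraphic {n : ℕ} (d : Fin n → ℕ) : Prop :=
  Antitone d ∧ ∃ G : SimpleGraph (Fin n), IsRealization G d

/-- `d` is potentially `H`-graphic: some realization of `d` contains a copy of `H`. -/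
def PotentiallyGraphic {n : ℕ} (d : Fin n → ℕ) {β : Type*} (H : SimpleGraph β) : Prop :=
  ∃ G : SimpleGraph (Fin n), IsRealization G d ∧ ContainsCopy G H

/-- The set of even integers `l` such that every `n`-term graphic sequence with degree sum
at least `l` is potentially `H`-graphic; `σ(H, n)` is the least element of this set. -/
def SigmaSet {β : Type*} (H : SimpleGraph β) (n : ℕ) : Set ℕ :=
  {l | Even l ∧ ∀ d : Fin n → ℕ, IsGraphic d → l ≤ ∑ i, d i → PotentiallyGraphic d H}

/-- `K_m - H`: the complete graph on `m` vertices minus the edge set of a copy of `H`. -/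
def KsubH (m k : ℕ) (h : k ≤ m) (H : SimpleGraph (Fin k)) : SimpleGraph (Fin m) :=
  (⊤ : SimpleGraph (Fin m)) \ H.map (Fin.castLEEmb h)

/-- `Z₄ = K₄ - P₂`: the complete graph on 4 vertices minus two adjacent edges. -/
def Z4 : SimpleGraph (Fin 4) :=
  (⊤ : SimpleGraph (Fin 4)) \ SimpleGraph.fromEdgeSet {s(0, 1), s(1, 2)}

/-- The cycle on 4 vertices. -/
def C4 : SimpleGraph (Fin 4) :=
  SimpleGraph.fromEdgeSet {s(0, 1), s(1, 2), s(2, 3), s(3, 0)}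

/-- 1-indexed access `d_i` to a finite sequence (0 outside the range). -/
def nth {n : ℕ} (d : Fin n → ℕ) (i : ℕ) : ℕ :=
  if h : i - 1 < n then d ⟨i - 1, h⟩ else 0

section Switching

variable {V : Type} [Fintype V]

lemma degree_eq_card_filter (G : SimpleGraph V) (v : V) :
    G.degree v = #{u | G.Adj v u} := by
  rw [← G.card_neighborFinset_eq_degree, SimpleGraph.neighborFinset_eq_filter]

/-- The graph obtained by replacing the edges `ab`, `cd` by the edges `ac`, `bd` has the same
degrees. -/
lemma exists_switch (G : SimpleGraph V) {a b c d : V} (hab : G.Adj a b) (hcd : G.Adj c d)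
    (hac : a ≠ c) (hbd : b ≠ d) (nac : ¬ G.Adj a c) (nbd : ¬ G.Adj b d) :
    ∃ G' : SimpleGraph V, (∀ v, G'.degree v = G.degree v) ∧
      ∀ u v, G'.Adj u v ↔
        (G.Adj u v ∧ ¬ (u = a ∧ v = b ∨ u = b ∧ v = a) ∧ ¬ (u = c ∧ v = d ∨ u = d ∧ v = c)) ∨
        (u = a ∧ v = c ∨ u = c ∧ v = a) ∨ (u = b ∧ v = d ∨ u = d ∧ v = b) := by
  have hab' := hab.ne
  have hcd' := hcd.ne
  have had : a ≠ d := by rintro rfl; exact nac hcd.symm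
  have hbc : b ≠ c := by rintro rfl; exact nac hab
  have hsymm : ∀ u v, G.Adj u v → G.Adj v u := fun _ _ h => h.symm
  obtain ⟨G', key⟩ : ∃ G' : SimpleGraph V, ∀ u v, G'.Adj u v ↔
        (G.Adj u v ∧ ¬ (u = a ∧ v = b ∨ u = b ∧ v = a) ∧ ¬ (u = c ∧ v = d ∨ u = d ∧ v = c)) ∨
        (u = a ∧ v = c ∨ u = c ∧ v = a) ∨ (u = b ∧ v = d ∨ u = d ∧ v = b) := by
    refine ⟨{ Adj := fun u v => _, symm := ⟨?_⟩, loopless := ⟨?_⟩ }, fun _ _ => Iff.rfl⟩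
    · intro u v h
      have := hsymm u v
      have := hsymm v u
      grind
    · intro v h
      have := G.loopless.irrefl v
      grind
  refine ⟨G', fun v => ?_, key⟩
  have exchange : ∀ p q r : V, G.Adj p q → ¬ G.Adj p r →
      (∀ u, G'.Adj p u ↔ (G.Adj p u ∧ u ≠ q) ∨ u = r) → G'.degree p = G.degree p := by
    intro p q r hpq hpr h
    have : ({u | G'.Adj p u} : Finset V) = insert r (({u | G.Adj p u} : Finset V).erase q) := by
      ext u
      simp only [mem_filter, mem_univ, true_and, mem_insert, mem_erase, h]
      tauto
    rw [degree_eq_card_filter, degree_eq_card_filter, this, card_insert_of_notMem,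
      card_erase_add_one]
    · simpa using hpq
    · simp [hpr]
  by_cases ha : v = a
  · subst ha; exact exchange v b c hab nac fun u => by rw [key]; grind
  by_cases hb : v = b
  · subst hb; exact exchange v a d hab.symm nbd fun u => by rw [key]; grind
  by_cases hc : v = c
  · subst hc
    exact exchange v d a hcd (fun h => nac h.symm) fun u => by rw [key]; grind
  by_cases hd : v = d
  · subst hd
    exact exchange v c b hcd.symm (fun h => nbd h.symm) fun u => by rw [key]; grind
  rw [degree_eq_card_filter, degree_eq_card_filter]
  congr 1
  ext u
  simp only [mem_filter, mem_univ, true_and, key]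
  grind

/-- If `deg w ≤ deg x`, then there is a realization of the degrees in which `x` is joined to all former
neighbours of `w`, and which differs from `G` only at pairs meeting `{w, x}`. -/
lemma exists_neighbor_exchange (G : SimpleGraph V) {w x : V} (hwx : w ≠ x)
    (hdeg : G.degree w ≤ G.degree x) :
    ∃ G' : SimpleGraph V, (∀ v, G'.degree v = G.degree v) ∧
      (∀ u v, u ≠ w → u ≠ x → v ≠ w → v ≠ x → (G'.Adj u v ↔ G.Adj u v)) ∧
      (G'.Adj w x ↔ G.Adj w x) ∧
      (∀ v, v ≠ x → G.Adj w v → G'.Adj x v) ∧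
      (∀ v, G.Adj w v → G.Adj x v → G'.Adj w v) ∧
      (∀ v, v ≠ w → G.Adj x v → G'.Adj w v ∨ G'.Adj x v) := by
  have hirr := G.loopless.irrefl
  set A : Finset V := {v | G.Adj w v ∧ v ≠ x ∧ ¬ G.Adj x v} with hA
  set B₀ : Finset V := {v | G.Adj x v ∧ v ≠ w ∧ ¬ G.Adj w v} with hB₀
  have hAB₀ : #A ≤ #B₀ := by
    have e1 : #A + #{v | G.Adj w v ∧ (v = x ∨ G.Adj x v)} = G.degree w := by
      rw [degree_eq_card_filter, hA, ← card_filter_add_card_filter_not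
        (s := ({u | G.Adj w u} : Finset V)) (fun v => v ≠ x ∧ ¬ G.Adj x v), filter_filter,
        filter_filter]
      congr 3; ext v; tauto
    have e2 : #B₀ + #{v | G.Adj x v ∧ (v = w ∨ G.Adj w v)} = G.degree x := by
      rw [degree_eq_card_filter, hB₀, ← card_filter_add_card_filter_not
        (s := ({u | G.Adj x u} : Finset V)) (fun v => v ≠ w ∧ ¬ G.Adj w v), filter_filter,
        filter_filter]
      congr 3; ext v; tauto
    have e3 : #{v | G.Adj x v ∧ (v = w ∨ G.Adj w v)} ≤
        #{v | G.Adj w v ∧ (v = x ∨ G.Adj x v)} := by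
      refine card_le_card_of_injOn (Equiv.swap w x) ?_ (Equiv.injective _).injOn
      intro v hv
      simp only [coe_filter, mem_univ, true_and, Set.mem_ofPred_eq] at hv ⊢
      rcases hv with ⟨h1, rfl | h2⟩
      · simp [h1.symm]
      · rw [Equiv.swap_apply_of_ne_of_ne h2.ne' h1.ne']
        exact ⟨h2, Or.inr h1⟩
    omega
  obtain ⟨B, hB, hcard⟩ := exists_subset_card_eq hAB₀
  have memA : ∀ v, v ∈ A ↔ G.Adj w v ∧ v ≠ x ∧ ¬ G.Adj x v := by simp [hA]
  have memB : ∀ v, v ∈ B → G.Adj x v ∧ v ≠ w ∧ ¬ G.Adj w v := fun v hv => by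
    simpa [hB₀] using hB hv
  have hwT : w ∉ A ∪ B := by
    simp only [mem_union, memA]; rintro (h | h)
    · exact hirr _ h.1
    · exact (memB _ h).2.1 rfl
  have hxT : x ∉ A ∪ B := by
    simp only [mem_union, memA]; rintro (h | h)
    · exact h.2.1 rfl
    · exact hirr _ (memB _ h).1
  have hT : ∀ v, v ∈ A ∪ B → Equiv.swap w x v = v := fun v hv =>
    Equiv.swap_apply_of_ne_of_ne (by rintro rfl; exact hwT hv) (by rintro rfl; exact hxT hv)
  obtain ⟨G', key⟩ : ∃ G' : SimpleGraph V, ∀ u v, G'.Adj u v ↔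
      G.Adj (if v ∈ A ∪ B then Equiv.swap w x u else u)
        (if u ∈ A ∪ B then Equiv.swap w x v else v) := by
    refine ⟨{ Adj := fun u v => _, symm := ⟨?_⟩, loopless := ⟨?_⟩ }, fun _ _ => Iff.rfl⟩
    · intro u v h
      exact G.adj_symm h
    · intro v h
      split_ifs at h
      · exact hirr _ h
      · exact hirr _ h
  have keyw : ∀ v, G'.Adj w v ↔ if v ∈ A ∪ B then G.Adj x v else G.Adj w v := by
    intro v
    rw [key, if_neg hwT]
    split_ifs <;> simp
  have keyx : ∀ v, G'.Adj x v ↔ if v ∈ A ∪ B then G.Adj w v else G.Adj x v := by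
    intro v
    rw [key, if_neg hxT]
    split_ifs <;> simp
  have keyu : ∀ u v, u ≠ w → u ≠ x → v ≠ w → v ≠ x → (G'.Adj u v ↔ G.Adj u v) := by
    intro u v h1 h2 h3 h4
    rw [key, Equiv.swap_apply_of_ne_of_ne h1 h2, Equiv.swap_apply_of_ne_of_ne h3 h4]
    simp
  have hdisj : Disjoint A B := by
    rw [Finset.disjoint_left]
    intro v hv hv'
    exact (memB v hv').2.2 ((memA v).1 hv).1
  refine ⟨G', fun u => ?_, keyu, ?_, fun v hv h => ?_, fun v h h' => ?_, fun v hv h => ?_⟩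
  · by_cases huw : u = w
    · subst huw
      have hs : ({v | G'.Adj u v} : Finset V) = (({v | G.Adj u v} : Finset V) \ A) ∪ B := by
        ext v
        simp only [mem_filter, mem_univ, true_and, mem_union, mem_sdiff, keyw]
        have := memB v
        have := memA v
        split_ifs with h <;> tauto
      have hsub : A ⊆ ({v | G.Adj u v} : Finset V) := fun v hv => by simp [((memA v).1 hv).1]
      rw [degree_eq_card_filter, degree_eq_card_filter, hs, card_union_of_disjoint, hcard,
        card_sdiff_add_card_eq_card hsub]
      rw [Finset.disjoint_left]
      intro v hv hv'
      simp only [mem_sdiff, mem_filter, mem_univ, true_and] at hv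
      exact (memB v hv').2.2 hv.1
    by_cases hux : u = x
    · subst hux
      have hs : ({v | G'.Adj u v} : Finset V) = (({v | G.Adj u v} : Finset V) \ B) ∪ A := by
        ext v
        simp only [mem_filter, mem_univ, true_and, mem_union, mem_sdiff, keyx]
        have := memB v
        have := memA v
        have : v = u → ¬ G.Adj u v := by rintro rfl; exact hirr _
        split_ifs with h <;> tauto
      have hsub : B ⊆ ({v | G.Adj u v} : Finset V) := fun v hv => by simp [(memB v hv).1]
      rw [degree_eq_card_filter, degree_eq_card_filter, hs, card_union_of_disjoint, ← hcard,
        card_sdiff_add_card_eq_card hsub]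
      rw [Finset.disjoint_left]
      intro v hv hv'
      simp only [mem_sdiff, mem_filter, mem_univ, true_and] at hv
      exact ((memA v).1 hv').2.2 hv.1
    rw [degree_eq_card_filter, degree_eq_card_filter]
    refine card_equiv (if u ∈ A ∪ B then Equiv.swap w x else Equiv.refl V) fun v => ?_
    simp only [mem_filter, mem_univ, true_and]
    rw [key, Equiv.swap_apply_of_ne_of_ne huw hux, ite_self]
    split_ifs <;> rfl
  · rw [keyw, if_neg hxT]
  · rw [keyx]
    have := memA v
    have := memB v
    split_ifs with h' <;> simp only [mem_union] at h' <;> tauto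
  · rw [keyw]
    split_ifs <;> assumption
  · rw [keyw, keyx]
    split_ifs <;> tauto

end Switching

section Roles

variable {k : ℕ}

/-- The weights realizing the threshold graph `K_k ∨ (P₃ ∪ K₁)`. -/
def roleWeight : Fin k ⊕ Fin 4 → ℕ
  | .inl _ => 5
  | .inr j => ![2, 3, 2, 0] j

/-- The number of vertices of `K_k ∨ (P₃ ∪ K₁)` not adjacent to a given one. -/
def roleDefect : Fin k ⊕ Fin 4 → ℕ
  | .inl _ => 0
  | .inr j => ![2, 1, 2, 3] j

/-- The graph `K_k ∨ (P₃ ∪ K₁)`, as a threshold graph. -/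
def roleGraph (k : ℕ) : SimpleGraph (Fin k ⊕ Fin 4) where
  Adj a b := a ≠ b ∧ 5 ≤ roleWeight a + roleWeight b
  symm := ⟨fun _ _ h => ⟨h.1.symm, by rw [add_comm]; exact h.2⟩⟩
  loopless := ⟨fun _ h => h.1 rfl⟩

lemma roleGraph_adj {a b : Fin k ⊕ Fin 4} :
    (roleGraph k).Adj a b ↔ a ≠ b ∧ 5 ≤ roleWeight a + roleWeight b := Iff.rfl

lemma card_role_neighbors_add_defect (a : Fin k ⊕ Fin 4) :
    #{b | (roleGraph k).Adj a b} + roleDefect a = k + 3 := by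
  simp only [roleGraph_adj, card_filter, Fintype.sum_sum_type, Fin.sum_univ_four]
  rcases a with i | j
  · obtain ⟨m, rfl⟩ : ∃ m, k = m + 1 := ⟨k - 1, by have := i.2; omega⟩
    have : ∑ x : Fin (m + 1), (if i = x then 0 else 1) = m := by
      have h := Finset.sum_ite_eq univ i (fun _ => 1)
      have h2 : ∑ x : Fin (m + 1), ((if i = x then 0 else 1) + if i = x then 1 else 0) = m + 1 := by
        rw [sum_congr rfl (g := fun _ => 1) (fun x _ => by split_ifs <;> rfl)]
        simp
      rw [sum_add_distrib, h] at h2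
      simpa using h2
    simp [roleWeight, roleDefect, this]
  · fin_cases j <;> simp [roleWeight, roleDefect]

lemma sum_roleDefect : ∑ a : Fin k ⊕ Fin 4, roleDefect a = 8 := by
  simp [roleDefect, Fintype.sum_sum_type, Fin.sum_univ_four]

lemma roleDefect_le (a : Fin k ⊕ Fin 4) : roleDefect a ≤ 3 := by
  rcases a with i | j
  · simp [roleDefect]
  · fin_cases j <;> simp [roleDefect]

/-- The number of roles weighing at least as much as a given one. -/
lemma card_heavy_roles (a : Fin k ⊕ Fin 4) :
    #{g | roleWeight a ≤ roleWeight g ∧ g ≠ a} + 1 = match a with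
      | .inl _ => k
      | .inr j => k + ![3, 1, 3, 4] j := by
  simp only [card_filter, Fintype.sum_sum_type, Fin.sum_univ_four]
  rcases a with i | j
  · obtain ⟨m, rfl⟩ : ∃ m, k = m + 1 := ⟨k - 1, by have := i.2; omega⟩
    have : ∑ x : Fin (m + 1), (if x = i then 0 else 1) = m := by
      have h := Finset.sum_ite_eq' univ i (fun _ => 1)
      have h2 : ∑ x : Fin (m + 1), ((if x = i then 0 else 1) + if x = i then 1 else 0) = m + 1 := by
        rw [sum_congr rfl (g := fun _ => 1) (fun x _ => by split_ifs <;> rfl)]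
        simp
      rw [sum_add_distrib, h] at h2
      simpa using h2
    simp [roleWeight, this]
  · fin_cases j <;> simp [roleWeight]

end Roles

section Placement

variable {V : Type} [Fintype V] {k : ℕ}

/-- `G` has degrees `d`, and `f` places a copy of `K_k ∨ (P₃ ∪ K₁)` in `G` avoiding `v₀`. -/
structure IsPlaced (d : V → ℕ) (v₀ : V) (G : SimpleGraph V) (f : Fin k ⊕ Fin 4 → V) : Prop where
  degree_eq : ∀ v, G.degree v = d v
  injective : Function.Injective f
  avoid : ∀ a, f a ≠ v₀
  adj : ∀ a b, (roleGraph k).Adj a b → G.Adj (f a) (f b)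

/-- The number of vertices of the placed copy adjacent to `v₀`. -/
noncomputable def links (v₀ : V) (G : SimpleGraph V) (f : Fin k ⊕ Fin 4 → V) : ℕ :=
  #{a | G.Adj v₀ (f a)}

/-- The weighted degree sum of the placed copy. -/
def degreeWeight (d : V → ℕ) (f : Fin k ⊕ Fin 4 → V) : ℕ :=
  ∑ a, (roleWeight a + 1) * d (f a)

/-- The weighted number of edges between the placed copy and the neighbours of `v₀` outside it. -/
noncomputable def reach (v₀ : V) (G : SimpleGraph V) (f : Fin k ⊕ Fin 4 → V) : ℕ :=
  ∑ a, roleWeight a * #{x | G.Adj v₀ x ∧ (∀ b, x ≠ f b) ∧ G.Adj (f a) x}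

/-- A placement maximizing `links`, and then `degreeWeight`. -/
structure IsOptimal (d : V → ℕ) (v₀ : V) (G : SimpleGraph V) (f : Fin k ⊕ Fin 4 → V) : Prop
    extends IsPlaced d v₀ G f where
  links_le : ∀ G' f', IsPlaced (k := k) d v₀ G' f' → links v₀ G' f' ≤ links v₀ G f
  degreeWeight_le : ∀ G' f', IsPlaced (k := k) d v₀ G' f' → links v₀ G' f' = links v₀ G f →
    degreeWeight d f' ≤ degreeWeight d f

variable {d : V → ℕ} {v₀ : V} {G : SimpleGraph V} {f : Fin k ⊕ Fin 4 → V}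

lemma exists_isOptimal (h : IsPlaced d v₀ G f) :
    ∃ G' f', IsOptimal (k := k) d v₀ G' f' ∧
      ∀ G'' f'', IsOptimal (k := k) d v₀ G'' f'' → reach v₀ G'' f'' ≤ reach v₀ G' f' := by
  have hfin : ∀ P : SimpleGraph V × (Fin k ⊕ Fin 4 → V) → Prop, (∃ p, P p) →
      ∀ φ : SimpleGraph V × (Fin k ⊕ Fin 4 → V) → ℕ, ∃ p, P p ∧ ∀ q, P q → φ q ≤ φ p := by
    rintro P ⟨p, hp⟩ φ
    obtain ⟨q, hq, hmax⟩ := Set.exists_max_image {p | P p} φ (Set.toFinite _) ⟨p, hp⟩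
    exact ⟨q, hq, hmax⟩
  obtain ⟨p₁, h₁, m₁⟩ := hfin (fun p => IsPlaced d v₀ p.1 p.2) ⟨(G, f), h⟩
    (fun p => links v₀ p.1 p.2)
  obtain ⟨p₂, h₂, m₂⟩ := hfin
    (fun p => IsPlaced d v₀ p.1 p.2 ∧ links v₀ p.1 p.2 = links v₀ p₁.1 p₁.2) ⟨p₁, h₁, rfl⟩
    (fun p => degreeWeight d p.2)
  have hopt : IsOptimal d v₀ p₂.1 p₂.2 :=
    { toIsPlaced := h₂.1
      links_le := fun G' f' h' => h₂.2 ▸ m₁ (G', f') h'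
      degreeWeight_le := fun G' f' h' e => m₂ (G', f') ⟨h', e.trans h₂.2⟩ }
  obtain ⟨p₃, h₃, m₃⟩ := hfin (fun p => IsOptimal d v₀ p.1 p.2) ⟨p₂, hopt⟩
    (fun p => reach v₀ p.1 p.2)
  exact ⟨p₃.1, p₃.2, h₃, fun G'' f'' h'' => m₃ (G'', f'') h''⟩

lemma IsPlaced.switch (h : IsPlaced d v₀ G f) {a b c e : V} (hab : G.Adj a b) (hce : G.Adj c e)
    (hac : a ≠ c) (hbe : b ≠ e) (nac : ¬ G.Adj a c) (nbe : ¬ G.Adj b e)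
    (hH : ∀ p q, (roleGraph k).Adj p q → ¬ (f p = a ∧ f q = b) ∧ ¬ (f p = c ∧ f q = e)) :
    ∃ G' : SimpleGraph V, IsPlaced d v₀ G' f ∧
      ∀ u v, G'.Adj u v ↔
        (G.Adj u v ∧ ¬ (u = a ∧ v = b ∨ u = b ∧ v = a) ∧ ¬ (u = c ∧ v = e ∨ u = e ∧ v = c)) ∨
        (u = a ∧ v = c ∨ u = c ∧ v = a) ∨ (u = b ∧ v = e ∨ u = e ∧ v = b) := by
  obtain ⟨G', hd, key⟩ := exists_switch G hab hce hac hbe nac nbe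
  refine ⟨G', ⟨fun v => (hd v).trans (h.degree_eq v), h.injective, h.avoid, fun p q hpq => ?_⟩, key⟩
  have h1 := hH p q hpq
  have h2 := hH q p hpq.symm
  refine (key _ _).2 (Or.inl ⟨h.adj p q hpq, ?_, ?_⟩)
  · rintro (hc | hc)
    · exact h1.1 hc
    · exact h2.1 hc.symm
  · rintro (hc | hc)
    · exact h1.2 hc
    · exact h2.2 hc.symm

lemma IsOptimal.of_switch (h : IsOptimal d v₀ G f) {G' : SimpleGraph V}
    (h' : IsPlaced d v₀ G' f) (hv : ∀ a, G.Adj v₀ (f a) → G'.Adj v₀ (f a)) :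
    IsOptimal d v₀ G' f := by
  have hle : links v₀ G f ≤ links v₀ G' f :=
    card_le_card fun a ha => by
      simp only [mem_filter, mem_univ, true_and] at ha ⊢
      exact hv a ha
  have heq : links v₀ G' f = links v₀ G f := le_antisymm (h.links_le _ _ h') hle
  exact
    { toIsPlaced := h'
      links_le := fun G'' f'' h'' => heq ▸ h.links_le _ _ h''
      degreeWeight_le := fun G'' f'' h'' e => h.degreeWeight_le _ _ h'' (e.trans heq) }

lemma IsOptimal.adj_of_adj (h : IsOptimal d v₀ G f) {G' : SimpleGraph V}
    {f' : Fin k ⊕ Fin 4 → V} (h' : IsPlaced d v₀ G' f')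
    (hv : ∀ a, G.Adj v₀ (f a) → G'.Adj v₀ (f' a)) {a : Fin k ⊕ Fin 4}
    (ha : G'.Adj v₀ (f' a)) : G.Adj v₀ (f a) := by
  by_contra hn
  refine absurd (h.links_le _ _ h') (not_le.2 ?_)
  refine card_lt_card ⟨fun b hb => ?_, fun hsub => ?_⟩
  · simp only [mem_filter, mem_univ, true_and] at hb ⊢
    exact hv b hb
  · have := hsub (show a ∈ ({a | G'.Adj v₀ (f' a)} : Finset _) by simpa using ha)
    simp only [mem_filter, mem_univ, true_and] at this
    exact hn this

/-- An outer neighbour of `v₀` is adjacent to the loose neighbours of a vertex of the copy which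
is not adjacent to `v₀`. -/
lemma IsOptimal.eq_or_adj (h : IsOptimal d v₀ G f) {a : Fin k ⊕ Fin 4}
    (ha : ¬ G.Adj v₀ (f a)) {x y : V} (hx : G.Adj v₀ x) (hxf : ∀ b, x ≠ f b)
    (hy : G.Adj (f a) y) (hyf : ∀ b, (roleGraph k).Adj a b → y ≠ f b) : x = y ∨ G.Adj x y := by
  by_contra! hcon
  obtain ⟨G', hG', key⟩ := h.toIsPlaced.switch hx hy (h.avoid a).symm hcon.1 ha hcon.2
    (fun p q hpq => ⟨fun hc => h.avoid p hc.1, fun hc => by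
      have := h.injective hc.1
      subst this
      exact hyf q hpq hc.2.symm⟩)
  refine ha (h.adj_of_adj hG' (fun b hb => ?_) (a := a) ((key _ _).2 (by simp)))
  rw [key]
  have := hxf b
  have := h.avoid b
  have := h.avoid a
  have hyv : y ≠ v₀ := by rintro rfl; exact ha hy.symm
  left
  refine ⟨hb, ?_, ?_⟩
  · rintro (hc | hc)
    · exact hxf b hc.2.symm
    · exact h.avoid b hc.2
  · rintro (hc | hc)
    · exact h.avoid a hc.1.symm
    · exact hyv hc.1.symm

/-- Vertices outside an optimal copy have degree at most that of any vertex of the copy. -/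
lemma IsOptimal.degree_outer_le (h : IsOptimal d v₀ G f) {x : V} (hx : x ≠ v₀)
    (hxf : ∀ b, x ≠ f b) (a : Fin k ⊕ Fin 4) : d x ≤ d (f a) := by
  by_contra! hlt
  obtain ⟨G', hd, h1, h2, h3, h4, h5⟩ := exists_neighbor_exchange G (hxf a).symm
    (by rw [h.degree_eq, h.degree_eq]; exact hlt.le)
  have hne : ∀ b, b ≠ a → f b ≠ f a := fun b hb e => hb (h.injective e)
  have hP : IsPlaced d v₀ G' (Function.update f a x) := by
    refine ⟨fun v => (hd v).trans (h.degree_eq v), fun b c hbc => ?_, fun b => ?_,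
      fun b c hbc => ?_⟩
    · simp only [Function.update_apply] at hbc
      split_ifs at hbc with e1 e2 e2
      · rw [e1, e2]
      · exact absurd hbc (hxf c)
      · exact absurd hbc.symm (hxf b)
      · exact h.injective hbc
    · rw [Function.update_apply]
      split_ifs
      · exact hx
      · exact h.avoid b
    · have hG := h.adj b c hbc
      simp only [Function.update_apply]
      split_ifs with e1 e2 e2
      · exact absurd (e1.trans e2.symm) hbc.1
      · subst e1; exact h3 _ (hxf c).symm hG
      · subst e2; exact (h3 _ (hxf b).symm hG.symm).symm
      · exact (h1 _ _ (hne b e1) (hxf b).symm (hne c e2) (hxf c).symm).2 hG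
  have hv : ∀ b, G.Adj v₀ (f b) → G'.Adj v₀ (Function.update f a x b) := by
    intro b hb
    rw [Function.update_apply]
    split_ifs with e
    · subst e; exact (h3 _ hx.symm hb.symm).symm
    · exact (h1 _ _ (h.avoid a).symm hx.symm (hne b e) (hxf b).symm).2 hb
  have hlinks : links v₀ G' (Function.update f a x) = links v₀ G f := by
    refine le_antisymm (h.links_le _ _ hP) (card_le_card fun b hb => ?_)
    simp only [mem_filter, mem_univ, true_and] at hb ⊢
    exact hv b hb
  refine absurd (h.degreeWeight_le _ _ hP hlinks) (not_le.2 ?_)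
  refine sum_lt_sum (fun b _ => ?_) ⟨a, mem_univ a, ?_⟩
  · rw [Function.update_apply]
    split_ifs with e
    · subst e; gcongr
    · rfl
  · rw [Function.update_self]
    gcongr

/-- In an optimal copy the degrees are ordered as the weights of the roles. -/
lemma IsOptimal.degree_le_of_weight_lt (h : IsOptimal d v₀ G f) {a b : Fin k ⊕ Fin 4}
    (hab : roleWeight b < roleWeight a) : d (f b) ≤ d (f a) := by
  by_contra! hlt
  have habne : a ≠ b := by rintro rfl; exact lt_irrefl _ hab
  have hfab : f a ≠ f b := fun e => habne (h.injective e)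
  obtain ⟨G', hd, h1, h2, h3, h4, h5⟩ := exists_neighbor_exchange G hfab
    (by rw [h.degree_eq, h.degree_eq]; exact hlt.le)
  have hnea : ∀ c, c ≠ a → f c ≠ f a := fun c hc e => hc (h.injective e)
  have hneb : ∀ c, c ≠ b → f c ≠ f b := fun c hc e => hc (h.injective e)
  have hdom : ∀ c, c ≠ a → (roleGraph k).Adj b c → (roleGraph k).Adj a c := fun c hc hbc =>
    ⟨hc.symm, by have := hbc.2; omega⟩
  have hsw : ∀ c, Equiv.swap a b c = a ∧ c = b ∨ Equiv.swap a b c = b ∧ c = a ∨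
      Equiv.swap a b c = c ∧ c ≠ a ∧ c ≠ b := by
    intro c
    by_cases ca : c = a
    · subst ca; simp
    by_cases cb : c = b
    · subst cb; simp
    simp [Equiv.swap_apply_of_ne_of_ne ca cb, ca, cb]
  have hP : IsPlaced d v₀ G' (f ∘ Equiv.swap a b) := by
    refine ⟨fun v => (hd v).trans (h.degree_eq v), h.injective.comp (Equiv.injective _),
      fun c => h.avoid _, fun c e hce => ?_⟩
    have hG := h.adj c e hce
    simp only [Function.comp_apply]
    rcases hsw c with ⟨e1, rfl⟩ | ⟨e1, rfl⟩ | ⟨e1, n1, n1'⟩ <;>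
    rcases hsw e with ⟨e2, rfl⟩ | ⟨e2, rfl⟩ | ⟨e2, n2, n2'⟩ <;> simp only [e1, e2]
    · exact absurd rfl hce.1
    · exact h2.2 hG.symm
    · exact h4 _ (h.adj _ _ (hdom e n2 hce)) hG
    · exact (h2.2 hG).symm
    · exact absurd rfl hce.1
    · exact h3 _ (hneb e n2') hG
    · exact (h4 _ (h.adj _ _ (hdom c n1 hce.symm)) hG.symm).symm
    · exact (h3 _ (hneb c n1') hG.symm).symm
    · exact (h1 _ _ (hnea c n1) (hneb c n1') (hnea e n2) (hneb e n2')).2 hG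
  have split : ∀ φ : Fin k ⊕ Fin 4 → ℕ,
      ∑ c, φ c = φ a + φ b + ∑ c ∈ (univ.erase a).erase b, φ c := by
    intro φ
    rw [← add_sum_erase univ φ (mem_univ a), ← add_sum_erase (univ.erase a) φ
      (mem_erase.2 ⟨habne.symm, mem_univ b⟩), add_assoc]
  have hle : links v₀ G f ≤ links v₀ G' (f ∘ Equiv.swap a b) := by
    have hlink : ∀ c, c ≠ a → c ≠ b → (G'.Adj v₀ (f c) ↔ G.Adj v₀ (f c)) := fun c ha hb =>
      h1 _ _ (h.avoid a).symm (h.avoid b).symm (hnea c ha) (hneb c hb)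
    have hAB : (if G.Adj v₀ (f a) then 1 else 0) + (if G.Adj v₀ (f b) then 1 else 0) ≤
        (if G'.Adj v₀ (f b) then 1 else 0) + (if G'.Adj v₀ (f a) then 1 else 0) := by
      have i1 := h3 v₀ (h.avoid b).symm
      have i2 := h4 v₀
      have i3 := h5 v₀ (h.avoid a).symm
      simp only [G.adj_comm _ v₀, G'.adj_comm _ v₀] at i1 i2 i3
      split_ifs <;> simp_all
    rw [links, links, card_filter, card_filter, split, split]
    simp only [Function.comp_apply, Equiv.swap_apply_left, Equiv.swap_apply_right]
    refine add_le_add hAB (le_of_eq (sum_congr rfl fun c hc => ?_))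
    simp only [mem_erase, mem_univ, and_true] at hc
    simp only [Equiv.swap_apply_of_ne_of_ne hc.2 hc.1, hlink c hc.2 hc.1]
  have hlinks := le_antisymm (h.links_le _ _ hP) hle
  refine absurd (h.degreeWeight_le _ _ hP hlinks) (not_le.2 ?_)
  rw [degreeWeight, degreeWeight, split, split]
  simp only [Function.comp_apply, Equiv.swap_apply_left, Equiv.swap_apply_right]
  refine add_lt_add_of_lt_of_le ?_ (le_of_eq (sum_congr rfl fun c hc => ?_))
  · nlinarith
  · simp only [mem_erase, mem_univ, and_true] at hc
    rw [Equiv.swap_apply_of_ne_of_ne hc.2 hc.1]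

end Placement

section Counting

lemma sum_card_adj_comm {V : Type} (G : SimpleGraph V) (S T : Finset V) :
    ∑ u ∈ S, #{c ∈ T | G.Adj u c} = ∑ c ∈ T, #{u ∈ S | G.Adj c u} := by
  refine (sum_card_bipartiteAbove_eq_sum_card_bipartiteBelow (fun u c => G.Adj u c)).trans
    (sum_congr rfl fun c _ => ?_)
  simp only [bipartiteBelow, G.adj_comm c]

variable {V : Type} [Fintype V]

lemma sum_degree_le_of_outside_le (G : SimpleGraph V) (T : Finset V) {δ : ℕ}
    (hδ : ∀ v ∉ T, G.degree v ≤ δ) :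
    ∑ v, G.degree v ≤ #T * (Fintype.card V - 1) + #Tᶜ * δ := by
  rw [← sum_add_sum_compl T]
  refine add_le_add (sum_le_card_nsmul _ _ _ fun v _ => ?_)
    (sum_le_card_nsmul _ _ _ fun v hv => hδ v (mem_compl.1 hv))
  have := G.degree_lt_card_verts v
  omega

lemma sum_degree_le_of_outside_le' (G : SimpleGraph V) (T : Finset V) {δ : ℕ}
    (hδ : ∀ v ∉ T, G.degree v ≤ δ) :
    ∑ v, G.degree v ≤ #T * (#T - 1) + 2 * (#Tᶜ * δ) := by
  have h1 : ∑ v ∈ T, G.degree v ≤ #T * (#T - 1) + #Tᶜ * δ := by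
    have e : ∀ v ∈ T, G.degree v ≤ (#T - 1) + #{u ∈ Tᶜ | G.Adj v u} := by
      intro v hv
      have hs : ({u | G.Adj v u} : Finset V) ⊆ T.erase v ∪ ({u ∈ Tᶜ | G.Adj v u} : Finset V) := by
        intro u hu
        simp only [mem_filter, mem_univ, true_and] at hu
        simp only [mem_union, mem_erase, mem_filter, mem_compl]
        by_cases hT : u ∈ T
        · exact Or.inl ⟨hu.ne', hT⟩
        · exact Or.inr ⟨hT, hu⟩
      rw [degree_eq_card_filter]
      refine (card_le_card hs).trans ((card_union_le _ _).trans ?_)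
      rw [card_erase_of_mem hv]
    refine (sum_le_sum e).trans ?_
    rw [sum_add_distrib, sum_const, smul_eq_mul, sum_card_adj_comm]
    refine Nat.add_le_add_left (sum_le_card_nsmul _ _ _ fun u hu => ?_) _
    refine le_trans (card_le_card (filter_subset_filter _ (subset_univ _))) ?_
    rw [← degree_eq_card_filter]
    exact hδ u (mem_compl.1 hu)
  have h2 : ∑ v ∈ Tᶜ, G.degree v ≤ #Tᶜ * δ :=
    sum_le_card_nsmul _ _ _ fun v hv => hδ v (mem_compl.1 hv)
  rw [← sum_add_sum_compl T]
  omega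

variable {k : ℕ} {d : V → ℕ} {v₀ : V} {G : SimpleGraph V} {f : Fin k ⊕ Fin 4 → V}

/-- Every vertex of an optimal copy has a neighbour besides those in the copy. -/
lemma IsOptimal.le_degree_add_defect (h : IsOptimal d v₀ G f)
    (hn : 5 * k + 36 ≤ Fintype.card V)
    (hS : Fintype.card V * (2 * k + 3) + 1 ≤ ∑ v, d v + k ^ 2 + 4 * k) (a : Fin k ⊕ Fin 4) :
    k + 4 ≤ d (f a) + roleDefect a := by
  by_contra! hlt
  set T : Finset V := insert v₀
    (image f ({g | roleWeight a ≤ roleWeight g ∧ g ≠ a} : Finset _)) with hT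
  have hTcard : #T = #{g | roleWeight a ≤ roleWeight g ∧ g ≠ a} + 1 := by
    rw [hT, card_insert_of_notMem, card_image_of_injective _ h.injective]
    simp only [mem_image, not_exists, not_and]
    exact fun g _ => h.avoid g
  have hout : ∀ v ∉ T, G.degree v ≤ d (f a) := by
    intro v hv
    rw [h.degree_eq]
    simp only [hT, mem_insert, mem_image, mem_filter, mem_univ, true_and, not_or, not_exists,
      not_and] at hv
    by_cases hvf : ∀ b, v ≠ f b
    · exact h.degree_outer_le hv.1 hvf a
    · push Not at hvf
      obtain ⟨b, rfl⟩ := hvf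
      by_cases hba : b = a
      · rw [hba]
      · refine h.degree_le_of_weight_lt ?_
        by_contra! hw
        exact hv.2 b ⟨hw, hba⟩ rfl
  have e1 := sum_degree_le_of_outside_le G T hout
  have e2 := sum_degree_le_of_outside_le' G T hout
  have hc : #T + #Tᶜ = Fintype.card V := card_add_card_compl T
  simp only [h.degree_eq] at e1 e2
  rw [card_heavy_roles] at hTcard
  generalize Fintype.card V = n at *
  generalize ∑ v, d v = S at *
  generalize #T = τ at *
  generalize #Tᶜ = c at *
  generalize d (f a) = δ at *
  obtain ⟨m, rfl⟩ : ∃ m, n = m + 1 := ⟨n - 1, by omega⟩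
  rcases a with i | j
  · simp only [roleDefect] at hlt hTcard
    subst hTcard
    have hδ : δ ≤ τ + 3 := by omega
    have := Nat.mul_le_mul_left c hδ
    simp only [Nat.add_sub_cancel] at e1
    nlinarith
  · have hcases : (τ = k + 1 ∧ δ ≤ k + 2) ∨ (τ = k + 3 ∧ δ ≤ k + 1) ∨ (τ = k + 4 ∧ δ ≤ k) := by
      fin_cases j <;> simp [roleDefect] at hlt hTcard <;> omega
    rcases hcases with ⟨rfl, hδ⟩ | ⟨rfl, hδ⟩ | ⟨rfl, hδ⟩
    · have := Nat.mul_le_mul_left c hδ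
      simp only [Nat.add_sub_cancel] at e1
      nlinarith
    · have := Nat.mul_le_mul_left c hδ
      rw [show k + 3 - 1 = k + 2 by omega] at e2
      nlinarith
    · have := Nat.mul_le_mul_left c hδ
      rw [show k + 4 - 1 = k + 3 by omega] at e2
      nlinarith

end Counting

section OuterNeighbor

lemma card_image_univ_role {V : Type} {k : ℕ} {f : Fin k ⊕ Fin 4 → V}
    (hf : Function.Injective f) : #(univ.image f) = k + 4 := by
  rw [card_image_of_injective _ hf]
  simp

variable {V : Type} [Fintype V] {k : ℕ} {d : V → ℕ} {v₀ : V} {G : SimpleGraph V}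
  {f : Fin k ⊕ Fin 4 → V}

/-- The vertices other than `v₀` outside the placed copy. -/
noncomputable def outer (v₀ : V) (f : Fin k ⊕ Fin 4 → V) : Finset V :=
  {v | v ≠ v₀ ∧ ∀ a, v ≠ f a}

lemma mem_outer {v : V} : v ∈ outer v₀ f ↔ v ≠ v₀ ∧ ∀ a, v ≠ f a := by simp [outer]

lemma IsPlaced.sum_eq (h : IsPlaced d v₀ G f) (φ : V → ℕ) :
    ∑ v, φ v = φ v₀ + ∑ a, φ (f a) + ∑ v ∈ outer v₀ f, φ v := by
  have hR : outer v₀ f = (insert v₀ (univ.image f))ᶜ := by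
    ext v
    simp only [mem_outer, mem_compl, mem_insert, mem_image, mem_univ, true_and, not_or,
      not_exists]
    exact and_congr_right fun _ => forall_congr' fun a => ⟨fun h e => h e.symm, fun h e => h e.symm⟩
  rw [hR, ← sum_add_sum_compl (insert v₀ (univ.image f)), sum_insert,
    sum_image fun a _ b _ e => h.injective e]
  simp only [mem_image, mem_univ, true_and, not_exists]
  exact h.avoid

/-- A vertex adjacent neither to `v₀` nor to a given vertex of the copy has at most `k + 3`
neighbours which are not outer. -/
lemma IsPlaced.degree_le_outer (h : IsPlaced d v₀ G f) {a : Fin k ⊕ Fin 4} {u : V}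
    (hu : ¬ G.Adj u (f a)) (huv : ¬ G.Adj u v₀) :
    d u ≤ #{x ∈ outer v₀ f | G.Adj u x} + (k + 3) := by
  have hs : ({x | G.Adj u x} : Finset V) ⊆
      ({x ∈ outer v₀ f | G.Adj u x} : Finset V) ∪ (univ.image f).erase (f a) := by
    intro x hx
    simp only [mem_filter, mem_univ, true_and] at hx
    simp only [mem_union, mem_filter, mem_outer, mem_erase, mem_image, mem_univ, true_and]
    by_cases hxf : ∃ b, f b = x
    · exact Or.inr ⟨by rintro rfl; exact hu hx, hxf⟩
    · push Not at hxf
      exact Or.inl ⟨⟨by rintro rfl; exact huv hx, fun b e => hxf b e.symm⟩, hx⟩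
  rw [← h.degree_eq, degree_eq_card_filter]
  refine (card_le_card hs).trans ((card_union_le _ _).trans ?_)
  rw [card_erase_of_mem (by simp), card_image_univ_role h.injective]
  omega

lemma IsPlaced.card_role_neighbors_le (h : IsPlaced d v₀ G f) (a : Fin k ⊕ Fin 4) (s : Finset V)
    (hs : ∀ v ∈ s, G.Adj (f a) v ∧ ∀ b, (roleGraph k).Adj a b → v ≠ f b) :
    #s + (k + 3) ≤ d (f a) + roleDefect a := by
  have hsub : s ∪ ({b | (roleGraph k).Adj a b} : Finset _).image f ⊆
      ({v | G.Adj (f a) v} : Finset V) := by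
    intro v hv
    simp only [mem_union, mem_image, mem_filter, mem_univ, true_and] at hv ⊢
    rcases hv with hv | ⟨b, hb, rfl⟩
    · exact (hs v hv).1
    · exact h.adj a b hb
  have hc := card_le_card hsub
  rw [← degree_eq_card_filter, h.degree_eq, card_union_of_disjoint,
    card_image_of_injective _ h.injective] at hc
  · have := card_role_neighbors_add_defect a
    omega
  · rw [Finset.disjoint_left]
    intro v hv hv'
    simp only [mem_image, mem_filter, mem_univ, true_and] at hv'
    obtain ⟨b, hb, rfl⟩ := hv'
    exact (hs _ hv).2 b hb rfl

/-- A switch along `v₀`: if `p` misses an outer neighbour `x` of `v₀`, and `q` is an outer vertex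
missing an outer neighbour `y` of `f a`, then `p` and `q` are not adjacent. -/
lemma IsOptimal.not_adj_of_not_adj (h : IsOptimal d v₀ G f) {a : Fin k ⊕ Fin 4}
    (ha : ¬ G.Adj v₀ (f a)) {x y p q : V} (hx : x ∈ outer v₀ f) (hvx : G.Adj v₀ x)
    (hy : y ∈ outer v₀ f) (hay : G.Adj (f a) y) (hpv : p ≠ v₀) (hpa : p ≠ f a) (hpx : p ≠ x)
    (npx : ¬ G.Adj p x) (hq : q ∈ outer v₀ f) (hqy : q ≠ y) (nqy : ¬ G.Adj q y) :
    ¬ G.Adj p q := by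
  intro hpq
  rw [mem_outer] at hx hy hq
  have hvq : ¬ G.Adj v₀ q := fun hvq =>
    (h.eq_or_adj ha hvq hq.2 hay fun b _ => hy.2 b).elim hqy nqy
  obtain ⟨G', hG', key⟩ := h.toIsPlaced.switch hvx hpq.symm hq.1.symm hpx.symm hvq
    (fun e => npx e.symm)
    (fun b c _ => ⟨fun e => h.avoid b e.1, fun e => hq.2 b e.1.symm⟩)
  have hopt : IsOptimal d v₀ G' f := h.of_switch hG' fun b hb => by
    refine (key _ _).2 (Or.inl ⟨hb, ?_, ?_⟩)
    · rintro (e | e)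
      · exact hx.2 b e.2.symm
      · exact hx.1 e.1.symm
    · rintro (e | e)
      · exact hq.1 e.1.symm
      · exact hpv e.1.symm
  have hva' : ¬ G'.Adj v₀ (f a) := by
    rw [key]
    rintro (e | (e | e) | (e | e))
    · exact ha e.1
    · exact hq.2 a e.2.symm
    · exact hq.1 e.1.symm
    · exact hx.1 e.1.symm
    · exact hpv e.1.symm
  have hay' : G'.Adj (f a) y := by
    refine (key _ _).2 (Or.inl ⟨hay, ?_, ?_⟩)
    · rintro (e | e)
      · exact h.avoid a e.1
      · exact hx.2 a e.1.symm
    · rintro (e | e)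
      · exact hq.2 a e.1.symm
      · exact hpa e.1.symm
  rcases hopt.eq_or_adj hva' ((key _ _).2 (Or.inr (Or.inl (Or.inl ⟨rfl, rfl⟩)))) hq.2 hay'
    (fun b _ => hy.2 b) with e | e
  · exact hqy e
  · rw [key] at e
    rcases e with e | (e | e) | (e | e)
    · exact nqy e.1
    · exact hq.1 e.1
    · exact hy.1 e.2
    · exact hvq (e.1 ▸ hvx)
    · exact hpq.ne e.1.symm

end OuterNeighbor

section OuterNeighborBound

lemma degree_sum_contradiction {k n S D t x i u : ℕ} (hn : 5 * k + 36 ≤ n)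
    (hS : n * (2 * k + 3) + 1 ≤ S + k ^ 2 + 4 * k) (hD : D ≤ x + (k + 3)) (ht : t ≤ 2 * k + 6)
    (hti : t ≤ i + (k + 3)) (hxt : x ≤ t) (hu : u + i ≤ 2 * t)
    (hle : S ≤ D + (t + (k + 3) * D) + (u * t + (8 + i * (t - x)))) : False := by
  zify [hxt] at hn hS hD ht hti hu hle
  have hxt' : (x : ℤ) ≤ t := by exact_mod_cast hxt
  have p1 := mul_le_mul_of_nonneg_left hD (show (0 : ℤ) ≤ (k : ℤ) + 4 by positivity)
  have p2 : (u : ℤ) * t ≤ (2 * t - i) * t :=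
    mul_le_mul_of_nonneg_right (by linarith) (by positivity)
  have p3 : (0 : ℤ) ≤ x * (i + (k + 3) - t) := mul_nonneg (by positivity) (by linarith)
  have p4 : (0 : ℤ) ≤ (t - x) * (2 * k + 7 - t) := mul_nonneg (by linarith) (by linarith)
  have p5 : (0 : ℤ) ≤ (2 * k + 6 - t) * (t + 4 * k + 14) := mul_nonneg (by linarith) (by positivity)
  have p6 := mul_le_mul_of_nonneg_right hn (show (0 : ℤ) ≤ 2 * (k : ℤ) + 3 by positivity)
  nlinarith

variable {V : Type} [Fintype V] {k : ℕ} {d : V → ℕ} {v₀ : V} {G : SimpleGraph V}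
  {f : Fin k ⊕ Fin 4 → V}

lemma card_le_degree_of_adj (G : SimpleGraph V) {x u : V} {s : Finset V} (hxu : G.Adj x u)
    (hu : u ∉ s) (hs : ∀ v ∈ s, v = x ∨ G.Adj v x) : #s ≤ G.degree x := by
  have hsub : insert u (s.erase x) ⊆ ({v | G.Adj x v} : Finset V) := by
    intro v hv
    simp only [mem_insert, mem_erase, mem_filter, mem_univ, true_and] at hv ⊢
    rcases hv with rfl | ⟨hvx, hv⟩
    · exact hxu
    · exact ((hs v hv).resolve_left hvx).symm
  have hc := card_le_card hsub
  rw [card_insert_of_notMem (fun h => hu (mem_of_mem_erase h)), ← degree_eq_card_filter] at hc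
  have := pred_card_le_card_erase (s := s) (a := x)
  omega

/-- If all cliques are small, then in an optimal copy a vertex not adjacent to `v₀` has no outer
neighbours. -/
lemma IsOptimal.not_adj_outer (h : IsOptimal d v₀ G f) (hmax : ∀ v, d v ≤ d v₀)
    (hn : 5 * k + 36 ≤ Fintype.card V)
    (hS : Fintype.card V * (2 * k + 3) + 1 ≤ ∑ v, d v + k ^ 2 + 4 * k)
    (hclique : ∀ s : Finset V, G.IsClique s → #s ≤ k + 4)
    (hv₀ : k + 4 ≤ d v₀) {a : Fin k ⊕ Fin 4} (ha : ¬ G.Adj v₀ (f a)) {y₀ : V}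
    (hy₀ : y₀ ∈ outer v₀ f) : ¬ G.Adj (f a) y₀ := by
  intro hay₀
  set R := outer v₀ f with hR
  set X : Finset V := {x ∈ R | G.Adj v₀ x} with hX
  set Y : Finset V := {y ∈ R | G.Adj (f a) y} with hY
  have ha' : ¬ G.Adj (f a) v₀ := fun e => ha e.symm
  have memX : ∀ x, x ∈ X ↔ x ∈ R ∧ G.Adj v₀ x := by simp [hX]
  have memY : ∀ y, y ∈ Y ↔ y ∈ R ∧ G.Adj (f a) y := by simp [hY]
  have hv₀R : v₀ ∉ R := fun e => (mem_outer.1 e).1 rfl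
  have hfR : ∀ b, f b ∉ R := fun b e => (mem_outer.1 e).2 b rfl
  have hdX : d v₀ ≤ #X + (k + 3) := h.toIsPlaced.degree_le_outer ha (G.loopless.irrefl v₀)
  have hdY : d (f a) ≤ #Y + (k + 3) :=
    h.toIsPlaced.degree_le_outer (G.loopless.irrefl (f a)) ha'
  have hXY : ∀ x ∈ X, ∀ y ∈ Y, x = y ∨ G.Adj x y := by
    intro x hx y hy
    rw [memX] at hx
    rw [memY] at hy
    exact h.eq_or_adj ha hx.2 (mem_outer.1 hx.1).2 hy.2 fun b _ => (mem_outer.1 hy.1).2 b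
  have hsw : ∀ x ∈ X, ∀ y ∈ Y, ∀ p q, p ≠ v₀ → p ≠ f a → p ≠ x → ¬ G.Adj p x → q ∈ R → q ≠ y →
      ¬ G.Adj q y → ¬ G.Adj p q := by
    intro x hx y hy p q h1 h2 h3 h4 h5 h6 h7
    rw [memX] at hx
    rw [memY] at hy
    exact h.not_adj_of_not_adj ha hx.1 hx.2 hy.1 hy.2 h1 h2 h3 h4 h5 h6 h7
  have hy₀Y : y₀ ∈ Y := (memY _).2 ⟨hy₀, hay₀⟩
  obtain ⟨x₀, hx₀⟩ : X.Nonempty := by rw [← card_pos]; omega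
  have hclq : (∀ x ∈ X, ∀ x' ∈ X, x = x' ∨ G.Adj x x') ∨
      (∀ y ∈ Y, ∀ y' ∈ Y, y = y' ∨ G.Adj y y') := by
    by_contra! hcon
    obtain ⟨⟨x, hx, x', hx', nx, nx'⟩, y, hy, y', hy', ny, ny'⟩ := hcon
    have hne : ∀ b, x' ≠ f b := (mem_outer.1 ((memX _).1 hx').1).2
    have e1 := hsw x hx y hy x' y' (mem_outer.1 ((memX _).1 hx').1).1 (hne a) nx.symm
      (fun e => nx' e.symm) ((memY _).1 hy').1 ny.symm (fun e => ny' e.symm)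
    rcases hXY x' hx' y' hy' with e | e
    · subst e
      rcases hXY x' hx' y hy with e | e
      · exact ny e.symm
      · exact ny' e.symm
    · exact e1 e
  have ht : d (f a) ≤ 2 * k + 6 := by
    rcases hclq with hc | hc
    · have hcl := hclique (insert v₀ X) (by
        rw [coe_insert, isClique_insert]
        refine ⟨fun x hx x' hx' hne => (hc x hx x' hx').resolve_left hne, fun x hx _ => ?_⟩
        exact ((memX x).1 hx).2)
      rw [card_insert_of_notMem fun e => hv₀R ((memX _).1 e).1] at hcl
      have := hmax (f a)
      omega
    · have hcl := hclique (insert (f a) Y) (by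
        rw [coe_insert, isClique_insert]
        refine ⟨fun x hx x' hx' hne => (hc x hx x' hx').resolve_left hne, fun x hx _ => ?_⟩
        exact ((memY x).1 hx).2)
      rw [card_insert_of_notMem fun e => hfR a ((memY _).1 e).1] at hcl
      omega
  set RX : Finset V := {r ∈ R | ∀ x ∈ X, r = x ∨ G.Adj r x} with hRX
  set RY : Finset V := {r ∈ R | ∀ y ∈ Y, r = y ∨ G.Adj r y} with hRY
  have memRX : ∀ r, r ∈ RX ↔ r ∈ R ∧ ∀ x ∈ X, r = x ∨ G.Adj r x := by simp [hRX]
  have memRY : ∀ r, r ∈ RY ↔ r ∈ R ∧ ∀ y ∈ Y, r = y ∨ G.Adj r y := by simp [hRY]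
  have hXRY : X ⊆ RY := fun x hx => (memRY x).2 ⟨((memX x).1 hx).1, hXY x hx⟩
  have hYRX : Y ⊆ RX := fun y hy => (memRX y).2 ⟨((memY y).1 hy).1, fun x hx =>
    (hXY x hx y hy).imp Eq.symm fun e => e.symm⟩
  have hdR : ∀ v ∈ R, d v ≤ d (f a) := fun v hv =>
    h.degree_outer_le (mem_outer.1 hv).1 (mem_outer.1 hv).2 a
  have hcRX : #RX ≤ d (f a) := by
    refine le_trans ?_ (hdR x₀ ((memX _).1 hx₀).1)
    rw [← h.degree_eq]
    exact card_le_degree_of_adj G ((memX _).1 hx₀).2.symm (fun e => hv₀R ((memRX _).1 e).1)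
      fun v hv => ((memRX v).1 hv).2 x₀ hx₀
  have hcRY : #RY ≤ d (f a) := by
    refine le_trans ?_ (hdR y₀ hy₀)
    rw [← h.degree_eq]
    exact card_le_degree_of_adj G hay₀.symm (fun e => hfR a ((memRY _).1 e).1)
      fun v hv => ((memRY v).1 hv).2 y₀ hy₀Y
  set I := RX ∩ RY with hI
  have hcI : d (f a) ≤ #I + (k + 3) := by
    rcases hclq with hc | hc
    · have : X ⊆ I := fun x hx =>
        mem_inter.2 ⟨(memRX x).2 ⟨((memX x).1 hx).1, hc x hx⟩, hXRY hx⟩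
      have := card_le_card this
      have := hmax (f a)
      omega
    · have : Y ⊆ I := fun y hy =>
        mem_inter.2 ⟨hYRX hy, (memRY y).2 ⟨((memY y).1 hy).1, hc y hy⟩⟩
      have := card_le_card this
      omega
  have hcX : #X ≤ d (f a) := (card_le_card hXRY).trans hcRY
  set U := R \ (RX ∪ RY) with hU
  have memU : ∀ u, u ∈ U ↔ u ∈ R ∧ u ∉ RX ∧ u ∉ RY := by simp [hU]
  have hUx : ∀ u ∈ U, ∃ x ∈ X, u ≠ x ∧ ¬ G.Adj u x := by
    intro u hu
    rw [memU, memRX] at hu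
    by_contra! hcon
    exact hu.2.1 ⟨hu.1, fun x hx => or_iff_not_imp_left.2 (hcon x hx)⟩
  have hUy : ∀ u ∈ U, ∃ y ∈ Y, u ≠ y ∧ ¬ G.Adj u y := by
    intro u hu
    rw [memU, memRY] at hu
    by_contra! hcon
    exact hu.2.2 ⟨hu.1, fun x hx => or_iff_not_imp_left.2 (hcon x hx)⟩
  have hUv : ∀ u ∈ U, ¬ G.Adj u v₀ := fun u hu e =>
    ((memU u).1 hu).2.2 (hXRY ((memX u).2 ⟨((memU u).1 hu).1, e.symm⟩))
  have hUa : ∀ u ∈ U, ¬ G.Adj u (f a) := fun u hu e =>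
    ((memU u).1 hu).2.1 (hYRX ((memY u).2 ⟨((memU u).1 hu).1, e.symm⟩))
  have hnbrX : ∀ u ∈ U, ∀ p, G.Adj u p → ∀ x ∈ X, p = x ∨ G.Adj p x := by
    intro u hu p hup x hx
    by_contra! hcon
    obtain ⟨y, hy, n1, n2⟩ := hUy u hu
    exact hsw x hx y hy p u (by rintro rfl; exact hUv u hu hup) (by rintro rfl; exact hUa u hu hup)
      hcon.1 hcon.2 ((memU u).1 hu).1 n1 n2 hup.symm
  have hnbrI : ∀ u ∈ U, ∀ p ∈ R, G.Adj u p → p ∈ I := by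
    intro u hu p hp hup
    refine mem_inter.2 ⟨(memRX p).2 ⟨hp, hnbrX u hu p hup⟩, (memRY p).2 ⟨hp, fun y hy => ?_⟩⟩
    by_contra! hcon
    obtain ⟨x, hx, n1, n2⟩ := hUx u hu
    have hu' := mem_outer.1 ((memU u).1 hu).1
    exact hsw x hx y hy u p hu'.1 (hu'.2 a) n1 n2 hp hcon.1 hcon.2 hup
  have hUX : Disjoint U X := by
    rw [Finset.disjoint_left]
    intro u hu hx
    exact ((memU u).1 hu).2.2 (hXRY hx)
  have hdegU : ∀ u ∈ U, d u ≤ #{c ∈ univ.image f | G.Adj u c} + #{q ∈ I | G.Adj u q} := by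
    intro u hu
    rw [← h.degree_eq, degree_eq_card_filter, ← card_union_of_disjoint]
    · refine card_le_card fun p hp => ?_
      simp only [mem_filter, mem_univ, true_and, mem_union, mem_image] at hp ⊢
      by_cases hpf : ∃ b, f b = p
      · exact Or.inl ⟨hpf, hp⟩
      · push Not at hpf
        refine Or.inr ⟨hnbrI u hu p (mem_outer.2 ⟨?_, fun b e => hpf b e.symm⟩) hp, hp⟩
        rintro rfl
        exact hUv u hu hp
    · rw [Finset.disjoint_left]
      intro p hp hp'
      simp only [mem_filter, mem_image, mem_univ, true_and] at hp hp'
      obtain ⟨⟨b, rfl⟩, -⟩ := hp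
      exact hfR b ((memRX _).1 (mem_inter.1 hp'.1).1).1
  have hcopy : ∀ b, #{u ∈ U | G.Adj (f b) u} ≤ roleDefect b := by
    intro b
    rcases ({u ∈ U | G.Adj (f b) u} : Finset V).eq_empty_or_nonempty with he | ⟨u, hu⟩
    · simp [he]
    · simp only [mem_filter] at hu
      have hbX := hnbrX u hu.1 (f b) hu.2.symm
      have hle := h.toIsPlaced.card_role_neighbors_le b
        (({u ∈ U | G.Adj (f b) u} : Finset V) ∪ X) (by
          intro v hv
          simp only [mem_union, mem_filter] at hv
          rcases hv with hv | hv
          · exact ⟨hv.2, fun c _ => (mem_outer.1 ((memU v).1 hv.1).1).2 c⟩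
          · have hv' := (mem_outer.1 ((memX v).1 hv).1).2
            exact ⟨(hbX v hv).resolve_left (hv' b).symm, fun c _ => hv' c⟩)
      rw [card_union_of_disjoint (disjoint_of_subset_left (filter_subset _ _) hUX)] at hle
      have := hmax (f b)
      omega
  have hinner : ∀ q ∈ I, #{u ∈ U | G.Adj q u} ≤ d (f a) - #X := by
    intro q hq
    have hq' := (memRX q).1 (mem_inter.1 hq).1
    have hqd := hdR q hq'.1
    have hle : #X + #{u ∈ U | G.Adj q u} ≤ d q := by
      rw [← h.degree_eq, degree_eq_card_filter]
      by_cases hqX : q ∈ X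
      · have hdis : Disjoint (insert v₀ (X.erase q)) ({u ∈ U | G.Adj q u} : Finset V) := by
          rw [Finset.disjoint_left]
          intro v hv hv'
          simp only [mem_insert, mem_erase, mem_filter] at hv hv'
          rcases hv with rfl | hv
          · exact hv₀R ((memU _).1 hv'.1).1
          · exact Finset.disjoint_left.1 hUX hv'.1 hv.2
        have hcard : #(insert v₀ (X.erase q)) = #X := by
          rw [card_insert_of_notMem, card_erase_add_one hqX]
          exact fun e => hv₀R ((memX _).1 (mem_of_mem_erase e)).1
        rw [← hcard, ← card_union_of_disjoint hdis]
        refine card_le_card fun v hv => ?_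
        simp only [mem_union, mem_insert, mem_erase, mem_filter, mem_univ, true_and] at hv ⊢
        rcases hv with (rfl | hv) | hv
        · exact ((memX q).1 hqX).2.symm
        · exact (hq'.2 v hv.2).resolve_left (Ne.symm hv.1)
        · exact hv.2
      · rw [← card_union_of_disjoint (disjoint_of_subset_right (filter_subset _ _) hUX.symm)]
        refine card_le_card fun v hv => ?_
        simp only [mem_union, mem_filter, mem_univ, true_and] at hv ⊢
        rcases hv with hv | hv
        · exact (hq'.2 v hv).resolve_left (by rintro rfl; exact hqX hv)
        · exact hv.2
    omega
  have hsumU : ∑ u ∈ U, d u ≤ 8 + #I * (d (f a) - #X) := by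
    refine (sum_le_sum hdegU).trans ?_
    rw [sum_add_distrib, sum_card_adj_comm G U (univ.image f), sum_card_adj_comm G U I,
      sum_image fun a _ b _ e => h.injective e, ← sum_roleDefect (k := k)]
    exact add_le_add (sum_le_sum fun b _ => hcopy b) (sum_le_card_nsmul _ _ _ hinner)
  have hsumR : ∑ v ∈ R, d v ≤ #(RX ∪ RY) * d (f a) + ∑ u ∈ U, d u := by
    rw [hU, ← sum_sdiff (s₁ := RX ∪ RY) (s₂ := R), add_comm]
    · refine Nat.add_le_add_right (sum_le_card_nsmul _ _ _ fun v hv => hdR v ?_) _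
      rcases mem_union.1 hv with hv | hv
      · exact ((memRX v).1 hv).1
      · exact ((memRY v).1 hv).1
    · exact union_subset (filter_subset _ _) (filter_subset _ _)
  have hsumC : ∑ b, d (f b) ≤ d (f a) + (k + 3) * d v₀ := by
    rw [← add_sum_erase univ _ (mem_univ a)]
    refine Nat.add_le_add_left ((sum_le_card_nsmul _ _ _ fun b _ => hmax (f b)).trans ?_) _
    rw [card_erase_of_mem (mem_univ a)]
    simp
  have htot := h.toIsPlaced.sum_eq d
  have hunion := card_union_add_card_inter RX RY
  rw [← hI] at hunion
  rw [← hR] at htot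
  exact degree_sum_contradiction hn hS hdX ht hcI hcX
    (show #(RX ∪ RY) + #I ≤ 2 * d (f a) by omega)
    (show ∑ v, d v ≤ d v₀ + (d (f a) + (k + 3) * d v₀) +
      (#(RX ∪ RY) * d (f a) + (8 + #I * (d (f a) - #X))) by omega)

end OuterNeighborBound

section Saturation

variable {V : Type} [Fintype V] {k : ℕ} {d : V → ℕ} {v₀ : V} {G : SimpleGraph V}
  {f : Fin k ⊕ Fin 4 → V}

lemma le_max_degree {n S D : ℕ} (hn : 5 * k + 36 ≤ n)
    (hS : n * (2 * k + 3) + 1 ≤ S + k ^ 2 + 4 * k) (hle : S ≤ n * D) : k + 4 ≤ D := by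
  by_contra! hlt
  have h1 : n * D ≤ n * (k + 3) := Nat.mul_le_mul_left n (by omega)
  nlinarith

/-- If `z` misses an outer neighbour `x` of `v₀`, and `y` is adjacent to `x` and lighter than `z`,
then all outer neighbours of `z` are neighbours of `y`. -/
lemma IsOptimal.adj_of_reach_max (h : IsOptimal d v₀ G f)
    (hreach : ∀ G' f', IsOptimal (k := k) d v₀ G' f' → reach v₀ G' f' ≤ reach v₀ G f)
    {g z : Fin k ⊕ Fin 4} (hgz : roleWeight g < roleWeight z)
    (hg : ∀ x ∈ outer v₀ f, G.Adj v₀ x → G.Adj (f g) x)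
    {x : V} (hx : x ∈ outer v₀ f) (hvx : G.Adj v₀ x) (hzx : ¬ G.Adj (f z) x)
    {u : V} (hu : u ∈ outer v₀ f) (hzu : G.Adj (f z) u) : G.Adj (f g) u := by
  by_contra hgu
  have hgz' : g ≠ z := by rintro rfl; exact lt_irrefl _ hgz
  have hux : ¬ G.Adj v₀ u := fun e => hgu (hg u hu e)
  have hx' := mem_outer.1 hx
  have hu' := mem_outer.1 hu
  obtain ⟨G', hG', key⟩ := h.toIsPlaced.switch (hg x hx hvx).symm hzu (hx'.2 z) (hu'.2 g).symm
    (fun e => hzx e.symm) hgu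
    (fun p q _ => ⟨fun e => hx'.2 p e.1.symm, fun e => hu'.2 q e.2.symm⟩)
  have hv₀ : ∀ v, G'.Adj v₀ v ↔ G.Adj v₀ v := by
    intro v
    rw [key]
    have h1 := h.avoid g
    have h2 := h.avoid z
    have h3 := hx'.1
    have h4 := hu'.1
    grind
  have hopt : IsOptimal d v₀ G' f := h.of_switch hG' fun a ha => (hv₀ _).2 ha
  refine absurd (hreach _ _ hopt) (not_le.2 ?_)
  have hcount : ∀ a, a ≠ g → a ≠ z →
      ({x | G'.Adj v₀ x ∧ (∀ b, x ≠ f b) ∧ G'.Adj (f a) x} : Finset V) =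
        ({x | G.Adj v₀ x ∧ (∀ b, x ≠ f b) ∧ G.Adj (f a) x} : Finset V) := by
    intro a ag az
    ext v
    simp only [mem_filter, mem_univ, true_and, hv₀, key]
    have h1 : f a ≠ f g := fun e => ag (h.injective e)
    have h2 : f a ≠ f z := fun e => az (h.injective e)
    have h3 := hx'.2 a
    have h4 := hu'.2 a
    grind
  have hcg : #{v | G.Adj v₀ v ∧ (∀ b, v ≠ f b) ∧ G.Adj (f g) v} ≤
      #{v | G'.Adj v₀ v ∧ (∀ b, v ≠ f b) ∧ G'.Adj (f g) v} + 1 := by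
    refine (card_le_card (t := insert x _) fun v hv => ?_).trans (card_insert_le _ _)
    simp only [mem_insert, mem_filter, mem_univ, true_and, hv₀] at hv ⊢
    by_cases hvx' : v = x
    · exact Or.inl hvx'
    · refine Or.inr ⟨hv.1, hv.2.1, (key _ _).2 (Or.inl ⟨hv.2.2, ?_, ?_⟩)⟩
      · rintro (e | e)
        · exact hx'.2 g e.1.symm
        · exact hvx' e.2
      · rintro (e | e)
        · exact hgz' (h.injective e.1)
        · exact hu'.2 g e.1.symm
  have hcz : #{v | G.Adj v₀ v ∧ (∀ b, v ≠ f b) ∧ G.Adj (f z) v} + 1 ≤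
      #{v | G'.Adj v₀ v ∧ (∀ b, v ≠ f b) ∧ G'.Adj (f z) v} := by
    have hnot : x ∉ ({v | G.Adj v₀ v ∧ (∀ b, v ≠ f b) ∧ G.Adj (f z) v} : Finset V) := by
      simp only [mem_filter, mem_univ, true_and]
      exact fun e => hzx e.2.2
    rw [← card_insert_of_notMem hnot]
    refine card_le_card fun v hv => ?_
    simp only [mem_insert, mem_filter, mem_univ, true_and, hv₀] at hv ⊢
    rcases hv with rfl | hv
    · exact ⟨hvx, hx'.2, (key _ _).2 (Or.inr (Or.inl (Or.inr ⟨rfl, rfl⟩)))⟩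
    · refine ⟨hv.1, hv.2.1, (key _ _).2 (Or.inl ⟨hv.2.2, ?_, ?_⟩)⟩
      · rintro (e | e)
        · exact hx'.2 z e.1.symm
        · exact hgz' (h.injective e.1).symm
      · rintro (e | e)
        · exact hux (e.2 ▸ hv.1)
        · exact hu'.2 z e.1.symm
  have split : ∀ φ : Fin k ⊕ Fin 4 → ℕ,
      ∑ c, φ c = φ g + φ z + ∑ c ∈ (univ.erase g).erase z, φ c := by
    intro φ
    rw [← add_sum_erase univ φ (mem_univ g), ← add_sum_erase (univ.erase g) φ
      (mem_erase.2 ⟨hgz'.symm, mem_univ z⟩), add_assoc]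
  rw [reach, reach, split, split]
  refine add_lt_add_of_lt_of_le ?_ (le_of_eq (sum_congr rfl fun c hc => ?_))
  · have i1 := Nat.mul_le_mul_left (roleWeight g) hcg
    have i2 := Nat.mul_le_mul_left (roleWeight z) hcz
    rw [mul_add, mul_one] at i1 i2
    omega
  · simp only [mem_erase, mem_univ, and_true] at hc
    rw [hcount c hc.2 hc.1]

/-- If all realizations only have small cliques, then in an optimal copy which also maximizes
`reach`, all vertices are adjacent to `v₀`. -/
lemma IsOptimal.adj_all (h : IsOptimal d v₀ G f)
    (hreach : ∀ G' f', IsOptimal (k := k) d v₀ G' f' → reach v₀ G' f' ≤ reach v₀ G f)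
    (hmax : ∀ v, d v ≤ d v₀) (hn : 5 * k + 36 ≤ Fintype.card V)
    (hS : Fintype.card V * (2 * k + 3) + 1 ≤ ∑ v, d v + k ^ 2 + 4 * k)
    (hclique : ∀ G' : SimpleGraph V, (∀ v, G'.degree v = d v) →
      ∀ s : Finset V, G'.IsClique s → #s ≤ k + 4) (a : Fin k ⊕ Fin 4) : G.Adj v₀ (f a) := by
  by_contra ha
  have ha' : ¬ G.Adj (f a) v₀ := fun e => ha e.symm
  have hv₀ : k + 4 ≤ d v₀ := le_max_degree hn hS (sum_le_card_nsmul _ _ _ fun v _ => hmax v)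
  set R := outer v₀ f with hR
  set X : Finset V := {x ∈ R | G.Adj v₀ x} with hX
  have memX : ∀ x, x ∈ X ↔ x ∈ R ∧ G.Adj v₀ x := by simp [hX]
  have hdX : d v₀ ≤ #X + (k + 3) := h.toIsPlaced.degree_le_outer ha (G.loopless.irrefl v₀)
  obtain ⟨x₀, hx₀⟩ : X.Nonempty := by rw [← card_pos]; omega
  have hx₀' := (memX _).1 hx₀
  have haR : ∀ v ∈ R, ¬ G.Adj (f a) v := fun v hv =>
    h.not_adj_outer hmax hn hS (hclique G h.degree_eq) hv₀ ha hv
  have ht : d (f a) ≤ k + 3 := by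
    have := h.toIsPlaced.degree_le_outer (G.loopless.irrefl (f a)) ha'
    rwa [filter_eq_empty_iff.2 haR, card_empty, zero_add] at this
  obtain ⟨g, hag, hgH⟩ : ∃ g, G.Adj (f a) (f g) ∧ ¬ (roleGraph k).Adj a g := by
    by_contra! hcon
    have hsub : ({v | G.Adj (f a) v} : Finset V) ⊆
        ({b | (roleGraph k).Adj a b} : Finset _).image f := by
      intro v hv
      simp only [mem_filter, mem_univ, true_and] at hv
      by_cases hvf : ∃ b, f b = v
      · obtain ⟨b, rfl⟩ := hvf
        exact mem_image_of_mem f (by simpa using hcon b hv)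
      · push Not at hvf
        exact absurd hv (haR v (mem_outer.2 ⟨by rintro rfl; exact ha' hv,
          fun b e => hvf b e.symm⟩))
    have hc := card_le_card hsub
    rw [← degree_eq_card_filter, h.degree_eq, card_image_of_injective _ h.injective] at hc
    have := card_role_neighbors_add_defect a
    have := h.le_degree_add_defect hn hS a
    omega
  have hgane : g ≠ a := by rintro rfl; exact G.loopless.irrefl _ hag
  have hgnot : ∀ b, (roleGraph k).Adj a b → f g ≠ f b := fun b hb e =>
    hgH (h.injective e ▸ hb)
  have hXg : ∀ x ∈ R, G.Adj v₀ x → G.Adj (f g) x := fun x hx hvx =>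
    ((h.eq_or_adj ha hvx (mem_outer.1 hx).2 hag hgnot).resolve_left
      ((mem_outer.1 hx).2 g)).symm
  have hloose : ∀ p q, (roleGraph k).Adj p q → ¬ (f p = f a ∧ f q = f g) := fun p q hpq e =>
    hgH (h.injective e.1 ▸ h.injective e.2 ▸ hpq)
  have hvg : G.Adj v₀ (f g) := by
    by_contra hvg
    have hx := mem_outer.1 hx₀'.1
    obtain ⟨G', hG', key⟩ := h.toIsPlaced.switch hag hx₀'.2.symm (hx.2 a).symm (h.avoid g)
      (haR x₀ hx₀'.1) (fun e => hvg e.symm)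
      (fun p q hpq => ⟨hloose p q hpq, fun e => h.avoid q e.2⟩)
    refine hvg (h.adj_of_adj hG' (fun b hb => (key _ _).2 (Or.inl ⟨hb, ?_, ?_⟩)) (a := g)
      ((key _ _).2 (Or.inr (Or.inr (Or.inr ⟨rfl, rfl⟩)))))
    · rintro (e | e)
      · exact h.avoid a e.1.symm
      · exact h.avoid g e.1.symm
    · rintro (e | e)
      · exact hx.1 e.1.symm
      · exact hx.2 b e.2.symm
  have hedge : ∀ p ∈ R, ∀ q ∈ R, G.Adj p q → G.Adj (f g) q := by
    intro p hp q hq hpq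
    by_contra hgq
    have hp' := mem_outer.1 hp
    have hq' := mem_outer.1 hq
    obtain ⟨G', hG', key⟩ := h.toIsPlaced.switch hag hpq (hp'.2 a).symm (hq'.2 g).symm
      (haR p hp) hgq (fun b c hbc => ⟨hloose b c hbc, fun e => hp'.2 b e.1.symm⟩)
    have hv : ∀ v, G'.Adj v₀ v ↔ G.Adj v₀ v := by
      intro v
      rw [key]
      have h1 := h.avoid g
      have h2 := h.avoid a
      have h3 := hp'.1
      have h4 := hq'.1
      grind
    have hopt : IsOptimal d v₀ G' f := h.of_switch hG' fun b hb => (hv _).2 hb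
    exact hopt.not_adj_outer hmax hn hS (hclique G' hG'.degree_eq) hv₀
      (fun e => ha ((hv _).1 e)) hp ((key _ _).2 (Or.inr (Or.inl (Or.inl ⟨rfl, rfl⟩))))
  have hRg : #{u ∈ R | G.Adj (f g) u} + 2 + (k + 3) ≤ d (f g) + roleDefect g := by
    have hle := h.toIsPlaced.card_role_neighbors_le g
      (insert v₀ (insert (f a) ({u ∈ R | G.Adj (f g) u} : Finset V))) (by
        intro v hv
        simp only [mem_insert, mem_filter] at hv
        rcases hv with rfl | rfl | hv
        · exact ⟨hvg.symm, fun b _ => (h.avoid b).symm⟩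
        · exact ⟨hag.symm, fun b hb e => hgH (h.injective e ▸ hb).symm⟩
        · exact ⟨hv.2, fun b _ => (mem_outer.1 hv.1).2 b⟩)
    rw [card_insert_of_notMem, card_insert_of_notMem] at hle
    · omega
    · simp only [mem_filter, not_and]
      exact fun e => absurd rfl ((mem_outer.1 e).2 a)
    · simp only [mem_insert, mem_filter, not_or, not_and]
      exact ⟨(h.avoid a).symm, fun e => absurd rfl (mem_outer.1 e).1⟩
  have hdg := roleDefect_le g
  have hmiss : ∀ z, (roleGraph k).Adj a z → #{x ∈ X | ¬ G.Adj (f z) x} ≤ 2 := by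
    intro z hz
    rcases ({x ∈ X | ¬ G.Adj (f z) x} : Finset V).eq_empty_or_nonempty with he | ⟨x, hx⟩
    · simp [he]
    simp only [mem_filter, memX] at hx
    have hw : roleWeight g < roleWeight z := by
      have h1 := hz.2
      have h2 : ¬ 5 ≤ roleWeight a + roleWeight g := fun e => hgH ⟨hgane.symm, e⟩
      omega
    have hzg := fun u hu => h.adj_of_reach_max hreach hw hXg hx.1.1 hx.1.2 hx.2 (u := u) hu
    have hdz : d (f z) ≤ #{u ∈ R | G.Adj (f z) u} + (k + 4) := by
      have hs : ({v | G.Adj (f z) v} : Finset V) ⊆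
          ({u ∈ R | G.Adj (f z) u} : Finset V) ∪ (insert v₀ ((univ.image f).erase (f z))) := by
        intro v hv
        simp only [mem_filter, mem_univ, true_and] at hv
        simp only [mem_union, mem_filter, mem_insert, mem_erase, mem_image, mem_univ, true_and]
        by_cases hvf : ∃ b, f b = v
        · exact Or.inr (Or.inr ⟨hv.ne', hvf⟩)
        · push Not at hvf
          by_cases hvv : v = v₀
          · exact Or.inr (Or.inl hvv)
          · exact Or.inl ⟨mem_outer.2 ⟨hvv, fun b e => hvf b e.symm⟩, hv⟩
      have hc := (card_le_card hs).trans (card_union_le _ _)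
      have hc' := card_insert_le v₀ ((univ.image f).erase (f z))
      rw [card_erase_of_mem (by simp), card_image_univ_role h.injective] at hc'
      rw [← degree_eq_card_filter, h.degree_eq] at hc
      omega
    have hsum : #{u ∈ R | G.Adj (f z) u} + #{x ∈ X | ¬ G.Adj (f z) x} ≤
        #{u ∈ R | G.Adj (f g) u} := by
      rw [← card_union_of_disjoint]
      · refine card_le_card fun u hu => ?_
        simp only [mem_union, mem_filter, memX] at hu ⊢
        rcases hu with hu | hu
        · exact ⟨hu.1, hzg u hu.1 hu.2⟩
        · exact ⟨hu.1.1, hXg u hu.1.1 hu.1.2⟩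
      · rw [Finset.disjoint_left]
        intro u hu hu'
        exact (mem_filter.1 hu').2 (mem_filter.1 hu).2
    have := h.degree_le_of_weight_lt hw
    omega
  have hsome : ∀ x ∈ X, ∃ z, (roleGraph k).Adj a z ∧ ¬ G.Adj (f z) x := by
    intro x hx
    by_contra! hcon
    rw [memX] at hx
    have hx' := mem_outer.1 hx.1
    have hP : IsPlaced d v₀ G (Function.update f a x) := by
      refine ⟨h.degree_eq, fun b c hbc => ?_, fun b => ?_, fun b c hbc => ?_⟩
      · simp only [Function.update_apply] at hbc
        split_ifs at hbc with e1 e2 e2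
        · rw [e1, e2]
        · exact absurd hbc (hx'.2 c)
        · exact absurd hbc.symm (hx'.2 b)
        · exact h.injective hbc
      · rw [Function.update_apply]
        split_ifs
        · exact hx'.1
        · exact h.avoid b
      · simp only [Function.update_apply]
        split_ifs with e1 e2 e2
        · exact absurd (e1.trans e2.symm) hbc.1
        · subst e1; exact (hcon c hbc).symm
        · subst e2; exact hcon b hbc.symm
        · exact h.adj b c hbc
    refine ha (h.adj_of_adj hP (fun b hb => ?_) (a := a) (by simpa using hx.2))
    rw [Function.update_apply]
    split_ifs
    · exact hx.2
    · exact hb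
  have hcX : #X ≤ 2 * (k + 2) := by
    have hsub : X ⊆ ({z | (roleGraph k).Adj a z} : Finset _).biUnion
        fun z => {x ∈ X | ¬ G.Adj (f z) x} := by
      intro x hx
      obtain ⟨z, hz, hzx⟩ := hsome x hx
      simp only [mem_biUnion, mem_filter, mem_univ, true_and]
      exact ⟨z, hz, hx, hzx⟩
    have hc := (card_le_card hsub).trans (card_biUnion_le_card_mul _ _ 2 fun z hz =>
      hmiss z (by simpa using hz))
    have hsub' : ({z | (roleGraph k).Adj a z} : Finset _) ⊆ (univ.erase a).erase g := by
      intro z hz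
      simp only [mem_filter, mem_univ, true_and, mem_erase, and_true] at hz ⊢
      exact ⟨by rintro rfl; exact hgH hz, hz.1.symm⟩
    have hc' := card_le_card hsub'
    rw [card_erase_of_mem (mem_erase.2 ⟨hgane, mem_univ g⟩), card_erase_of_mem (mem_univ a)] at hc'
    simp only [card_univ, Fintype.card_sum, Fintype.card_fin] at hc'
    omega
  have hR0 : ∑ u ∈ R with ¬ G.Adj (f g) u, d u ≤ (k + 2) * d v₀ := by
    set C : Finset V := (((univ : Finset (Fin k ⊕ Fin 4)).erase a).erase g).image f with hC
    have hcard : #C = k + 2 := by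
      rw [hC, card_image_of_injective _ h.injective,
        card_erase_of_mem (mem_erase.2 ⟨hgane, mem_univ g⟩), card_erase_of_mem (mem_univ a)]
      simp
    have hle : ∀ u ∈ ({u ∈ R | ¬ G.Adj (f g) u} : Finset V), d u ≤ #{c ∈ C | G.Adj u c} := by
      intro u hu
      rw [mem_filter] at hu
      rw [← h.degree_eq, degree_eq_card_filter]
      refine card_le_card fun v hv => ?_
      simp only [mem_filter, mem_univ, true_and] at hv ⊢
      refine ⟨?_, hv⟩
      by_cases hvf : ∃ b, f b = v
      · obtain ⟨b, rfl⟩ := hvf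
        refine mem_image_of_mem f (mem_erase.2 ⟨?_, mem_erase.2 ⟨?_, mem_univ b⟩⟩)
        · rintro rfl; exact hu.2 hv.symm
        · rintro rfl; exact haR u hu.1 hv.symm
      · push Not at hvf
        refine absurd ?_ hu.2
        by_cases hvv : v = v₀
        · subst hvv; exact hXg u hu.1 hv.symm
        · exact hedge v (mem_outer.2 ⟨hvv, fun b e => hvf b e.symm⟩) u hu.1 hv.symm
    refine (sum_le_sum hle).trans ?_
    rw [sum_card_adj_comm, ← hcard]
    refine sum_le_card_nsmul _ _ _ fun c _ => ?_
    refine le_trans (card_le_card (filter_subset_filter _ (subset_univ _))) ?_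
    rw [← degree_eq_card_filter, h.degree_eq]
    exact hmax c
  have hR1 : ∑ u ∈ R with G.Adj (f g) u, d u ≤ (2 * k + 5) * (k + 3) := by
    refine (sum_le_card_nsmul _ _ (k + 3) fun u hu => ?_).trans
      (Nat.mul_le_mul_right _ (by have := hmax (f g); omega))
    have hu' := mem_outer.1 (mem_filter.1 hu).1
    exact (h.degree_outer_le hu'.1 hu'.2 a).trans ht
  have hsumC : ∑ b, d (f b) ≤ (k + 4) * d v₀ := by
    refine (sum_le_card_nsmul _ _ _ fun b _ => hmax (f b)).trans ?_
    simp
  have htot := h.toIsPlaced.sum_eq d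
  rw [← hR, ← sum_filter_add_sum_filter_not R (fun u => G.Adj (f g) u)] at htot
  have hD : d v₀ ≤ 3 * k + 7 := by omega
  have q1 := Nat.mul_le_mul_left (k + 2) hD
  have q2 := Nat.mul_le_mul_left (k + 4) hD
  have q3 := Nat.mul_le_mul_right (2 * k + 3) hn
  have : ∑ v, d v ≤ 3 * k + 7 + (k + 4) * (3 * k + 7) + ((2 * k + 5) * (k + 3) +
    (k + 2) * (3 * k + 7)) := by omega
  clear hreach hclique
  nlinarith

end Saturation

section Induction

lemma degree_eq_ite_add_card_subtype {V : Type} [Fintype V] (G : SimpleGraph V) (v₀ v : V) :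
    G.degree v = (if G.Adj v v₀ then 1 else 0) + #{w : {w // w ≠ v₀} | G.Adj v w} := by
  rw [degree_eq_card_filter, card_filter, card_filter, Fintype.sum_eq_add_sum_subtype_ne _ v₀]

lemma sum_degree_eq_add_sum_degree_subtype {V : Type} [Fintype V] (G : SimpleGraph V) (v₀ : V)
    (K : SimpleGraph {w // w ≠ v₀}) (hK : ∀ a b : {w // w ≠ v₀}, K.Adj a b ↔ G.Adj a b) :
    ∑ v, G.degree v = 2 * G.degree v₀ + ∑ w, K.degree w := by
  have h : ∀ w : {w // w ≠ v₀}, G.degree w.1 =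
      (if G.Adj w.1 v₀ then 1 else 0) + K.degree w := by
    intro w
    rw [degree_eq_ite_add_card_subtype G v₀, degree_eq_card_filter K]
    simp only [hK]
  have h0 : G.degree v₀ = ∑ w : {w // w ≠ v₀}, if G.Adj w.1 v₀ then 1 else 0 := by
    rw [degree_eq_ite_add_card_subtype G v₀, if_neg (G.loopless.irrefl v₀), zero_add, card_filter]
    simp only [G.adj_comm]
  rw [Fintype.sum_eq_add_sum_subtype_ne _ v₀, sum_congr rfl fun w _ => h w, sum_add_distrib, ← h0]
  ring

/-- Replacing the graph induced outside `v₀` by one with the same degrees. -/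
lemma exists_glue {V : Type} [Fintype V] (G : SimpleGraph V) (v₀ : V)
    (K H : SimpleGraph {w // w ≠ v₀}) (hK : ∀ a b : {w // w ≠ v₀}, K.Adj a b ↔ G.Adj a b)
    (hH : ∀ w, H.degree w = K.degree w) :
    ∃ G' : SimpleGraph V, (∀ v, G'.degree v = G.degree v) ∧
      ∀ a b : {w // w ≠ v₀}, G'.Adj a b ↔ H.Adj a b := by
  obtain ⟨G', key⟩ : ∃ G' : SimpleGraph V, ∀ a b, G'.Adj a b ↔
      (∃ (ha : a ≠ v₀) (hb : b ≠ v₀), H.Adj ⟨a, ha⟩ ⟨b, hb⟩) ∨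
      ((a = v₀ ∨ b = v₀) ∧ G.Adj a b) := by
    refine ⟨{ Adj := fun a b => _, symm := ⟨?_⟩, loopless := ⟨?_⟩ }, fun _ _ => Iff.rfl⟩
    · rintro a b (⟨ha, hb, hab⟩ | ⟨h, hab⟩)
      · exact Or.inl ⟨hb, ha, hab.symm⟩
      · exact Or.inr ⟨h.symm, hab.symm⟩
    · rintro a (⟨ha, hb, hab⟩ | ⟨h, hab⟩)
      · exact H.loopless.irrefl _ hab
      · exact G.loopless.irrefl _ hab
  have hsub : ∀ a b : {w // w ≠ v₀}, G'.Adj a b ↔ H.Adj a b := by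
    intro a b
    rw [key]
    simp [a.2, b.2]
  have hv₀ : ∀ v, G'.Adj v v₀ ↔ G.Adj v v₀ := by
    intro v
    rw [key]
    simp
  refine ⟨G', fun v => ?_, hsub⟩
  rw [degree_eq_ite_add_card_subtype G' v₀, degree_eq_ite_add_card_subtype G v₀]
  by_cases hv : v = v₀
  · subst hv
    simp only [G'.adj_comm v, G.adj_comm v, hv₀]
  · have h1 := hH ⟨v, hv⟩
    rw [degree_eq_card_filter, degree_eq_card_filter] at h1
    simp only [hK, ← hsub] at h1
    simp only [hv₀, h1]

lemma containsCopy_of_isClique {V β : Type} [Fintype β] {G : SimpleGraph V} {s : Finset V}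
    (hs : G.IsClique s) (hcard : Fintype.card β ≤ #s) (H : SimpleGraph β) : ContainsCopy G H := by
  obtain ⟨e⟩ : Nonempty (β ↪ s) :=
    Function.Embedding.nonempty_of_card_le (by rwa [Fintype.card_coe])
  refine ⟨e.trans (Function.Embedding.subtype _), fun u v huv => hs (e u).2 (e v).2 fun h => ?_⟩
  exact huv.ne (e.injective (Subtype.ext h))

/-- A placed copy all of whose vertices are adjacent to `v₀` extends by `v₀`. -/
lemma IsPlaced.containsCopy_succ {V : Type} [Fintype V] {k : ℕ} {d : V → ℕ} {v₀ : V}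
    {G : SimpleGraph V} {f : Fin k ⊕ Fin 4 → V} (h : IsPlaced d v₀ G f)
    (hadj : ∀ a, G.Adj v₀ (f a)) : ContainsCopy G (roleGraph (k + 1)) := by
  let φ : Fin (k + 1) ⊕ Fin 4 → Option (Fin k ⊕ Fin 4) :=
    Sum.elim (Fin.cases none fun i => some (.inl i)) fun j => some (.inr j)
  have hφ : Function.Injective φ := by
    rintro (i | i) (j | j) hij
    · induction i using Fin.cases <;> induction j using Fin.cases <;> simp_all [φ]
    · induction i using Fin.cases <;> simp_all [φ]
    · induction j using Fin.cases <;> simp_all [φ]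
    · simp_all [φ]
  have hw : ∀ a b, φ a = some b → roleWeight a = roleWeight b := by
    rintro (i | i) b hb
    · induction i using Fin.cases with
      | zero => simp [φ] at hb
      | succ i =>
        simp only [φ, Sum.elim_inl, Fin.cases_succ, Option.some.injEq] at hb
        subst hb
        rfl
    · simp only [φ, Sum.elim_inr, Option.some.injEq] at hb
      subst hb
      rfl
  let ψ : Option (Fin k ⊕ Fin 4) → V := fun o => o.elim v₀ f
  have hψ : Function.Injective ψ := by
    rintro (_ | a) (_ | b) hab
    · rfl
    · exact absurd hab.symm (h.avoid b)
    · exact absurd hab (h.avoid a)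
    · exact congrArg some (h.injective hab)
  refine ⟨⟨ψ ∘ φ, hψ.comp hφ⟩, fun a b hab => ?_⟩
  change G.Adj (ψ (φ a)) (ψ (φ b))
  rcases ha : φ a with _ | a' <;> rcases hb : φ b with _ | b'
  · exact absurd (hφ (ha.trans hb.symm)) hab.1
  · exact hadj b'
  · exact (hadj a').symm
  · refine h.adj a' b' ⟨?_, by rw [← hw a a' ha, ← hw b b' hb]; exact hab.2⟩
    rintro rfl
    exact hab.1 (hφ (ha.trans hb.symm))

/-- A large enough degree sum forces a realization containing `K_k ∨ (P₃ ∪ K₁)`. -/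
theorem exists_containsCopy_roleGraph (k : ℕ) : ∀ (V : Type) [Fintype V] (G : SimpleGraph V),
    5 * k + 31 ≤ Fintype.card V →
    Fintype.card V * (2 * k + 1) + 4 ≤ ∑ v, G.degree v + k ^ 2 + 2 * k →
    ∃ G' : SimpleGraph V, (∀ v, G'.degree v = G.degree v) ∧ ContainsCopy G' (roleGraph k) := by
  induction k with
  | zero =>
    intro V _ G hn hS
    obtain ⟨v, hv⟩ : ∃ v, 1 < #{u | G.Adj v u} := by
      by_contra! hcon
      have : ∑ v, G.degree v ≤ Fintype.card V * 1 := sum_le_card_nsmul _ _ _ fun v _ => by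
        rw [degree_eq_card_filter]; exact hcon v
      omega
    obtain ⟨x, hx, y, hy, hxy⟩ := one_lt_card.1 hv
    simp only [mem_filter, mem_univ, true_and] at hx hy
    obtain ⟨z, hz⟩ : ∃ z, z ∉ ({x, v, y} : Finset V) := by
      by_contra! hcon
      have h1 := card_le_card (fun z _ => hcon z : (univ : Finset V) ⊆ {x, v, y})
      have h2 := card_le_three (a := x) (b := v) (c := y)
      rw [card_univ] at h1
      omega
    simp only [mem_insert, mem_singleton, not_or] at hz
    refine ⟨G, fun _ => rfl, ⟨Sum.elim Fin.elim0 ![x, v, y, z], ?_⟩, ?_⟩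
    · have hxv := hx.ne
      have hyv := hy.ne
      rintro (i | i) (j | j) hij
      · exact i.elim0
      · exact i.elim0
      · exact j.elim0
      · fin_cases i <;> fin_cases j <;> simp_all
    · rintro (i | i) (j | j) hij
      · exact i.elim0
      · exact i.elim0
      · exact j.elim0
      · rw [roleGraph_adj] at hij
        fin_cases i <;> fin_cases j <;> simp [roleWeight] at hij ⊢ <;>
          first | exact hx | exact hy | exact hx.symm | exact hy.symm
  | succ k ih =>
    intro V _ G hn hS
    have : Nonempty V := Fintype.card_pos_iff.1 (by omega)
    obtain ⟨v₀, hmax⟩ := Finite.exists_max fun v => G.degree v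
    have hcard : Fintype.card {w // w ≠ v₀} + 1 = Fintype.card V := by
      have h := Fintype.sum_eq_add_sum_subtype_ne (fun _ => 1) v₀
      simp only [sum_const, card_univ, smul_eq_mul, mul_one] at h
      omega
    obtain ⟨K, hK⟩ : ∃ K : SimpleGraph {w // w ≠ v₀},
        ∀ a b : {w // w ≠ v₀}, K.Adj a b ↔ G.Adj a b := ⟨G.comap Subtype.val, fun _ _ => Iff.rfl⟩
    have hsum := sum_degree_eq_add_sum_degree_subtype G v₀ K hK
    have hlt := G.degree_lt_card_verts v₀
    obtain ⟨H, hH, φ, hφ⟩ := ih {w // w ≠ v₀} K (by omega) (by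
      have e : Fintype.card V * (2 * (k + 1) + 1) =
        Fintype.card {w // w ≠ v₀} * (2 * k + 1) + 2 * Fintype.card V + (2 * k + 1) := by
          rw [← hcard]; ring
      have e' : (k + 1) ^ 2 = k ^ 2 + 2 * k + 1 := by ring
      omega)
    obtain ⟨G₁, hd₁, hadj₁⟩ := exists_glue G v₀ K H hK hH
    have hP : IsPlaced (fun v => G.degree v) v₀ G₁ (fun a => (φ a).1) :=
      ⟨hd₁, fun a b e => φ.injective (Subtype.ext e), fun a => (φ a).2,
        fun a b hab => (hadj₁ _ _).2 (hφ a b hab)⟩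
    obtain ⟨G₂, f, hopt, hreach⟩ := exists_isOptimal hP
    by_contra! hcon
    refine hcon G₂ hopt.degree_eq (hopt.toIsPlaced.containsCopy_succ
      (hopt.adj_all hreach hmax (by omega) ?_ fun G' hd s hs => ?_))
    · have e : Fintype.card V * (2 * (k + 1) + 1) = Fintype.card V * (2 * k + 3) := by ring
      have e' : (k + 1) ^ 2 = k ^ 2 + 2 * k + 1 := by ring
      omega
    · by_contra! hs'
      exact hcon G' hd (containsCopy_of_isClique hs (by simp; omega) _)

end Induction

lemma card_filter_fin_val (n : ℕ) (P : ℕ → Prop) :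
    #{j : Fin n | P j} = #((range n).filter P) := by
  rw [← card_map Fin.valEmbedding]
  congr 1
  ext j
  simp only [mem_map, mem_filter, mem_univ, true_and, Fin.valEmbedding_apply, mem_range]
  exact ⟨fun ⟨i, hi, e⟩ => e ▸ ⟨i.2, hi⟩, fun ⟨hj, hP⟩ => ⟨⟨j, hj⟩, hP, rfl⟩⟩

/-- The adjacency of the join of `K_c` with a cycle on `c, …, n - 1` together with the chords
joining `p` and `p + h` for `c ≤ p < c + h`. -/
def chordAdj (c h n p q : ℕ) : Prop :=
  p ≠ q ∧ (p < c ∨ q < c ∨ q = p + 1 ∨ p = q + 1 ∨ (p = c ∧ q + 1 = n) ∨ (q = c ∧ p + 1 = n) ∨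
    (p < c + h ∧ q = p + h) ∨ (q < c + h ∧ p = q + h))

lemma card_chordAdj_of_lt {c h n p : ℕ} (hp : p < c) (hc : c ≤ n) :
    #((range n).filter (chordAdj c h n p)) = n - 1 := by
  rw [← card_range n, ← card_erase_of_mem (mem_range.2 (hp.trans_le hc)), card_range]
  congr 1
  ext j
  simp only [chordAdj, mem_filter, mem_range, mem_erase]
  omega

lemma card_chordAdj {c h n p : ℕ} (hh : 2 ≤ h) (hn : n = c + 2 * h ∨ n = c + 2 * h + 1)
    (hn' : c + 5 ≤ n) (hp : c ≤ p) (hpn : p < n) :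
    #((range n).filter (chordAdj c h n p)) = if p = c + 2 * h then c + 2 else c + 3 := by
  obtain ⟨x, hx⟩ : ∃ x, (p + 1 = n ∧ x = c) ∨ (p + 1 < n ∧ x = p + 1) := by
    by_cases hp1 : p + 1 = n
    · exact ⟨c, by omega⟩
    · exact ⟨p + 1, by omega⟩
  obtain ⟨y, hy⟩ : ∃ y, (p = c ∧ y + 1 = n) ∨ (c < p ∧ y + 1 = p) := by
    by_cases hp1 : p = c
    · exact ⟨n - 1, by omega⟩
    · exact ⟨p - 1, by omega⟩
  split_ifs with hlast
  · have e : (range n).filter (chordAdj c h n p) = insert x (insert y (range c)) := by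
      ext j
      simp only [chordAdj, mem_filter, mem_range, mem_insert]
      omega
    rw [e, card_insert_of_notMem, card_insert_of_notMem, card_range] <;>
      simp only [mem_insert, mem_range] <;> omega
  · obtain ⟨z, hz⟩ : ∃ z, (p < c + h ∧ z = p + h) ∨ (c + h ≤ p ∧ z + h = p) := by
      by_cases hp1 : p < c + h
      · exact ⟨p + h, by omega⟩
      · exact ⟨p - h, by omega⟩
    have e : (range n).filter (chordAdj c h n p) =
        insert x (insert y (insert z (range c))) := by
      ext j
      simp only [chordAdj, mem_filter, mem_range, mem_insert]
      omega
    rw [e, card_insert_of_notMem, card_insert_of_notMem, card_insert_of_notMem, card_range] <;>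
      simp only [mem_insert, mem_range] <;> omega

/-- A graphic sequence of large sum with only `c` terms exceeding `c + 3`. -/
lemma exists_isGraphic_le {c n : ℕ} (hn : c + 5 ≤ n) :
    ∃ d : Fin n → ℕ, IsGraphic d ∧
      ∑ i, d i + (n - c) % 2 = c * (n - 1) + (n - c) * (c + 3) ∧
      ∀ i : Fin n, c ≤ i → d i ≤ c + 3 := by
  obtain ⟨h, hh⟩ : ∃ h, n = c + 2 * h ∨ n = c + 2 * h + 1 := ⟨(n - c) / 2, by omega⟩
  let D : ℕ → ℕ := fun p => if p < c then n - 1 else if p = c + 2 * h then c + 2 else c + 3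
  obtain ⟨G, hG⟩ : ∃ G : SimpleGraph (Fin n), ∀ u v, G.Adj u v ↔ chordAdj c h n u v :=
    ⟨{ Adj := fun u v => chordAdj c h n u v
       symm := ⟨fun u v => by simp only [chordAdj]; omega⟩
       loopless := ⟨fun u => by simp only [chordAdj]; omega⟩ }, fun _ _ => Iff.rfl⟩
  have hdeg : ∀ i, G.degree i = D i := by
    intro i
    rw [degree_eq_card_filter]
    simp only [hG]
    rw [card_filter_fin_val n (chordAdj c h n i)]
    simp only [D]
    split_ifs with h1 h2
    · exact card_chordAdj_of_lt h1 (by omega)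
    · rw [card_chordAdj (by omega) hh hn (by omega) i.2, if_pos h2]
    · rw [card_chordAdj (by omega) hh hn (by omega) i.2, if_neg h2]
  refine ⟨fun i => D i, ⟨?_, G, hdeg⟩, ?_, ?_⟩
  · intro i j hij
    have hij' : (i : ℕ) ≤ j := hij
    have := i.2
    have := j.2
    simp only [D]
    split_ifs <;> omega
  · rw [Fin.sum_univ_eq_sum_range D n]
    have hfirst : ∀ p ∈ range c, D p = n - 1 := fun p hp => if_pos (mem_range.1 hp)
    have hmid : ∀ p ∈ range (2 * h), D (c + p) = c + 3 := fun p hp => by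
      have := mem_range.1 hp
      simp only [D]
      rw [if_neg (by omega), if_neg (by omega)]
    have hsum : ∑ p ∈ range (c + 2 * h), D p = c * (n - 1) + 2 * h * (c + 3) := by
      rw [sum_range_add, sum_congr rfl hfirst, sum_congr rfl hmid]
      simp
    rcases hh with hh | hh
    · rw [show n - c = 2 * h by omega, ← hsum, Nat.mul_mod_right, add_zero, ← hh]
    · have hl : D (c + 2 * h) = c + 2 := by
        simp [D]
      rw [show range n = range (c + 2 * h + 1) by rw [hh], sum_range_succ, hsum, hl,
        show n - c = 2 * h + 1 by omega, add_one_mul, Nat.mul_add_mod]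
      omega
  · intro i hi
    simp only [D]
    split_ifs <;> omega

lemma KsubH_adj {m k : ℕ} {h : k ≤ m} {H : SimpleGraph (Fin k)} {u v : Fin m} :
    (KsubH m k h H).Adj u v ↔
      u ≠ v ∧ ∀ a b, H.Adj a b → Fin.castLE h a = u → Fin.castLE h b ≠ v := by
  rw [KsubH, sdiff_adj, SimpleGraph.map_adj]
  simp

lemma KsubH_mono {m k : ℕ} {h : k ≤ m} {H H' : SimpleGraph (Fin k)} (hH : H ≤ H') :
    KsubH m k h H' ≤ KsubH m k h H := fun _ _ huv =>
  KsubH_adj.2 ⟨(KsubH_adj.1 huv).1, fun a b hab => (KsubH_adj.1 huv).2 a b (hH hab)⟩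

lemma SigmaSet_mono {β : Type*} {H H' : SimpleGraph β} (hH : H ≤ H') (n : ℕ) :
    SigmaSet H' n ⊆ SigmaSet H n := fun _ hl => ⟨hl.1, fun d hd hs =>
  let ⟨G, hG, f, hf⟩ := hl.2 d hd hs
  ⟨G, hG, f, fun u v huv => hf u v (hH huv)⟩⟩

/-- Every realization containing `K_{r+1} - K₄` has `r - 3` vertices of degree at least `r`. -/
lemma not_potentiallyGraphic {n r : ℕ} (hr : 4 ≤ r) {d : Fin n → ℕ}
    (hd : ∀ i : Fin n, r - 4 ≤ i → d i < r) :
    ¬ PotentiallyGraphic d (KsubH (r + 1) 4 (by omega) ⊤) := by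
  rintro ⟨G, hG, f, hf⟩
  have hlarge : ∀ u : Fin (r + 1), 4 ≤ (u : ℕ) → (f u : ℕ) < r - 4 := by
    intro u hu
    by_contra! hlt
    have hdeg : r ≤ G.degree (f u) := by
      rw [← G.card_neighborFinset_eq_degree]
      calc r = #((univ.erase u).map f) := by simp
        _ ≤ _ := card_le_card fun x hx => by
          obtain ⟨v, hv, rfl⟩ := mem_map.1 hx
          rw [mem_neighborFinset]
          refine hf u v (KsubH_adj.2 ⟨(ne_of_mem_erase hv).symm, fun a b _ ha => ?_⟩)
          rw [← ha] at hu
          have := a.2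
          simp only [Fin.val_castLE] at hu
          omega
    rw [hG] at hdeg
    exact absurd (hd _ hlt) (by omega)
  have hcard : #(univ.image
      fun i : Fin (r - 3) => (f ⟨i + 4, by omega⟩ : ℕ)) ≤ r - 4 := by
    rw [← card_range (r - 4)]
    refine card_le_card fun x hx => ?_
    obtain ⟨i, -, rfl⟩ := mem_image.1 hx
    exact mem_range.2 (hlarge _ (by simp))
  rw [card_image_of_injective _ fun i j hij => by
    have := f.injective (Fin.val_injective hij)
    simp only [Fin.mk.injEq] at this
    exact Fin.ext (by omega)] at hcard
  simp only [card_univ, Fintype.card_fin] at hcard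
  omega

lemma containsCopy_KsubH_Z4 {V : Type} {G : SimpleGraph V} {k : ℕ}
    (hG : ContainsCopy G (roleGraph k)) :
    ContainsCopy G (KsubH (k + 3 + 1) 4 (by omega) Z4) := by
  obtain ⟨f, hf⟩ := hG
  let g : Fin k ⊕ Fin 4 ≃ Fin (k + 3 + 1) :=
    (Equiv.sumComm _ _).trans (finSumFinEquiv.trans (finCongr (by omega)))
  refine ⟨g.symm.toEmbedding.trans f, fun u v huv => hf _ _ ?_⟩
  obtain ⟨a, rfl⟩ := g.surjective u
  obtain ⟨b, rfl⟩ := g.surjective v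
  obtain ⟨hne, hZ⟩ := KsubH_adj.1 huv
  have hg : ∀ i : Fin 4, Fin.castLE (by omega) i = g (.inr i) := fun i => by
    apply Fin.ext
    simp [g]
  change (roleGraph k).Adj (g.symm (g a)) (g.symm (g b))
  rw [g.symm_apply_apply, g.symm_apply_apply, roleGraph_adj]
  refine ⟨fun h => hne (h ▸ rfl), ?_⟩
  rcases a with a | i
  · simp [roleWeight]
  rcases b with b | j
  · simp [roleWeight]
  have hij : ¬ Z4.Adj i j := fun h => hZ i j h (hg i) (hg j)
  have hne' : i ≠ j := fun h => hne (h ▸ rfl)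
  fin_cases i <;> fin_cases j <;> simp [Z4, roleWeight] at hij hne' ⊢

lemma mem_SigmaSet_Z4 {k n m : ℕ} (hn : 5 * k + 31 ≤ n) (hm : Even m)
    (hs : n * (2 * k + 1) + 4 ≤ m + k ^ 2 + 2 * k) :
    m ∈ SigmaSet (KsubH (k + 3 + 1) 4 (by omega) Z4) n := by
  refine ⟨hm, fun d ⟨_, G, hG⟩ hd => ?_⟩
  have hsum : ∑ v, G.degree v = ∑ v, d v := sum_congr rfl fun v _ => hG v
  obtain ⟨G', hdeg, hcopy⟩ := exists_containsCopy_roleGraph k (Fin n) G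
    (by simpa using hn) (by rw [Fintype.card_fin, hsum]; omega)
  exact ⟨G', fun i => (hdeg i).trans (hG i), containsCopy_KsubH_Z4 hcopy⟩

lemma le_of_mem_SigmaSet {k n m l : ℕ} (hk : 1 ≤ k) (hn : 5 * k + 31 ≤ n)
    (hm : m + k ^ 2 + 2 * k ≤ n * (2 * k + 1) + 5 - (n - k + 1) % 2) (hme : Even m)
    (hl : l ∈ SigmaSet (KsubH (k + 3 + 1) 4 (by omega) ⊤) n) : m ≤ l := by
  obtain ⟨c, rfl⟩ : ∃ c, k = c + 1 := ⟨k - 1, by omega⟩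
  obtain ⟨d, hd, hsum, hle⟩ := exists_isGraphic_le (c := c) (n := n) (by omega)
  by_contra! hlt
  refine not_potentiallyGraphic (by omega) (fun i hi => ?_) (hl.2 d hd ?_)
  · have := hle i (by omega)
    omega
  · obtain ⟨t, rfl⟩ : ∃ t, n = c + t := ⟨n - c, by omega⟩
    obtain ⟨s, rfl⟩ : ∃ s, t = s + 1 := ⟨t - 1, by omega⟩
    obtain ⟨x, hx⟩ := hl.1
    obtain ⟨y, hy⟩ := hme
    have e1 : c + (s + 1) - c = s + 1 := by omega
    have e2 : c + (s + 1) - 1 = c + s := by omega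
    have e3 : c + (s + 1) - (c + 1) + 1 = s + 1 := by omega
    rw [e1, e2] at hsum
    rw [e3] at hm
    have e : c * (c + s) + (s + 1) * (c + 3) + (c + 1) ^ 2 + 2 * (c + 1) =
      (c + (s + 1)) * (2 * (c + 1) + 1) + 3 := by ring
    omega

/-- Theorem 1.1: for `r ≥ 4` and `n ≥ 5r + 16`,
`σ(K_{r+1} - K₄, n) = σ(K_{r+1} - (K₄ - e), n) = σ(K_{r+1} - Z₄, n)`, and this common
value is `(r-1)(2n-r) - 3(n-r) + 1` if `n - r` is odd, and `(r-1)(2n-r) - 3(n-r) + 2`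
if `n - r` is even. -/
theorem stmt0 (r n : ℕ) (hr : 4 ≤ r) (hn : 5 * r + 16 ≤ n) :
    ∃ m : ℕ,
      IsLeast (SigmaSet (KsubH (r + 1) 4 (by omega) (⊤ : SimpleGraph (Fin 4))) n) m ∧
      IsLeast (SigmaSet (KsubH (r + 1) 4 (by omega)
        ((⊤ : SimpleGraph (Fin 4)) \ SimpleGraph.fromEdgeSet {s(0, 1)})) n) m ∧
      IsLeast (SigmaSet (KsubH (r + 1) 4 (by omega) Z4) n) m ∧
      (m : ℤ) = if Odd (n - r)
        then ((r : ℤ) - 1) * (2 * (n : ℤ) - r) - 3 * ((n : ℤ) - r) + 1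
        else ((r : ℤ) - 1) * (2 * (n : ℤ) - r) - 3 * ((n : ℤ) - r) + 2 := by
  obtain ⟨k, rfl⟩ : ∃ k, r = k + 3 := ⟨r - 3, by omega⟩
  obtain ⟨t, rfl⟩ : ∃ t, n = k + 3 + t := ⟨n - (k + 3), by omega⟩
  obtain ⟨m, hm⟩ : ∃ m, m + k ^ 2 + 2 * k + t % 2 = (k + 3 + t) * (2 * k + 1) + 5 :=
    ⟨k ^ 2 + 5 * k + 2 * t * k + t + 8 - t % 2, by
      have e : (k + 3 + t) * (2 * k + 1) + 5 =
        k ^ 2 + 5 * k + 2 * t * k + t + 8 + k ^ 2 + 2 * k := by ring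
      have := Nat.mod_lt t two_pos
      omega⟩
  have hmt : m + t % 2 = k * (k + 1) + 2 * (2 * k + t * k + 4) + t := by
    refine Nat.add_right_cancel (m := k ^ 2 + 2 * k) ?_
    calc m + t % 2 + (k ^ 2 + 2 * k) = (k + 3 + t) * (2 * k + 1) + 5 := by rw [← hm]; ring
      _ = _ := by ring
  have hme : Even m := by
    obtain ⟨x, hx⟩ := Nat.even_mul_succ_self k
    exact Nat.even_iff.2 (by omega)
  have hupper := mem_SigmaSet_Z4 (k := k) (n := k + 3 + t) (by omega) hme (by omega)
  have hZ : Z4 ≤ (⊤ : SimpleGraph (Fin 4)) \ SimpleGraph.fromEdgeSet {s(0, 1)} :=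
    sdiff_le_sdiff_left (SimpleGraph.fromEdgeSet_mono (by simp))
  have hZ' := SigmaSet_mono (KsubH_mono (m := k + 3 + 1) (h := by omega) hZ) (k + 3 + t)
  have htop := SigmaSet_mono (KsubH_mono (m := k + 3 + 1) (h := by omega)
    (sdiff_le : (⊤ : SimpleGraph (Fin 4)) \ SimpleGraph.fromEdgeSet {s(0, 1)} ≤ ⊤)) (k + 3 + t)
  have hlower : m ∈ lowerBounds (SigmaSet (KsubH (k + 3 + 1) 4 (by omega)
      (⊤ : SimpleGraph (Fin 4))) (k + 3 + t)) :=
    fun l hl => le_of_mem_SigmaSet (by omega) (by omega) (by omega) hme hl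
  refine ⟨m, ⟨htop (hZ' hupper), hlower⟩, ⟨hZ' hupper, fun l hl => hlower (htop hl)⟩,
    ⟨hupper, fun l hl => hlower (htop (hZ' hl))⟩, ?_⟩
  have hmt' : (m : ℤ) + (t % 2 : ℕ) = k * (k + 1) + 2 * (2 * k + t * k + 4) + t := by
    exact_mod_cast hmt
  rw [Nat.add_sub_cancel_left]
  push_cast
  split_ifs with hodd
  · rw [Nat.odd_iff.1 hodd] at hmt'
    push_cast at hmt'
    linear_combination hmt'
  · rw [Nat.even_iff.1 (Nat.not_odd_iff_even.1 hodd)] at hmt'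
    push_cast at hmt'
    linear_combination hmt'
end

section
/- Let r ≥ 4 and n ≥ 5r+16 be integers, and let π = (d_1, ..., d_n) be an n-term graphic sequence with σ(π) ≥ (r−1)(2n−r) − 3(n−r) + 1 if n−r is odd, and σ(π) ≥ (r−1)(2n−r) − 3(n−r) + 2 if n−r is even. Then π is potentially K_{r+1} − Z_4-graphic. -/
open SimpleGraph Finset
open scoped Classical

section Switching

variable {V : Type*}

/-- The 2-switch replacing the edges `pa`, `qb` by `pb`, `qa`. -/
def edgeSwitch (G : SimpleGraph V) (p a q b : V) : SimpleGraph V :=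
  (G \ SimpleGraph.fromEdgeSet {s(p, a), s(q, b)}) ⊔ SimpleGraph.fromEdgeSet {s(p, b), s(q, a)}

lemma edgeSwitch_adj (G : SimpleGraph V) (p a q b x y : V) :
    (edgeSwitch G p a q b).Adj x y ↔
      (G.Adj x y ∧ ¬(x = p ∧ y = a ∨ x = a ∧ y = p) ∧ ¬(x = q ∧ y = b ∨ x = b ∧ y = q)) ∨
      (x ≠ y ∧ ((x = p ∧ y = b ∨ x = b ∧ y = p) ∨ (x = q ∧ y = a ∨ x = a ∧ y = q))) := by
  have := @SimpleGraph.Adj.ne V G x y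
  simp only [edgeSwitch, SimpleGraph.sup_adj, SimpleGraph.sdiff_adj, SimpleGraph.fromEdgeSet_adj,
    Set.mem_insert_iff, Set.mem_singleton_iff, Sym2.eq_iff]
  tauto

variable [Fintype V]

lemma edgeSwitch_degree {G : SimpleGraph V} {p a q b : V} (hpa : G.Adj p a) (hqb : G.Adj q b)
    (hpb : ¬G.Adj p b) (hqa : ¬G.Adj q a) (hpb' : p ≠ b) (hqa' : q ≠ a) (x : V) :
    (edgeSwitch G p a q b).degree x = G.degree x := by
  have hpq : p ≠ q := by rintro rfl; exact hqa hpa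
  have hab : a ≠ b := by rintro rfl; exact hqa hqb
  have h1 := hpa.ne
  have h2 := hqb.ne
  have key : ∀ s t : V, G.Adj x s → ¬G.Adj x t →
      (∀ y, (edgeSwitch G p a q b).Adj x y ↔ y = t ∨ (G.Adj x y ∧ y ≠ s)) →
      (edgeSwitch G p a q b).degree x = G.degree x := by
    intro s t hs ht h
    have : (edgeSwitch G p a q b).neighborFinset x = insert t ((G.neighborFinset x).erase s) := by
      ext y
      simp only [SimpleGraph.mem_neighborFinset, Finset.mem_insert, Finset.mem_erase, h]
      tauto
    rw [← SimpleGraph.card_neighborFinset_eq_degree, this, Finset.card_insert_of_notMem,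
      Finset.card_erase_add_one, SimpleGraph.card_neighborFinset_eq_degree]
    · simpa using hs
    · simp [ht]
  have hap := hpa.symm
  have hbq := hqb.symm
  have hbp : ¬G.Adj b p := fun h => hpb h.symm
  have haq : ¬G.Adj a q := fun h => hqa h.symm
  by_cases hx : x = p
  · subst hx
    refine key a b hpa hpb fun y => ?_
    rw [edgeSwitch_adj]; grind
  by_cases hx' : x = q
  · subst hx'
    refine key b a hqb hqa fun y => ?_
    rw [edgeSwitch_adj]; grind
  by_cases hxa : x = a
  · subst hxa
    refine key p q hap haq fun y => ?_
    rw [edgeSwitch_adj]; grind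
  by_cases hxb : x = b
  · subst hxb
    refine key q p hbq hbp fun y => ?_
    rw [edgeSwitch_adj]; grind
  have : (edgeSwitch G p a q b).neighborFinset x = G.neighborFinset x := by
    ext y
    simp only [SimpleGraph.mem_neighborFinset, edgeSwitch_adj]
    grind
  rw [← SimpleGraph.card_neighborFinset_eq_degree, this,
    SimpleGraph.card_neighborFinset_eq_degree]

lemma exists_transfer_aux (p q v : V) (hpq : p ≠ q) (hvp : v ≠ p) (hvq : v ≠ q) (A : Finset V)
    (hvA : v ∉ A) (hqA : q ∉ A) (m : ℕ) :
    ∀ G : SimpleGraph V,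
      (A \ G.neighborFinset q).card <
        (((G.neighborFinset q \ G.neighborFinset p) \ A).erase p).card →
      (∀ a ∈ A, G.Adj p a ∨ G.Adj q a) → (A \ G.neighborFinset q).card = m →
      ∃ G' : SimpleGraph V, (∀ x, G'.degree x = G.degree x) ∧ (∀ a ∈ A, G'.Adj q a) ∧
        (∀ x y, x ≠ p → x ≠ q → y ≠ p → y ≠ q → (G'.Adj x y ↔ G.Adj x y)) ∧
        (∀ x, G'.Adj v x ↔ G.Adj v x) ∧ (G'.Adj p q ↔ G.Adj p q) ∧
        (∀ x, G.Adj p x → G.Adj q x → G'.Adj p x ∧ G'.Adj q x) := by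
  induction m with
  | zero =>
    intro G _ _ hm
    refine ⟨G, fun _ => rfl, fun a ha => ?_, by simp, by simp, by simp, fun x h h' => ⟨h, h'⟩⟩
    by_contra h
    have : a ∈ A \ G.neighborFinset q := by simp [ha, h]
    rw [Finset.card_eq_zero] at hm
    simp [hm] at this
  | succ m ih =>
    intro G hlt hA hm
    obtain ⟨a, ha⟩ : (A \ G.neighborFinset q).Nonempty := by
      rw [← Finset.card_pos]; omega
    simp only [Finset.mem_sdiff, SimpleGraph.mem_neighborFinset] at ha
    obtain ⟨haA, hqa⟩ := ha
    have hpa : G.Adj p a := (hA a haA).resolve_right hqa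
    have hqa' : q ≠ a := by rintro rfl; exact hqA haA
    obtain ⟨b, hb, hbv⟩ := Finset.exists_mem_ne
      (s := ((G.neighborFinset q \ G.neighborFinset p) \ A).erase p) (by omega) v
    have hb' := hb
    simp only [Finset.mem_erase, Finset.mem_sdiff, SimpleGraph.mem_neighborFinset] at hb'
    obtain ⟨hbp, ⟨hqb, hpb⟩, hbA⟩ := hb'
    have hab : a ≠ b := by rintro rfl; exact hqa hqb
    have hav : a ≠ v := by rintro rfl; exact hvA haA
    have hdeg := edgeSwitch_degree hpa hqb hpb hqa hbp.symm hqa'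
    have hadj := edgeSwitch_adj G p a q b
    have hpa' := hpa.ne
    have hqb' := hqb.ne
    have hqcard : A \ (edgeSwitch G p a q b).neighborFinset q = (A \ G.neighborFinset q).erase a := by
      ext c
      simp only [Finset.mem_sdiff, SimpleGraph.mem_neighborFinset, Finset.mem_erase, hadj]
      clear ih hdeg hlt hm
      grind
    have hqcard' : (((edgeSwitch G p a q b).neighborFinset q \
        (edgeSwitch G p a q b).neighborFinset p) \ A).erase p =
        (((G.neighborFinset q \ G.neighborFinset p) \ A).erase p).erase b := by
      ext c
      simp only [Finset.mem_sdiff, SimpleGraph.mem_neighborFinset, Finset.mem_erase, hadj]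
      clear ih hdeg hlt hm hqcard
      grind
    have hc1 := Finset.card_erase_add_one (s := A \ G.neighborFinset q) (a := a) (by simp [haA, hqa])
    have hc2 := Finset.card_erase_add_one hb
    obtain ⟨G', h1, h2, h3, h4, h5, h6⟩ := ih (edgeSwitch G p a q b)
      (by rw [hqcard, hqcard']; omega)
      (by
        intro c hc
        have := hA c hc
        have hcq : c ≠ q := by rintro rfl; exact hqA hc
        simp only [hadj]
        clear ih hdeg hlt hm hqcard hqcard' hc1 hc2
        grind)
      (by rw [hqcard]; omega)
    clear ih hlt hm hqcard hqcard' hc1 hc2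
    refine ⟨G', fun x => (h1 x).trans (hdeg x), h2, fun x y hxp hxq hyp hyq => ?_, fun x => ?_, ?_,
      fun x hpx hqx => h6 x ?_ ?_⟩
    · rw [h3 x y hxp hxq hyp hyq, hadj]; clear h1 h2 h3 h4 h5 h6 hdeg hadj; grind
    · rw [h4, hadj]; clear h1 h2 h3 h4 h5 h6 hdeg hadj; grind
    · rw [h5, hadj]; clear h1 h2 h3 h4 h5 h6 hdeg hadj; grind
    · rw [hadj]; clear h1 h2 h3 h4 h5 h6 hdeg hadj; grind
    · rw [hadj]; clear h1 h2 h3 h4 h5 h6 hdeg hadj; grind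

/-- If `q` has larger degree than `p`, neighbours of `p` can be handed over to `q` by 2-switches
that do not touch the edges at a prescribed third vertex `v`. -/
lemma exists_transfer {G : SimpleGraph V} {p q v : V} (hvp : v ≠ p) (hvq : v ≠ q) {A : Finset V}
    (hvA : v ∉ A) (hqA : q ∉ A) (hA : ∀ a ∈ A, G.Adj p a) (hlt : G.degree p < G.degree q) :
    ∃ G' : SimpleGraph V, (∀ x, G'.degree x = G.degree x) ∧ (∀ a ∈ A, G'.Adj q a) ∧
      (∀ x y, x ≠ p → x ≠ q → y ≠ p → y ≠ q → (G'.Adj x y ↔ G.Adj x y)) ∧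
      (∀ x, G'.Adj v x ↔ G.Adj v x) ∧ (G'.Adj p q ↔ G.Adj p q) ∧
      (∀ x, G.Adj p x → G.Adj q x → G'.Adj p x ∧ G'.Adj q x) := by
  have hpq : p ≠ q := by rintro rfl; omega
  refine exists_transfer_aux p q v hpq hvp hvq A hvA hqA _ G ?_ (fun a ha => .inl (hA a ha)) rfl
  have hB : ((G.neighborFinset q \ G.neighborFinset p) \ A).erase p =
      (G.neighborFinset q \ {p}) \ (G.neighborFinset p \ {q}) := by
    ext x
    simp only [Finset.mem_sdiff, SimpleGraph.mem_neighborFinset, Finset.mem_erase,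
      Finset.mem_singleton]
    have := hA x
    have h2 := @SimpleGraph.Adj.ne V G q x
    tauto
  have hA' : A \ G.neighborFinset q ⊆ (G.neighborFinset p \ {q}) \ (G.neighborFinset q \ {p}) := by
    intro x hx
    simp only [Finset.mem_sdiff, SimpleGraph.mem_neighborFinset, Finset.mem_singleton] at hx ⊢
    have := hA x hx.1
    have : x ≠ q := by rintro rfl; exact hqA hx.1
    tauto
  have e1 := Finset.card_sdiff_add_card_inter (G.neighborFinset q) {p}
  have e2 := Finset.card_sdiff_add_card_inter (G.neighborFinset p) {q}
  have e3 : (G.neighborFinset q ∩ {p}).card = (G.neighborFinset p ∩ {q}).card := by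
    by_cases h : G.Adj p q
    · rw [Finset.inter_singleton_of_mem (by simpa using h.symm),
        Finset.inter_singleton_of_mem (by simpa using h)]; simp
    · rw [Finset.inter_singleton_of_notMem (by simpa using fun h' => h h'.symm),
        Finset.inter_singleton_of_notMem (by simpa using h)]
  have e4 := Finset.card_sdiff_add_card_inter (G.neighborFinset q \ {p}) (G.neighborFinset p \ {q})
  have e5 := Finset.card_sdiff_add_card_inter (G.neighborFinset p \ {q}) (G.neighborFinset q \ {p})
  rw [Finset.inter_comm] at e5
  rw [SimpleGraph.card_neighborFinset_eq_degree] at e1 e2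
  have := Finset.card_le_card hA'
  rw [hB]
  omega

end Switching

section Core

variable {V : Type*}

/-- `C` is a `k`-clique completely joined to the 4-set `J`, and `J` spans a path on 3 vertices:
the vertex set `C ∪ J` carries a copy of `K_{k+4} - Z₄`. -/
structure IsCore (G : SimpleGraph V) (C J : Finset V) (k : ℕ) : Prop where
  card_left : C.card = k
  card_right : J.card = 4
  disjoint : Disjoint C J
  adj : ∀ x ∈ C, ∀ y ∈ C ∪ J, x ≠ y → G.Adj x y
  path : ∃ a ∈ J, ∃ b ∈ J, ∃ c ∈ J, a ≠ c ∧ G.Adj b a ∧ G.Adj b c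

namespace IsCore

variable {G G' : SimpleGraph V} {C J : Finset V} {k : ℕ}

lemma map (h : IsCore G C J k) (f : V ≃ V)
    (hf : ∀ x ∈ C ∪ J, ∀ y ∈ C ∪ J, G.Adj x y → G'.Adj (f x) (f y)) :
    IsCore G' (C.image f) (J.image f) k where
  card_left := by rw [Finset.card_image_of_injective _ f.injective, h.card_left]
  card_right := by rw [Finset.card_image_of_injective _ f.injective, h.card_right]
  disjoint := by rw [Finset.disjoint_image f.injective]; exact h.disjoint
  adj := by
    intro x hx y hy hxy
    rw [← Finset.image_union] at hy
    obtain ⟨x, hxC, rfl⟩ := Finset.mem_image.1 hx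
    obtain ⟨y, hyC, rfl⟩ := Finset.mem_image.1 hy
    exact hf x (Finset.mem_union_left _ hxC) y hyC (h.adj x hxC y hyC fun e => hxy (by rw [e]))
  path := by
    obtain ⟨a, ha, b, hb, c, hc, hac, hba, hbc⟩ := h.path
    exact ⟨f a, Finset.mem_image_of_mem _ ha, f b, Finset.mem_image_of_mem _ hb, f c,
      Finset.mem_image_of_mem _ hc, fun e => hac (f.injective e),
      hf b (Finset.mem_union_right _ hb) a (Finset.mem_union_right _ ha) hba,
      hf b (Finset.mem_union_right _ hb) c (Finset.mem_union_right _ hc) hbc⟩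

lemma mono (h : IsCore G C J k)
    (hf : ∀ x ∈ C ∪ J, ∀ y ∈ C ∪ J, G.Adj x y → G'.Adj x y) : IsCore G' C J k := by
  simpa using h.map (Equiv.refl V) hf

lemma card_union (h : IsCore G C J k) : (C ∪ J).card = k + 4 := by
  rw [Finset.card_union_of_disjoint h.disjoint, h.card_left, h.card_right]

lemma insert_left {v : V} (h : IsCore G C J k) (hv : v ∉ C ∪ J) (hadj : ∀ x ∈ C ∪ J, G.Adj v x) :
    IsCore G (insert v C) J (k + 1) where
  card_left := by
    rw [Finset.card_insert_of_notMem fun h' => hv (Finset.mem_union_left _ h'), h.card_left]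
  card_right := h.card_right
  disjoint := by
    rw [Finset.disjoint_insert_left]
    exact ⟨fun h' => hv (Finset.mem_union_right _ h'), h.disjoint⟩
  adj := by
    intro x hx y hy hxy
    rw [Finset.insert_union, Finset.mem_insert] at hy
    rw [Finset.mem_insert] at hx
    rcases hx with rfl | hx
    · exact hadj y (hy.resolve_left hxy.symm)
    · rcases hy with rfl | hy
      · exact (hadj x (Finset.mem_union_left _ hx)).symm
      · exact h.adj x hx y hy hxy
  path := h.path

/-- Deleting the edge `uy` does no harm if `y` lies outside the core. -/
lemma deleteEdge_of_notMem (h : IsCore G C J k) {y : V} (u : V) (hy : y ∉ C ∪ J) :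
    IsCore (G.deleteEdges {s(u, y)}) C J k := by
  refine h.mono fun x hx z hz hxz => ?_
  rw [SimpleGraph.deleteEdges_adj]
  refine ⟨hxz, ?_⟩
  simp only [Set.mem_singleton_iff, Sym2.eq_iff]
  rintro (⟨-, rfl⟩ | ⟨rfl, -⟩)
  exacts [hy hz, hy hx]

end IsCore

/-- The number of vertices of the core `C ∪ J` not adjacent to `v`. -/
noncomputable def missing (G : SimpleGraph V) (v : V) (C J : Finset V) : ℕ :=
  {x ∈ C ∪ J | ¬G.Adj v x}.card

/-- A weight favouring vertices of large degree in the core. -/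
def coreWeight (d : V → ℕ) (C J : Finset V) : ℕ := 2 * ∑ x ∈ C, d x + ∑ x ∈ J, d x

variable [Fintype V]

/-- A realization `G` of `d` with a core `(C, J)` avoiding the vertex `v`. -/
structure CoreConfig (d : V → ℕ) (k : ℕ) (v : V) (G : SimpleGraph V) (C J : Finset V) : Prop where
  degree_eq : ∀ x, G.degree x = d x
  core : IsCore G C J k
  notMem : v ∉ C ∪ J

/-- A core avoiding `v` that misses `v` as little as possible and, among these, has maximal
weight. -/
structure OptimalConfig (d : V → ℕ) (k : ℕ) (v : V) (G : SimpleGraph V) (C J : Finset V) : Prop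
    extends CoreConfig d k v G C J where
  min : ∀ G' C' J', CoreConfig d k v G' C' J' → missing G v C J ≤ missing G' v C' J'
  max : ∀ G' C' J', CoreConfig d k v G' C' J' → missing G' v C' J' ≤ missing G v C J →
    coreWeight d C' J' ≤ coreWeight d C J

lemma CoreConfig.exists_optimal {d : V → ℕ} {k : ℕ} {v : V} {G : SimpleGraph V} {C J : Finset V}
    (h : CoreConfig d k v G C J) : ∃ G C J, OptimalConfig d k v G C J := by
  let S : Set (SimpleGraph V × Finset V × Finset V) := {t | CoreConfig d k v t.1 t.2.1 t.2.2}
  obtain ⟨⟨G₁, C₁, J₁⟩, h₁, hmin⟩ := Set.exists_min_image S (fun t => missing t.1 v t.2.1 t.2.2)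
    (Set.toFinite S) ⟨(G, C, J), h⟩
  let T : Set (SimpleGraph V × Finset V × Finset V) :=
    {t | t ∈ S ∧ missing t.1 v t.2.1 t.2.2 ≤ missing G₁ v C₁ J₁}
  obtain ⟨⟨G₂, C₂, J₂⟩, h₂, hmax⟩ := Set.exists_max_image T (fun t => coreWeight d t.2.1 t.2.2)
    (Set.toFinite T) ⟨(G₁, C₁, J₁), h₁, le_rfl⟩
  exact ⟨G₂, C₂, J₂, h₂.1, fun G' C' J' h' => h₂.2.trans (hmin (G', C', J') h'),
    fun G' C' J' h' hm => hmax (G', C', J') ⟨h', hm.trans h₂.2⟩⟩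

namespace OptimalConfig

variable {d : V → ℕ} {k : ℕ} {v : V} {G : SimpleGraph V} {C J : Finset V}

lemma of_missing_le {G' : SimpleGraph V} (h : OptimalConfig d k v G C J)
    (hdeg : ∀ x, G'.degree x = G.degree x) (hcore : IsCore G' C J k)
    (hmiss : missing G' v C J ≤ missing G v C J) : OptimalConfig d k v G' C J where
  degree_eq x := (hdeg x).trans (h.degree_eq x)
  core := hcore
  notMem := h.notMem
  min G' C' J' h' := hmiss.trans (h.min G' C' J' h')
  max G' C' J' h' hm := h.max G' C' J' h' (hm.trans hmiss)

/-- A 2-switch disjoint from the edges inside the core and between the core and `v` preserves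
optimality. -/
lemma of_adj {G' : SimpleGraph V} (h : OptimalConfig d k v G C J)
    (hdeg : ∀ x, G'.degree x = G.degree x)
    (hcore : ∀ x ∈ C ∪ J, ∀ y ∈ C ∪ J, G.Adj x y → G'.Adj x y)
    (hv : ∀ x ∈ C ∪ J, G.Adj v x → G'.Adj v x) : OptimalConfig d k v G' C J := by
  refine h.of_missing_le hdeg (h.core.mono hcore) (Finset.card_le_card fun x hx => ?_)
  simp only [Finset.mem_filter] at hx ⊢
  exact ⟨hx.1, fun h' => hx.2 (hv x hx.1 h')⟩

/-- Every edge `uy` at a core vertex `u` missed by `v` whose deletion leaves the core intact has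
`y` adjacent to all neighbours of `v` outside the core. -/
lemma adj_of_removable (h : OptimalConfig d k v G C J) {u y w : V} (hu : u ∈ C ∪ J)
    (hvu : ¬G.Adj v u) (hvw : G.Adj v w) (hw : w ∉ C ∪ J) (huy : G.Adj u y) (hyw : y ≠ w)
    (hrem : IsCore (G.deleteEdges {s(u, y)}) C J k) : G.Adj y w := by
  by_contra hcon
  have huv : u ≠ v := by rintro rfl; exact h.notMem hu
  have hadj := edgeSwitch_adj G u y w v
  have hdeg := edgeSwitch_degree huy hvw.symm (fun h' => hvu h'.symm) (fun h' => hcon h'.symm)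
    huv hyw.symm
  have hv := h.notMem
  have hcore : IsCore (edgeSwitch G u y w v) C J k := by
    refine hrem.mono fun a ha b hb hab => ?_
    rw [SimpleGraph.deleteEdges_adj, Set.mem_singleton_iff, Sym2.eq_iff] at hab
    rw [hadj]
    grind
  have := h.min _ C J ⟨fun x => (hdeg x).trans (h.degree_eq x), hcore, h.notMem⟩
  refine absurd this (not_le.2 (Finset.card_lt_card ?_))
  rw [Finset.ssubset_iff_of_subset]
  · refine ⟨u, by simp [hvu]; simpa using hu, ?_⟩
    simp only [Finset.mem_filter, hadj]
    grind
  · intro x hx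
    simp only [Finset.mem_filter, hadj] at hx ⊢
    refine ⟨hx.1, fun h' => hx.2 ?_⟩
    have := h'.ne
    have : x ≠ w := by rintro rfl; exact hw hx.1
    have : v ≠ y := by rintro rfl; exact hvu huy.symm
    grind

/-- A vertex `x` outside the core that is not adjacent to the endpoint `y` of a removable edge has
all its neighbours adjacent to all neighbours of `v` outside the core. -/
lemma eq_or_adj_of_not_adj (h : OptimalConfig d k v G C J) {u y w x t : V} (hu : u ∈ C ∪ J)
    (hvu : ¬G.Adj v u) (hvw : G.Adj v w) (hw : w ∉ C ∪ J) (huy : G.Adj u y)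
    (hrem : IsCore (G.deleteEdges {s(u, y)}) C J k)
    (hx : x ∉ C ∪ J) (hxv : x ≠ v) (hxy : x ≠ y) (hnxy : ¬G.Adj x y) (hxt : G.Adj x t) :
    t = w ∨ G.Adj t w := by
  by_contra! hcon
  obtain ⟨htw, hntw⟩ := hcon
  have hnxv : ¬G.Adj x v := fun h' =>
    hnxy (h.adj_of_removable hu hvu h'.symm hx huy hxy.symm hrem).symm
  have hvy : v ≠ y := by rintro rfl; exact hvu huy.symm
  have hxw : x ≠ w := by rintro rfl; exact hnxv hvw.symm
  have hux : u ≠ x := by rintro rfl; exact hx hu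
  have huw : u ≠ w := by rintro rfl; exact hw hu
  have hxt' := hxt.ne
  have hvw' := hvw.ne
  have huv : u ≠ v := by rintro rfl; exact h.notMem hu
  have hadj := edgeSwitch_adj G x t w v
  have hdeg := edgeSwitch_degree hxt hvw.symm hnxv (fun h' => hntw h'.symm) hxv htw.symm
  have hv := h.notMem
  have key : ∀ a ∈ C ∪ J, ∀ b, G.Adj a b → b ∈ C ∪ J ∨ (a = u ∧ b = y) ∨ (b = v ∧ a ≠ w) →
      (edgeSwitch G x t w v).Adj a b := by
    intro a ha b hab hb
    rw [hadj]
    have : a ≠ x := by rintro rfl; exact hx ha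
    have : a ≠ v := by rintro rfl; exact hv ha
    have : b ∈ C ∪ J → b ≠ x ∧ b ≠ v := by
      intro hbW; constructor <;> rintro rfl
      exacts [hx hbW, hv hbW]
    grind
  have h1 : OptimalConfig d k v (edgeSwitch G x t w v) C J := by
    refine h.of_adj hdeg (fun a ha b hb hab => key a ha b hab (.inl hb)) fun a ha hva => ?_
    exact (key a ha v hva.symm (.inr (.inr ⟨rfl, by rintro rfl; exact hw ha⟩))).symm
  have h2 := h1.adj_of_removable (w := x) (y := y) hu
    (by rw [hadj]; clear hadj key hdeg; grind) (by rw [hadj]; clear hadj key hdeg; grind) hx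
    (key u hu y huy (.inr (.inl ⟨rfl, rfl⟩))) hxy.symm (by
      refine hrem.mono fun a ha b hb hab => ?_
      rw [SimpleGraph.deleteEdges_adj] at hab ⊢
      exact ⟨key a ha b hab.1 (.inl hb), hab.2⟩)
  rw [hadj] at h2
  have := fun h' : G.Adj y x => hnxy h'.symm
  clear hadj key hdeg
  grind

/-- If some edge `uy` at a missed core vertex leaves the core and avoids the neighbours of `v`,
then the neighbours of `v` outside the core form a clique. -/
lemma adj_of_neighbors (h : OptimalConfig d k v G C J) {u y w w' : V} (hu : u ∈ C ∪ J)
    (hvu : ¬G.Adj v u) (huy : G.Adj u y) (hy : y ∉ C ∪ J) (hvy : ¬G.Adj v y)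
    (hvw : G.Adj v w) (hw : w ∉ C ∪ J) (hvw' : G.Adj v w') (hw' : w' ∉ C ∪ J) (hww' : w' ≠ w) :
    G.Adj w' w := by
  by_cases huw' : G.Adj u w'
  · exact h.adj_of_removable hu hvu hvw hw huw' hww' (h.core.deleteEdge_of_notMem u hw')
  have hyv : v ≠ y := by rintro rfl; exact hvu huy.symm
  have huv : u ≠ v := by rintro rfl; exact h.notMem hu
  have huw : u ≠ w' := by rintro rfl; exact hw' hu
  have hyw : w ≠ y := by rintro rfl; exact hvy hvw
  have hyw' : w' ≠ y := by rintro rfl; exact hvy hvw'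
  have hadj := edgeSwitch_adj G u y v w'
  have hdeg := edgeSwitch_degree huy hvw' huw' hvy huw hyv
  have hv := h.notMem
  have h1 : OptimalConfig d k v (edgeSwitch G u y v w') C J := by
    refine h.of_adj hdeg (fun a ha b hb hab => ?_) fun a ha hva => ?_
    · rw [hadj]; grind
    · rw [hadj]; grind
  have := hvw'.ne
  have h2 := h1.adj_of_removable (u := u) (y := w') (w := w) hu (by rw [hadj]; grind)
    (by rw [hadj]; grind) hw (by rw [hadj]; grind) hww' (h1.core.deleteEdge_of_notMem u hw')
  rw [hadj] at h2
  have : w ≠ u := by rintro rfl; exact hw hu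
  grind

end OptimalConfig

end Core

namespace OptimalConfig

variable {V : Type*} [Fintype V] {d : V → ℕ} {k : ℕ} {v : V} {G : SimpleGraph V} {C J : Finset V}

/-- Vertices outside the core have degree at most that of any core vertex missed by `v`. -/
lemma degree_le_of_missed (h : OptimalConfig d k v G C J) {u w : V} (hu : u ∈ C ∪ J)
    (hvu : ¬G.Adj v u) (hw : w ∉ C ∪ J) (hwv : w ≠ v) : d w ≤ d u := by
  by_contra! hlt
  have huv : v ≠ u := by rintro rfl; exact h.notMem hu
  have huw : u ≠ w := by rintro rfl; exact hw hu
  obtain ⟨G', hdeg, hA, hrest, hv, -, -⟩ := exists_transfer (G := G) (p := u) (q := w) (v := v)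
    (A := {x ∈ C ∪ J | G.Adj u x}) huv hwv.symm (by simp only [mem_filter]; exact fun h' => h.notMem h'.1)
    (by simp only [mem_filter]; exact fun h' => hw h'.1)
    (by simp only [mem_filter]; exact fun a h' => h'.2)
    (by rwa [h.degree_eq, h.degree_eq])
  have hsw : ∀ x ∈ C ∪ J, x ≠ u → Equiv.swap u w x = x := fun x hx hxu =>
    Equiv.swap_apply_of_ne_of_ne hxu (by rintro rfl; exact hw hx)
  have hne : ∀ x ∈ C ∪ J, x ≠ w := by rintro x hx rfl; exact hw hx
  have hcore : IsCore G' (C.image (Equiv.swap u w)) (J.image (Equiv.swap u w)) k := by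
    refine h.core.map _ fun x hx y hy hxy => ?_
    by_cases hxu : x = u
    · subst hxu
      rw [Equiv.swap_apply_left, hsw y hy hxy.ne']
      exact hA y (by simp only [mem_filter]; exact ⟨hy, hxy⟩)
    · rw [hsw x hx hxu]
      by_cases hyu : y = u
      · subst hyu
        rw [Equiv.swap_apply_left]
        exact (hA x (by simp only [mem_filter]; exact ⟨hx, hxy.symm⟩)).symm
      · rw [hsw y hy hyu, hrest x y hxu (hne x hx) hyu (hne y hy)]
        exact hxy
  have hnot : v ∉ C.image (Equiv.swap u w) ∪ J.image (Equiv.swap u w) := by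
    rw [← Finset.image_union]
    intro hmem
    obtain ⟨x, hx, hxv⟩ := Finset.mem_image.1 hmem
    by_cases hxu : x = u
    · subst hxu
      rw [Equiv.swap_apply_left] at hxv
      exact hwv hxv
    · rw [hsw x hx hxu] at hxv
      exact h.notMem (hxv ▸ hx)
  have hmax := h.max G' _ _ ⟨fun x => (hdeg x).trans (h.degree_eq x), hcore, hnot⟩ (by
    unfold missing
    rw [← Finset.image_union, Finset.filter_image,
      Finset.card_image_of_injective _ (Equiv.injective _)]
    refine Finset.card_le_card fun x hx => ?_
    simp only [Finset.mem_filter, hv] at hx ⊢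
    refine ⟨hx.1, fun h' => hx.2 ?_⟩
    have hxu : x ≠ u := by rintro rfl; exact hvu h'
    rwa [hsw x hx.1 hxu])
  refine absurd hmax (not_le.2 ?_)
  unfold coreWeight
  rw [Finset.sum_image fun x _ y _ e => Equiv.injective _ e,
    Finset.sum_image fun x _ y _ e => Equiv.injective _ e]
  have hle : ∀ x ∈ C ∪ J, d x ≤ d (Equiv.swap u w x) := by
    intro x hx
    by_cases hxu : x = u
    · subst hxu; rw [Equiv.swap_apply_left]; exact hlt.le
    · rw [hsw x hx hxu]
  have hleC : ∑ x ∈ C, d x ≤ ∑ x ∈ C, d (Equiv.swap u w x) :=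
    Finset.sum_le_sum fun x hx => hle x (Finset.mem_union_left _ hx)
  have hleJ : ∑ x ∈ J, d x ≤ ∑ x ∈ J, d (Equiv.swap u w x) :=
    Finset.sum_le_sum fun x hx => hle x (Finset.mem_union_right _ hx)
  have hstrict : d u < d (Equiv.swap u w u) := by rwa [Equiv.swap_apply_left]
  rcases Finset.mem_union.1 hu with huC | huJ
  · have := Finset.sum_lt_sum (fun x hx => hle x (Finset.mem_union_left _ hx)) ⟨u, huC, hstrict⟩
    omega
  · have := Finset.sum_lt_sum (fun x hx => hle x (Finset.mem_union_right _ hx)) ⟨u, huJ, hstrict⟩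
    omega

/-- The clique part of an optimal core has the larger degrees. -/
lemma degree_le_of_mem (h : OptimalConfig d k v G C J) {c z : V} (hc : c ∈ C) (hz : z ∈ J) :
    d z ≤ d c := by
  by_contra! hlt
  have hcW : c ∈ C ∪ J := Finset.mem_union_left _ hc
  have hzW : z ∈ C ∪ J := Finset.mem_union_right _ hz
  have hvc : v ≠ c := by rintro rfl; exact h.notMem hcW
  have hvz : v ≠ z := by rintro rfl; exact h.notMem hzW
  have hzC : z ∉ C := fun h' => Finset.disjoint_left.1 h.core.disjoint h' hz
  have hcJ : c ∉ J := fun h' => Finset.disjoint_left.1 h.core.disjoint hc h'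
  have hcz : c ≠ z := by rintro rfl; exact hcJ hz
  obtain ⟨G', hdeg, hA, hrest, hv, hpq, hcommon⟩ := exists_transfer (G := G) (p := c) (q := z)
    (v := v) (A := ((C ∪ J).erase c).erase z) hvc hvz
    (by simp only [mem_erase]; exact fun h' => h.notMem h'.2.2)
    (by simp)
    (by simp only [mem_erase]; exact fun a h' => h.core.adj c hc a h'.2.2 h'.2.1.symm)
    (by rwa [h.degree_eq, h.degree_eq])
  have hsw : ∀ x, x ≠ c → x ≠ z → Equiv.swap c z x = x := fun x hxc hxz =>
    Equiv.swap_apply_of_ne_of_ne hxc hxz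
  have hczG : G.Adj c z := h.core.adj c hc z hzW hcz
  have hczG' : G'.Adj c z := hpq.2 hczG
  have hadj : ∀ x ∈ C ∪ J, ∀ y ∈ C ∪ J, G.Adj x y →
      G'.Adj (Equiv.swap c z x) (Equiv.swap c z y) := by
    have hleft : ∀ y ∈ C ∪ J, y ≠ c → G'.Adj (Equiv.swap c z c) (Equiv.swap c z y) := by
      intro y hy hyc
      rw [Equiv.swap_apply_left]
      by_cases hyz : y = z
      · subst hyz; rw [Equiv.swap_apply_right]; exact hczG'.symm
      · rw [hsw y hyc hyz]
        exact hA y (by simp only [mem_erase]; exact ⟨hyz, hyc, hy⟩)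
    have hright : ∀ y ∈ C ∪ J, y ≠ c → G.Adj z y →
        G'.Adj (Equiv.swap c z z) (Equiv.swap c z y) := by
      intro y hy hyc hzy
      rw [Equiv.swap_apply_right, hsw y hyc hzy.ne']
      exact (hcommon y (h.core.adj c hc y hy hyc.symm) hzy).1
    intro x hx y hy hxy
    by_cases hxc : x = c
    · subst hxc; exact hleft y hy hxy.ne'
    by_cases hyc : y = c
    · subst hyc; exact (hleft x hx hxc).symm
    by_cases hxz : x = z
    · subst hxz; exact hright y hy hyc hxy
    by_cases hyz : y = z
    · subst hyz; exact (hright x hx hxc hxy.symm).symm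
    rw [hsw x hxc hxz, hsw y hyc hyz, hrest x y hxc hxz hyc hyz]
    exact hxy
  have hW : C.image (Equiv.swap c z) ∪ J.image (Equiv.swap c z) = C ∪ J := by
    rw [← Finset.image_union]
    refine Finset.eq_of_subset_of_card_le (fun y hy => ?_)
      (Finset.card_image_of_injective _ (Equiv.injective _)).ge
    obtain ⟨x, hx, rfl⟩ := Finset.mem_image.1 hy
    by_cases hxc : x = c
    · subst hxc; rwa [Equiv.swap_apply_left]
    by_cases hxz : x = z
    · subst hxz; rwa [Equiv.swap_apply_right]
    rwa [hsw x hxc hxz]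
  have hmax := h.max G' _ _ ⟨fun x => (hdeg x).trans (h.degree_eq x), h.core.map _ hadj,
    hW ▸ h.notMem⟩ (by
      unfold missing
      rw [hW]
      simp only [hv]
      exact le_rfl)
  refine absurd hmax (not_le.2 ?_)
  unfold coreWeight
  rw [Finset.sum_image fun x _ y _ e => Equiv.injective _ e,
    Finset.sum_image fun x _ y _ e => Equiv.injective _ e,
    ← Finset.add_sum_erase C _ hc, ← Finset.add_sum_erase J _ hz,
    ← Finset.add_sum_erase C (fun x => d (Equiv.swap c z x)) hc,
    ← Finset.add_sum_erase J (fun x => d (Equiv.swap c z x)) hz]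
  have e1 : ∑ x ∈ C.erase c, d (Equiv.swap c z x) = ∑ x ∈ C.erase c, d x := by
    refine Finset.sum_congr rfl fun x hx => ?_
    rw [Finset.mem_erase] at hx
    rw [hsw x hx.1 (by rintro rfl; exact hzC hx.2)]
  have e2 : ∑ x ∈ J.erase z, d (Equiv.swap c z x) = ∑ x ∈ J.erase z, d x := by
    refine Finset.sum_congr rfl fun x hx => ?_
    rw [Finset.mem_erase] at hx
    rw [hsw x (by rintro rfl; exact hcJ hx.2) hx.1]
  rw [e1, e2, Equiv.swap_apply_left, Equiv.swap_apply_right]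
  omega

end OptimalConfig

section Counting

variable {V : Type*} [Fintype V]

/-- If few vertices have degree at least `k + 4`, the degree sum is small. -/
lemma card_large_degree {d : V → ℕ} {k : ℕ} (hd : ∀ x, d x + 1 ≤ Fintype.card V)
    (hn : 5 * k + 36 ≤ Fintype.card V)
    (hσ : Fintype.card V * (2 * k + 3) + 1 ≤ ∑ x, d x + k ^ 2 + 4 * k) :
    k + 1 ≤ ({x | k + 4 ≤ d x} : Finset V).card := by
  by_contra! hlt
  have hsplit := Finset.sum_filter_add_sum_filter_not univ (fun x => k + 4 ≤ d x) d
  have hcard := Finset.card_filter_add_card_filter_not (s := (univ : Finset V)) (fun x => k + 4 ≤ d x)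
  obtain ⟨m, hm⟩ : ∃ m, Fintype.card V = m + 1 := ⟨Fintype.card V - 1, by omega⟩
  have h1 := Finset.sum_le_card_nsmul ({x | k + 4 ≤ d x} : Finset V) d m
    (fun x _ => by have := hd x; omega)
  have h2 := Finset.sum_le_card_nsmul ({x | ¬k + 4 ≤ d x} : Finset V) d (k + 3)
    (fun x hx => by simp only [mem_filter] at hx; omega)
  rw [Finset.card_univ] at hcard
  simp only [smul_eq_mul] at h1 h2
  rw [hm] at hcard hσ hn
  obtain ⟨e, he⟩ : ∃ e, k = ({x | k + 4 ≤ d x} : Finset V).card + e :=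
    ⟨k - ({x | k + 4 ≤ d x} : Finset V).card, by omega⟩
  generalize ({x | k + 4 ≤ d x} : Finset V).card = t at *
  generalize ({x | ¬k + 4 ≤ d x} : Finset V).card = t' at *
  have ht' : t' = m + 1 - t := by omega
  have hmk : k + 3 ≤ m := by omega
  have : t * m + t' * (k + 3) ≤ k * m + (m + 1 - k) * (k + 3) := by
    obtain ⟨f, hf⟩ : ∃ f, m + 1 = k + f := ⟨m + 1 - k, by omega⟩
    have : t' = f + e := by omega
    rw [this, hf, Nat.add_sub_cancel_left]
    calc t * m + (f + e) * (k + 3) = t * m + e * (k + 3) + f * (k + 3) := by ring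
      _ ≤ t * m + e * m + f * (k + 3) := by gcongr
      _ = (t + e) * m + f * (k + 3) := by ring
      _ = k * m + f * (k + 3) := by rw [← he]
  obtain ⟨f, hf⟩ : ∃ f, m + 1 = k + f := ⟨m + 1 - k, by omega⟩
  rw [hf, Nat.add_sub_cancel_left] at this
  have hm' : k * (m + 1) = k * m + k := by ring
  rw [hf] at hm' hσ
  nlinarith

lemma sum_degree_lower {n σ k : ℕ} (hn : 5 * k + 36 ≤ n)
    (hσ : n * (2 * k + 3) + 1 ≤ σ + k ^ 2 + 4 * k) : 9 * k ^ 2 + 83 * k + 109 ≤ σ := by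
  have : (5 * k + 36) * (2 * k + 3) ≤ n * (2 * k + 3) := Nat.mul_le_mul_right _ hn
  nlinarith

lemma sum_degree_le_of_neighbors {G : SimpleGraph V} {W : Finset V} {v y w₀ : V} {δ D q : ℕ}
    (hD : ∀ x, G.degree x ≤ D) (hδ : ∀ x, x ∉ W → x ≠ v → G.degree x ≤ δ)
    (hvw₀ : G.Adj v w₀) (hw₀ : w₀ ∉ W)
    (hDq : D ≤ (G.neighborFinset v \ W).card + q)
    (hy : ∀ w, G.Adj v w → w ∉ W → y ≠ w → G.Adj y w)
    (hfar : ∀ x t w, x ∉ W → x ≠ v → x ≠ y → ¬G.Adj x y → G.Adj x t → G.Adj v w → w ∉ W →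
      t = w ∨ G.Adj t w) :
    ∑ x, G.degree x ≤ (W.card + 1) * D +
      ((insert y (G.neighborFinset y)) \ insert v W).card * δ + (δ + 1) * (q + 1) := by
  set R := G.neighborFinset v \ W with hR
  have memR : ∀ w, w ∈ R ↔ G.Adj v w ∧ w ∉ W := by simp [hR]
  set Y := (insert y (G.neighborFinset y)) \ insert v W with hY
  set X := univ \ (insert v W ∪ Y) with hX
  have memX : ∀ x, x ∈ X → x ∉ W ∧ x ≠ v ∧ x ≠ y ∧ ¬G.Adj x y := by
    intro x hx
    simp only [hX, hY, mem_sdiff, mem_univ, true_and, mem_union, mem_insert, mem_neighborFinset,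
      not_or, not_and_or, not_not] at hx
    have := @SimpleGraph.adj_comm V G x y
    tauto
  set Z : Finset V := {z | ∀ w ∈ R, z = w ∨ G.Adj z w} with hZ
  have hNX : ∀ x ∈ X, G.neighborFinset x ⊆ Z := by
    intro x hx t ht
    obtain ⟨h1, h2, h3, h4⟩ := memX x hx
    rw [mem_neighborFinset] at ht
    simp only [hZ, mem_filter, mem_univ, true_and]
    intro w hw
    exact hfar x t w h1 h2 h3 h4 ht ((memR w).1 hw).1 ((memR w).1 hw).2
  have hZcard : Z.card ≤ δ + 1 := by
    have : Z ⊆ insert w₀ (G.neighborFinset w₀) := by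
      intro z hz
      simp only [hZ, mem_filter, mem_univ, true_and] at hz
      rw [mem_insert, mem_neighborFinset, SimpleGraph.adj_comm]
      exact hz w₀ ((memR w₀).2 ⟨hvw₀, hw₀⟩)
    have h1 := Finset.card_le_card this
    have h2 := Finset.card_insert_le w₀ (G.neighborFinset w₀)
    have h3 := hδ w₀ hw₀ hvw₀.ne'
    rw [← SimpleGraph.card_neighborFinset_eq_degree] at h3
    omega
  have hZX : ∀ z ∈ Z, (Finset.bipartiteBelow G.Adj X z).card ≤ q + 1 := by
    intro z hz
    simp only [hZ, mem_filter, mem_univ, true_and] at hz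
    have hdisj : Disjoint (Finset.bipartiteBelow G.Adj X z) (R.erase z) := by
      rw [Finset.disjoint_left]
      intro x hx hxR
      have hx1 := memX x (Finset.mem_of_mem_filter x hx)
      have hx2 := (memR x).1 (Finset.mem_of_mem_erase hxR)
      exact hx1.2.2.2 (hy x hx2.1 hx2.2 hx1.2.2.1.symm).symm
    have hsub : Finset.bipartiteBelow G.Adj X z ∪ R.erase z ⊆ G.neighborFinset z := by
      intro x hx
      rw [mem_neighborFinset]
      rcases Finset.mem_union.1 hx with hx | hx
      · exact ((Finset.mem_filter.1 hx).2).symm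
      · rw [Finset.mem_erase] at hx
        exact (hz x hx.2).resolve_left hx.1.symm
    have h1 := Finset.card_le_card hsub
    rw [Finset.card_union_of_disjoint hdisj, SimpleGraph.card_neighborFinset_eq_degree] at h1
    have h2 := Finset.pred_card_le_card_erase (s := R) (a := z)
    have h3 := hD z
    have h4 : 0 < R.card := Finset.card_pos.2 ⟨w₀, (memR w₀).2 ⟨hvw₀, hw₀⟩⟩
    omega
  have hsumX : ∑ x ∈ X, G.degree x ≤ (δ + 1) * (q + 1) := by
    calc ∑ x ∈ X, G.degree x ≤ ∑ x ∈ X, (Finset.bipartiteAbove G.Adj Z x).card := by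
          refine Finset.sum_le_sum fun x hx => ?_
          rw [← SimpleGraph.card_neighborFinset_eq_degree]
          refine Finset.card_le_card fun t ht => ?_
          exact Finset.mem_filter.2 ⟨hNX x hx ht, by simpa using ht⟩
      _ = ∑ z ∈ Z, (Finset.bipartiteBelow G.Adj X z).card :=
          Finset.sum_card_bipartiteAbove_eq_sum_card_bipartiteBelow _
      _ ≤ Z.card * (q + 1) := by
          simpa using Finset.sum_le_card_nsmul Z _ (q + 1) hZX
      _ ≤ _ := Nat.mul_le_mul_right _ hZcard
  have hsumY : ∑ x ∈ Y, G.degree x ≤ Y.card * δ := by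
    simpa using Finset.sum_le_card_nsmul Y _ δ fun x hx => by
      simp only [hY, mem_sdiff, mem_insert, not_or] at hx
      exact hδ x hx.2.2 hx.2.1
  have hsumW : ∑ x ∈ insert v W, G.degree x ≤ (W.card + 1) * D := by
    calc ∑ x ∈ insert v W, G.degree x ≤ (insert v W).card * D := by
          simpa using Finset.sum_le_card_nsmul (insert v W) _ D fun x _ => hD x
      _ ≤ _ := Nat.mul_le_mul_right _ (Finset.card_insert_le _ _)
  have hdisj : Disjoint (insert v W) Y := Finset.disjoint_sdiff
  have h1 := Finset.sum_sdiff (Finset.subset_univ (insert v W ∪ Y)) (f := fun x => G.degree x)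
  rw [Finset.sum_union hdisj] at h1
  rw [← h1]
  have : ∑ x ∈ univ \ (insert v W ∪ Y), G.degree x ≤ (δ + 1) * (q + 1) := hsumX
  omega

end Counting

section Extension

variable {V : Type*}

lemma IsCore.of_center {G : SimpleGraph V} {C T : Finset V} {z : V} {m : ℕ} (hC : C.card = m)
    (hT : T.card = 3) (hzT : z ∉ T) (hzC : z ∉ C) (hdisj : Disjoint C T)
    (hadj : ∀ x ∈ C, ∀ y, y ∈ C ∨ y = z ∨ y ∈ T → x ≠ y → G.Adj x y)
    (hz : ∀ t ∈ T, G.Adj z t) : IsCore G C (insert z T) m where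
  card_left := hC
  card_right := by rw [Finset.card_insert_of_notMem hzT, hT]
  disjoint := by rw [Finset.disjoint_insert_right]; exact ⟨hzC, hdisj⟩
  adj x hx y hy hxy := hadj x hx y (by rwa [mem_union, mem_insert] at hy) hxy
  path := by
    obtain ⟨a, b, c, hab, hac, hbc, rfl⟩ := Finset.card_eq_three.1 hT
    exact ⟨a, by simp, z, by simp, b, by simp, hab, hz a (by simp), hz b (by simp)⟩

variable [Fintype V]

/-- Some realization of `d` has a core with a clique part of `m` vertices. -/
def HasCoreRealization (d : V → ℕ) (m : ℕ) : Prop :=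
  ∃ (G : SimpleGraph V) (C J : Finset V), (∀ x, G.degree x = d x) ∧ IsCore G C J m

namespace OptimalConfig

variable {d : V → ℕ} {k : ℕ} {v : V} {G : SimpleGraph V} {C J : Finset V}

lemma degree_le_card_add (h : OptimalConfig d k v G C J) {u : V} (hu : u ∈ C ∪ J)
    (hvu : ¬G.Adj v u) : d v ≤ (G.neighborFinset v \ (C ∪ J)).card + (k + 3) := by
  have h1 := Finset.card_sdiff_add_card_inter (G.neighborFinset v) (C ∪ J)
  have h2 : (G.neighborFinset v ∩ (C ∪ J)) ⊆ (C ∪ J).erase u := by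
    intro x hx
    rw [mem_inter, mem_neighborFinset] at hx
    exact Finset.mem_erase.2 ⟨by rintro rfl; exact hvu hx.1, hx.2⟩
  have h3 := Finset.card_le_card h2
  rw [Finset.card_erase_of_mem hu, h.core.card_union] at h3
  rw [SimpleGraph.card_neighborFinset_eq_degree, h.degree_eq] at h1
  omega

lemma le_degree (h : OptimalConfig d k v G C J) (hmax : ∀ x, d x ≤ d v)
    (hn : 5 * k + 36 ≤ Fintype.card V)
    (hσ : Fintype.card V * (2 * k + 3) + 1 ≤ ∑ x, d x + k ^ 2 + 4 * k) : k + 4 ≤ d v := by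
  have := card_large_degree (fun x => by
    rw [← h.degree_eq]; exact G.degree_lt_card_verts x) hn hσ
  obtain ⟨x, hx⟩ := Finset.card_pos.1 (by omega : 0 < ({x | k + 4 ≤ d x} : Finset V).card)
  simp only [mem_filter, mem_univ, true_and] at hx
  exact hx.trans (hmax x)

/-- The degree sum bound resulting from a removable edge `uy`. -/
lemma sum_le_of_removable (h : OptimalConfig d k v G C J) (hmax : ∀ x, d x ≤ d v)
    (hn : 5 * k + 36 ≤ Fintype.card V)
    (hσ : Fintype.card V * (2 * k + 3) + 1 ≤ ∑ x, d x + k ^ 2 + 4 * k) {u y : V}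
    (hu : u ∈ C ∪ J) (hvu : ¬G.Adj v u) (huy : G.Adj u y)
    (hrem : IsCore (G.deleteEdges {s(u, y)}) C J k) :
    9 * k ^ 2 + 83 * k + 109 ≤ (k + 5) * d v +
      ((insert y (G.neighborFinset y)) \ insert v (C ∪ J)).card * d u + (d u + 1) * (k + 4) := by
  have hD := h.degree_le_card_add hu hvu
  have h4 := h.le_degree hmax hn hσ
  obtain ⟨w₀, hw₀⟩ : (G.neighborFinset v \ (C ∪ J)).Nonempty := by
    rw [← Finset.card_pos]; omega
  rw [mem_sdiff, mem_neighborFinset] at hw₀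
  have := sum_degree_le_of_neighbors (G := G) (W := C ∪ J) (v := v) (y := y) (δ := d u) (D := d v)
    (q := k + 3) (fun x => by rw [h.degree_eq]; exact hmax x)
    (fun x hx hxv => by rw [h.degree_eq]; exact h.degree_le_of_missed hu hvu hx hxv)
    hw₀.1 hw₀.2 hD (fun w hvw hw hyw => h.adj_of_removable hu hvu hvw hw huy hyw hrem)
    (fun x t w hx hxv hxy hnxy hxt hvw hw =>
      h.eq_or_adj_of_not_adj hu hvu hvw hw huy hrem hx hxv hxy hnxy hxt)
  rw [Finset.sum_congr rfl fun x _ => h.degree_eq x, h.core.card_union] at this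
  exact (sum_degree_lower hn hσ).trans this

/-- If a core vertex missed by `v` has a neighbour outside the core, the core can be enlarged. -/
lemma hasCoreRealization_of_outer_neighbor (h : OptimalConfig d k v G C J)
    (hmax : ∀ x, d x ≤ d v) (hn : 5 * k + 36 ≤ Fintype.card V)
    (hσ : Fintype.card V * (2 * k + 3) + 1 ≤ ∑ x, d x + k ^ 2 + 4 * k) {u y : V}
    (hu : u ∈ C ∪ J) (hvu : ¬G.Adj v u) (huy : G.Adj u y) (hy : y ∉ C ∪ J) :
    HasCoreRealization d (k + 1) := by
  have huv : u ≠ v := by rintro rfl; exact h.notMem hu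
  have hyv : y ≠ v := by rintro rfl; exact hvu huy.symm
  have hcount := h.sum_le_of_removable hmax hn hσ hu hvu huy (h.core.deleteEdge_of_notMem u hy)
  have hD := h.degree_le_card_add hu hvu
  have hdy : d y ≤ d u := h.degree_le_of_missed hu hvu hy hyv
  have hY : ((insert y (G.neighborFinset y)) \ insert v (C ∪ J)).card ≤ d u := by
    have hsub : (insert y (G.neighborFinset y)) \ insert v (C ∪ J) ⊆
        insert y ((G.neighborFinset y).erase u) := by
      intro x hx
      rw [mem_sdiff, mem_insert, mem_insert, not_or] at hx
      rw [mem_insert, mem_erase]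
      have : x ≠ u := by rintro rfl; exact hx.2.2 hu
      tauto
    have h1 := (Finset.card_le_card hsub).trans (Finset.card_insert_le _ _)
    rw [Finset.card_erase_add_one (by simpa using huy.symm),
      SimpleGraph.card_neighborFinset_eq_degree, h.degree_eq] at h1
    exact h1.trans hdy
  generalize ((insert y (G.neighborFinset y)) \ insert v (C ∪ J)).card = Y at hcount hY
  have hcount' : 9 * k ^ 2 + 83 * k + 109 ≤ (k + 5) * d v + d u * d u + (d u + 1) * (k + 4) :=
    hcount.trans (by gcongr)
  have hbound : ∀ a b : ℕ, d v ≤ a → d u ≤ b →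
      9 * k ^ 2 + 83 * k + 109 ≤ (k + 5) * a + b * b + (b + 1) * (k + 4) := fun a b ha hb =>
    hcount'.trans (by gcongr)
  by_cases hsmall : d v ≤ 2 * k + 6
  · have := hbound _ _ hsmall ((hmax u).trans hsmall)
    nlinarith
  set R := G.neighborFinset v \ (C ∪ J) with hR
  have memR : ∀ w, w ∈ R ↔ G.Adj v w ∧ w ∉ C ∪ J := by
    intro w; rw [hR, mem_sdiff, mem_neighborFinset]
  set K : Finset V := {z ∈ R | ∀ w ∈ R, z ≠ w → G.Adj z w} with hK
  have hKR : K ⊆ R := Finset.filter_subset _ _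
  by_cases hKcard : k + 1 ≤ K.card
  · obtain ⟨K', hK', hK'card⟩ := Finset.exists_subset_card_eq hKcard
    obtain ⟨z, hz⟩ := Finset.card_pos.1 (by omega : 0 < K'.card)
    obtain ⟨T, hT, hTcard⟩ := Finset.exists_subset_card_eq (s := R \ K') (n := 3) (by
      have := Finset.card_sdiff_add_card_inter R K'
      rw [Finset.inter_eq_right.2 (hK'.trans hKR)] at this
      omega)
    have hKadj : ∀ x ∈ K', ∀ w ∈ R, x ≠ w → G.Adj x w := fun x hx =>
      (Finset.mem_filter.1 (hK' hx)).2
    have hTR : ∀ t ∈ T, t ∈ R ∧ t ∉ K' := fun t ht => Finset.mem_sdiff.1 (hT ht)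
    have hvR : v ∉ R := fun h' => G.loopless.irrefl v ((memR v).1 h').1
    have hzT : z ∉ T := fun h' => (hTR z h').2 hz
    have hzv : z ≠ v := by rintro rfl; exact hvR (hKR (hK' hz))
    refine ⟨G, insert v (K'.erase z), insert z T, h.degree_eq,
      IsCore.of_center ?_ hTcard hzT ?_ ?_ ?_ ?_⟩
    · rw [Finset.card_insert_of_notMem, Finset.card_erase_add_one hz, hK'card]
      exact fun h' => hvR (hKR (hK' (Finset.mem_of_mem_erase h')))
    · simp [hzv]
    · rw [Finset.disjoint_left]
      intro a ha haT
      rw [mem_insert, mem_erase] at ha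
      rcases ha with rfl | ha
      · exact hvR (hTR _ haT).1
      · exact (hTR a haT).2 ha.2
    · have hall : ∀ b, b ∈ insert v (K'.erase z) ∨ b = z ∨ b ∈ T → b = v ∨ b ∈ R := by
        intro b hb
        rw [mem_insert, mem_erase] at hb
        rcases hb with (rfl | hb) | rfl | hb
        · exact .inl rfl
        · exact .inr (hKR (hK' hb.2))
        · exact .inr (hKR (hK' hz))
        · exact .inr (hTR b hb).1
      intro a ha b hb hab
      rw [mem_insert, mem_erase] at ha
      rcases ha with rfl | ha
      · exact ((memR b).1 ((hall b hb).resolve_left hab.symm)).1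
      · rcases hall b hb with rfl | hb
        · exact ((memR a).1 (hKR (hK' ha.2))).1.symm
        · exact hKadj a ha.2 b hb hab
    · intro t ht
      exact hKadj z hz t (hTR t ht).1 (by rintro rfl; exact hzT ht)
  exfalso
  have hNK : ∀ x, G.Adj u x → x ∉ C ∪ J → x ∈ K := by
    intro x hux hx
    have hvx : G.Adj v x := by
      by_contra hvx
      have : K = R := by
        refine Finset.Subset.antisymm hKR fun a ha => Finset.mem_filter.2 ⟨ha, fun b hb hab => ?_⟩
        exact h.adj_of_neighbors hu hvu hux hx hvx ((memR b).1 hb).1 ((memR b).1 hb).2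
          ((memR a).1 ha).1 ((memR a).1 ha).2 hab
      rw [this] at hKcard
      omega
    refine Finset.mem_filter.2 ⟨(memR x).2 ⟨hvx, hx⟩, fun w hw hxw => ?_⟩
    exact h.adj_of_removable hu hvu ((memR w).1 hw).1 ((memR w).1 hw).2 hux hxw
      (h.core.deleteEdge_of_notMem u hx)
  have hdu : d u ≤ 2 * k + 3 := by
    have hsub : G.neighborFinset u ⊆ (C ∪ J).erase u ∪ K := by
      intro x hx
      rw [mem_neighborFinset] at hx
      rw [mem_union (s := (C ∪ J).erase u), mem_erase]
      by_cases hxW : x ∈ C ∪ J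
      · exact .inl ⟨hx.ne', hxW⟩
      · exact .inr (hNK x hx hxW)
    have h1 := (Finset.card_le_card hsub).trans (Finset.card_union_le _ _)
    rw [Finset.card_erase_of_mem hu, h.core.card_union, SimpleGraph.card_neighborFinset_eq_degree,
      h.degree_eq] at h1
    omega
  have hyK := hNK y huy hy
  have hyR := hKR hyK
  have hRy : R.card + 1 ≤ d y := by
    have hsub : insert u (insert v (R.erase y)) ⊆ G.neighborFinset y := by
      intro x hx
      rw [mem_insert, mem_insert, mem_erase] at hx
      rw [mem_neighborFinset]
      rcases hx with rfl | rfl | hx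
      · exact huy.symm
      · exact ((memR y).1 hyR).1.symm
      · exact (Finset.mem_filter.1 hyK).2 x hx.2 hx.1.symm
    have h1 := Finset.card_le_card hsub
    rw [Finset.card_insert_of_notMem, Finset.card_insert_of_notMem,
      Finset.card_erase_add_one hyR, SimpleGraph.card_neighborFinset_eq_degree, h.degree_eq] at h1
    · exact h1
    · intro h'
      exact G.loopless.irrefl v ((memR v).1 (Finset.mem_of_mem_erase h')).1
    · intro h'
      rw [mem_insert] at h'
      exact ((memR u).1 (Finset.mem_of_mem_erase (h'.resolve_left huv))).2 hu
  have := hbound (3 * k + 5) _ (by omega) hdu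
  nlinarith

end OptimalConfig

end Extension

section Counting

variable {V : Type*} [Fintype V]

/-- The degree sum, counted relative to a set `B` of vertices. -/
lemma sum_degree_eq_block (G : SimpleGraph V) (B : Finset V) :
    ∑ x, G.degree x = ∑ x ∈ B, (G.neighborFinset x ∩ B).card +
      ∑ x ∈ Bᶜ, (G.degree x + (G.neighborFinset x ∩ B).card) := by
  have h1 : ∑ x ∈ B, G.degree x = ∑ x ∈ B, (G.neighborFinset x ∩ B).card +
      ∑ x ∈ B, (G.neighborFinset x ∩ Bᶜ).card := by
    rw [← Finset.sum_add_distrib]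
    refine Finset.sum_congr rfl fun x _ => ?_
    rw [← SimpleGraph.card_neighborFinset_eq_degree, ← Finset.sdiff_eq_inter_compl, add_comm,
      Finset.card_sdiff_add_card_inter]
  have h2 : ∑ x ∈ B, (G.neighborFinset x ∩ Bᶜ).card = ∑ x ∈ Bᶜ, (G.neighborFinset x ∩ B).card := by
    have h3 := Finset.sum_card_bipartiteAbove_eq_sum_card_bipartiteBelow (s := B) (t := Bᶜ) G.Adj
    convert h3 using 3 with x hx x hx
    · ext y; simp [Finset.bipartiteAbove, and_comm]
    · ext y; simp [Finset.bipartiteBelow, and_comm, SimpleGraph.adj_comm]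
  rw [← Finset.sum_add_sum_compl B, h1, h2, Finset.sum_add_distrib]
  ring

end Counting

namespace OptimalConfig

variable {V : Type*} [Fintype V] {d : V → ℕ} {k : ℕ} {v : V} {G : SimpleGraph V} {C J : Finset V}

lemma neighborFinset_subset (h : OptimalConfig d k v G C J) (hmax : ∀ x, d x ≤ d v)
    (hn : 5 * k + 36 ≤ Fintype.card V)
    (hσ : Fintype.card V * (2 * k + 3) + 1 ≤ ∑ x, d x + k ^ 2 + 4 * k)
    (hno : ¬HasCoreRealization d (k + 1)) {u : V} (hu : u ∈ C ∪ J) (hvu : ¬G.Adj v u) :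
    G.neighborFinset u ⊆ (C ∪ J).erase u := by
  intro y hy
  rw [mem_neighborFinset] at hy
  rw [mem_erase]
  refine ⟨hy.ne', ?_⟩
  by_contra hyW
  exact hno (h.hasCoreRealization_of_outer_neighbor hmax hn hσ hu hvu hy hyW)

lemma degree_missed_le (h : OptimalConfig d k v G C J) (hmax : ∀ x, d x ≤ d v)
    (hn : 5 * k + 36 ≤ Fintype.card V)
    (hσ : Fintype.card V * (2 * k + 3) + 1 ≤ ∑ x, d x + k ^ 2 + 4 * k)
    (hno : ¬HasCoreRealization d (k + 1)) {u : V} (hu : u ∈ C ∪ J) (hvu : ¬G.Adj v u) :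
    d u ≤ k + 3 := by
  have := Finset.card_le_card (h.neighborFinset_subset hmax hn hσ hno hu hvu)
  rwa [SimpleGraph.card_neighborFinset_eq_degree, h.degree_eq, Finset.card_erase_of_mem hu,
    h.core.card_union] at this

lemma le_degree_missed (h : OptimalConfig d k v G C J)
    (hn : 5 * k + 36 ≤ Fintype.card V)
    (hσ : Fintype.card V * (2 * k + 3) + 1 ≤ ∑ x, d x + k ^ 2 + 4 * k)
    {u : V} (hu : u ∈ C ∪ J) (hvu : ¬G.Adj v u) :
    k + 2 ≤ d u := by
  by_contra! hlt
  have hBcard : (insert v ((C ∪ J).erase u)).card = k + 4 := by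
    rw [Finset.card_insert_of_notMem fun h' => h.notMem (Finset.mem_of_mem_erase h'),
      Finset.card_erase_add_one hu, h.core.card_union]
  have hblock := sum_degree_eq_block G (insert v ((C ∪ J).erase u))
  set B := insert v ((C ∪ J).erase u) with hB
  have h1 : ∑ x ∈ B, (G.neighborFinset x ∩ B).card ≤ (k + 4) * (k + 3) := by
    rw [← hBcard, ← smul_eq_mul]
    refine Finset.sum_le_card_nsmul _ _ _ fun x hx => ?_
    have hsub : G.neighborFinset x ∩ B ⊆ B.erase x := fun y hy => by
      rw [mem_inter, mem_neighborFinset] at hy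
      exact Finset.mem_erase.2 ⟨hy.1.ne', hy.2⟩
    have := Finset.card_le_card hsub
    rwa [Finset.card_erase_of_mem hx, hBcard] at this
  have h2 : ∑ x ∈ Bᶜ, (G.degree x + (G.neighborFinset x ∩ B).card) ≤
      (Fintype.card V - (k + 4)) * (2 * k + 2) := by
    rw [← hBcard, ← Finset.card_compl, ← smul_eq_mul]
    refine Finset.sum_le_card_nsmul _ _ _ fun x hx => ?_
    have hdx : d x ≤ k + 1 := by
      rw [mem_compl, hB, mem_insert, mem_erase, not_or, not_and_or, not_not] at hx
      by_cases hxu : x = u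
      · subst hxu; omega
      · have := h.degree_le_of_missed hu hvu (hx.2.resolve_left hxu) hx.1
        omega
    have := Finset.card_le_card (Finset.inter_subset_left (s₁ := G.neighborFinset x) (s₂ := B))
    rw [SimpleGraph.card_neighborFinset_eq_degree] at this
    rw [h.degree_eq] at this ⊢
    omega
  rw [Finset.sum_congr rfl fun x _ => h.degree_eq x] at hblock
  obtain ⟨m, hm⟩ : ∃ m, Fintype.card V = k + 4 + m := ⟨Fintype.card V - (k + 4), by omega⟩
  rw [hm] at h2 hσ hn
  rw [Nat.add_sub_cancel_left] at h2
  nlinarith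

lemma mem_right_of_missed (h : OptimalConfig d k v G C J) (hmax : ∀ x, d x ≤ d v)
    (hn : 5 * k + 36 ≤ Fintype.card V)
    (hσ : Fintype.card V * (2 * k + 3) + 1 ≤ ∑ x, d x + k ^ 2 + 4 * k)
    (hno : ¬HasCoreRealization d (k + 1)) {u : V} (hu : u ∈ C ∪ J) (hvu : ¬G.Adj v u) :
    u ∈ J := by
  rcases Finset.mem_union.1 hu with huC | huJ
  swap
  · exact huJ
  exfalso
  have hdu := h.degree_missed_le hmax hn hσ hno hu hvu
  have hlarge := card_large_degree (fun x => by
    rw [← h.degree_eq]; exact G.degree_lt_card_verts x) hn hσ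
  have hsub : ({x | k + 4 ≤ d x} : Finset V) ⊆ insert v (C.erase u) := by
    intro x hx
    simp only [mem_filter, mem_univ, true_and] at hx
    rw [mem_insert, mem_erase]
    by_contra! hcon
    have hle : d x ≤ d u := by
      by_cases hxu : x = u
      · rw [hxu]
      by_cases hxJ : x ∈ J
      · exact h.degree_le_of_mem huC hxJ
      · refine h.degree_le_of_missed hu hvu ?_ hcon.1
        rw [mem_union, not_or]
        exact ⟨hcon.2 hxu, hxJ⟩
    omega
  have h1 := (Finset.card_le_card hsub).trans (Finset.card_insert_le _ _)
  rw [Finset.card_erase_add_one huC, h.core.card_left] at h1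
  omega

/-- A missed vertex has at least two neighbours in `J`. -/
lemma card_neighbors_right (h : OptimalConfig d k v G C J) (hmax : ∀ x, d x ≤ d v)
    (hn : 5 * k + 36 ≤ Fintype.card V)
    (hσ : Fintype.card V * (2 * k + 3) + 1 ≤ ∑ x, d x + k ^ 2 + 4 * k)
    (hno : ¬HasCoreRealization d (k + 1)) {u : V} (hu : u ∈ C ∪ J) (hvu : ¬G.Adj v u) :
    d u ≤ k + (G.neighborFinset u ∩ J).card := by
  have hsub : G.neighborFinset u ⊆ C ∪ (G.neighborFinset u ∩ J) := by
    intro x hx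
    have := h.neighborFinset_subset hmax hn hσ hno hu hvu hx
    rw [mem_erase, mem_union] at this
    rw [mem_union, mem_inter]
    tauto
  have h1 := (Finset.card_le_card hsub).trans (Finset.card_union_le _ _)
  rwa [SimpleGraph.card_neighborFinset_eq_degree, h.degree_eq, h.core.card_left] at h1

/-- A missed vertex has no removable edge inside `J` unless the core can be enlarged. -/
lemma not_removable (h : OptimalConfig d k v G C J) (hmax : ∀ x, d x ≤ d v)
    (hn : 5 * k + 36 ≤ Fintype.card V)
    (hσ : Fintype.card V * (2 * k + 3) + 1 ≤ ∑ x, d x + k ^ 2 + 4 * k)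
    (hno : ¬HasCoreRealization d (k + 1)) {u z : V} (hu : u ∈ C ∪ J) (hvu : ¬G.Adj v u)
    (hz : z ∈ J) (huz : G.Adj u z) : ¬IsCore (G.deleteEdges {s(u, z)}) C J k := by
  intro hrem
  have huJ := h.mem_right_of_missed hmax hn hσ hno hu hvu
  have hzW : z ∈ C ∪ J := Finset.mem_union_right _ hz
  have hD := h.degree_le_card_add hu hvu
  have h4 := h.le_degree hmax hn hσ
  have hdu := h.degree_missed_le hmax hn hσ hno hu hvu
  set R := G.neighborFinset v \ (C ∪ J) with hR
  have memR : ∀ w, w ∈ R ↔ G.Adj v w ∧ w ∉ C ∪ J := by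
    intro w; rw [hR, mem_sdiff, mem_neighborFinset]
  have hzR : ∀ w ∈ R, G.Adj z w := fun w hw =>
    h.adj_of_removable hu hvu ((memR w).1 hw).1 ((memR w).1 hw).2 huz
      (by rintro rfl; exact ((memR _).1 hw).2 hzW) hrem
  obtain ⟨w₀, hw₀⟩ : R.Nonempty := by
    rw [← Finset.card_pos]; omega
  have hvz : G.Adj v z := by
    by_contra hvz
    have := h.neighborFinset_subset hmax hn hσ hno hzW hvz
      ((mem_neighborFinset _ _ _).2 (hzR w₀ hw₀))
    exact ((memR w₀).1 hw₀).2 (Finset.mem_of_mem_erase this)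
  have hvC : ∀ c ∈ C, G.Adj v c := by
    intro c hc
    by_contra hvc
    exact Finset.disjoint_left.1 h.core.disjoint hc
      (h.mem_right_of_missed hmax hn hσ hno (Finset.mem_union_left _ hc) hvc)
  have hRcard : 2 * k + 3 ≤ R.card := by
    by_contra! hlt
    have hcount := h.sum_le_of_removable hmax hn hσ hu hvu huz hrem
    have hY : ((insert z (G.neighborFinset z)) \ insert v (C ∪ J)).card ≤ d v := by
      have hsub : (insert z (G.neighborFinset z)) \ insert v (C ∪ J) ⊆ G.neighborFinset z := by
        intro x hx
        rw [mem_sdiff, mem_insert, mem_insert, not_or] at hx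
        exact hx.1.resolve_left (by rintro rfl; exact hx.2.2 hzW)
      have := Finset.card_le_card hsub
      rw [SimpleGraph.card_neighborFinset_eq_degree, h.degree_eq] at this
      exact this.trans (hmax z)
    have hdv : d v ≤ 3 * k + 5 := by omega
    have : 9 * k ^ 2 + 83 * k + 109 ≤
        (k + 5) * (3 * k + 5) + (3 * k + 5) * (k + 3) + (k + 3 + 1) * (k + 4) :=
      hcount.trans (by gcongr; exact hY.trans hdv)
    nlinarith
  have hfew : ∀ c ∈ C, (R \ G.neighborFinset c).card ≤ 2 := by
    intro c hc
    by_cases hall : ∀ w ∈ R, G.Adj c w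
    · rw [Finset.sdiff_eq_empty_iff_subset.2 fun w hw => by simpa using hall w hw]
      simp
    push Not at hall
    obtain ⟨w, hw, hcw⟩ := hall
    set P := G.neighborFinset c \ insert v (C ∪ J) with hP
    set Q := G.neighborFinset z \ insert v (C ∪ J) with hQ
    have hcW : c ∈ C ∪ J := Finset.mem_union_left _ hc
    have hPQ : P ⊆ Q := by
      intro x hx
      rw [hP, mem_sdiff, mem_neighborFinset] at hx
      rw [hQ, mem_sdiff, mem_neighborFinset]
      refine ⟨?_, hx.2⟩
      rw [mem_insert, not_or] at hx
      by_contra hzx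
      rcases h.eq_or_adj_of_not_adj hu hvu ((memR w).1 hw).1 ((memR w).1 hw).2 huz hrem hx.2.2
        hx.2.1 (by rintro rfl; exact hx.2.2 hzW) (fun h' => hzx h'.symm) hx.1.symm with rfl | h'
      · exact ((memR _).1 hw).2 hcW
      · exact hcw h'
    have hdc : d c ≤ k + 4 + P.card := by
      have hsub : G.neighborFinset c ⊆ (insert v ((C ∪ J).erase c)) ∪ P := by
        intro x hx
        rw [mem_union (s := insert v ((C ∪ J).erase c)), hP, mem_sdiff, mem_insert, mem_insert,
          mem_erase]
        have : x ≠ c := ((mem_neighborFinset _ _ _).1 hx).ne'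
        tauto
      have h1 := (Finset.card_le_card hsub).trans (Finset.card_union_le _ _)
      have h2 := Finset.card_insert_le v ((C ∪ J).erase c)
      rw [Finset.card_erase_add_one hcW, h.core.card_union] at h2
      rw [SimpleGraph.card_neighborFinset_eq_degree, h.degree_eq] at h1
      omega
    have hdz : k + 2 + Q.card ≤ d z := by
      have hsub : (insert v (insert u C)) ∪ Q ⊆ G.neighborFinset z := by
        intro x hx
        rw [mem_union, mem_insert, mem_insert] at hx
        rw [mem_neighborFinset]
        rcases hx with (rfl | rfl | hx) | hx
        · exact hvz.symm
        · exact huz.symm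
        · exact (h.core.adj x hx z hzW (by
            rintro rfl; exact Finset.disjoint_left.1 h.core.disjoint hx hz)).symm
        · rw [hQ, mem_sdiff, mem_neighborFinset] at hx
          exact hx.1
      have h1 := Finset.card_le_card hsub
      rw [Finset.card_union_of_disjoint, Finset.card_insert_of_notMem,
        Finset.card_insert_of_notMem, h.core.card_left, SimpleGraph.card_neighborFinset_eq_degree,
        h.degree_eq] at h1
      · omega
      · exact fun h' => Finset.disjoint_left.1 h.core.disjoint h' huJ
      · rw [mem_insert, not_or]
        exact ⟨by rintro rfl; exact h.notMem hu, fun h' => h.notMem (Finset.mem_union_left _ h')⟩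
      · rw [Finset.disjoint_left]
        intro x hx hxQ
        rw [hQ, mem_sdiff, mem_insert, not_or] at hxQ
        rw [mem_insert, mem_insert] at hx
        rcases hx with rfl | rfl | hx
        · exact hxQ.2.1 rfl
        · exact hxQ.2.2 hu
        · exact hxQ.2.2 (Finset.mem_union_left _ hx)
    have hle := h.degree_le_of_mem hc hz
    have hsub : R \ G.neighborFinset c ⊆ Q \ P := by
      intro x hx
      rw [mem_sdiff] at hx
      rw [mem_sdiff, hQ, hP, mem_sdiff, mem_sdiff, mem_neighborFinset, mem_insert, not_or]
      have := (memR x).1 hx.1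
      exact ⟨⟨hzR x hx.1, this.1.ne', this.2⟩, fun h' => hx.2 h'.1⟩
    have h1 := Finset.card_le_card hsub
    rw [Finset.card_sdiff_of_subset hPQ] at h1
    omega
  have hgood : 3 ≤ (R \ C.biUnion fun c => R \ G.neighborFinset c).card := by
    have h1 := Finset.card_biUnion_le_card_mul C (fun c => R \ G.neighborFinset c) 2 hfew
    have h2 := Finset.le_card_sdiff (C.biUnion fun c => R \ G.neighborFinset c) R
    rw [h.core.card_left] at h1
    omega
  obtain ⟨T, hT, hTcard⟩ := Finset.exists_subset_card_eq hgood
  have hTR : ∀ t ∈ T, t ∈ R ∧ ∀ c ∈ C, G.Adj c t := by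
    intro t ht
    have := hT ht
    simp only [mem_sdiff, mem_biUnion, mem_neighborFinset, not_exists, not_and, not_not] at this
    exact ⟨this.1, fun c hc => this.2 c hc this.1⟩
  have hvC' : v ∉ C := fun h' => h.notMem (Finset.mem_union_left _ h')
  have hzC : z ∉ C := fun h' => Finset.disjoint_left.1 h.core.disjoint h' hz
  refine hno ⟨G, insert v C, insert z T, h.degree_eq, IsCore.of_center ?_ hTcard ?_ ?_ ?_ ?_ ?_⟩
  · rw [Finset.card_insert_of_notMem hvC', h.core.card_left]
  · exact fun h' => ((memR z).1 (hTR z h').1).2 hzW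
  · rw [mem_insert, not_or]
    exact ⟨hvz.ne', hzC⟩
  · rw [Finset.disjoint_left]
    intro x hx hxT
    have := (memR x).1 (hTR x hxT).1
    rcases Finset.mem_insert.1 hx with rfl | hx
    · exact this.1.ne rfl
    · exact this.2 (Finset.mem_union_left _ hx)
  · intro x hx y hy hxy
    rw [mem_insert] at hx hy
    rcases hx with rfl | hx
    · rcases hy with (rfl | hy) | rfl | hy
      · exact absurd rfl hxy
      · exact hvC y hy
      · exact hvz
      · exact ((memR y).1 (hTR y hy).1).1
    · rcases hy with (rfl | hy) | rfl | hy
      · exact (hvC x hx).symm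
      · exact h.core.adj x hx y (Finset.mem_union_left _ hy) hxy
      · exact h.core.adj x hx _ hzW hxy
      · exact (hTR y hy).2 x hx
  · exact fun t ht => hzR t (hTR t ht).1

end OptimalConfig

/-- Deleting the edge `uz` inside `J` does no harm if another path of `J` survives. -/
lemma IsCore.deleteEdge_of_path {V : Type*} {G : SimpleGraph V} {C J : Finset V} {k : ℕ}
    (h : IsCore G C J k) {u z a b c : V} (hu : u ∈ J) (hz : z ∈ J) (ha : a ∈ J) (hb : b ∈ J)
    (hc : c ∈ J) (hac : a ≠ c) (hba : G.Adj b a) (hbc : G.Adj b c) (h1 : s(b, a) ≠ s(u, z))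
    (h2 : s(b, c) ≠ s(u, z)) : IsCore (G.deleteEdges {s(u, z)}) C J k where
  card_left := h.card_left
  card_right := h.card_right
  disjoint := h.disjoint
  adj x hx y hy hxy := by
    rw [SimpleGraph.deleteEdges_adj]
    refine ⟨h.adj x hx y hy hxy, fun h' => ?_⟩
    rw [Set.mem_singleton_iff, Sym2.eq_iff] at h'
    rcases h' with ⟨rfl, -⟩ | ⟨rfl, -⟩
    exacts [Finset.disjoint_left.1 h.disjoint hx hu, Finset.disjoint_left.1 h.disjoint hx hz]
  path := ⟨a, ha, b, hb, c, hc, hac, by rw [SimpleGraph.deleteEdges_adj]; exact ⟨hba, h1⟩,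
    by rw [SimpleGraph.deleteEdges_adj]; exact ⟨hbc, h2⟩⟩

namespace OptimalConfig

variable {V : Type*} [Fintype V] {d : V → ℕ} {k : ℕ} {v : V} {G : SimpleGraph V} {C J : Finset V}

/-- Two neighbours `m`, `m'` in `J` of a missed vertex have no further neighbours in `J`. -/
lemma not_adj_of_two_neighbors (h : OptimalConfig d k v G C J) (hmax : ∀ x, d x ≤ d v)
    (hn : 5 * k + 36 ≤ Fintype.card V)
    (hσ : Fintype.card V * (2 * k + 3) + 1 ≤ ∑ x, d x + k ^ 2 + 4 * k)
    (hno : ¬HasCoreRealization d (k + 1)) {u m m' l : V} (hu : u ∈ J) (hvu : ¬G.Adj v u)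
    (hm : m ∈ J) (hm' : m' ∈ J) (hl : l ∈ J) (hmm' : m ≠ m') (hlu : l ≠ u) (hum : G.Adj u m)
    (hum' : G.Adj u m') : ¬G.Adj m l := by
  intro hml
  refine h.not_removable hmax hn hσ hno (Finset.mem_union_right _ hu) hvu hm' hum'
    (h.core.deleteEdge_of_path hu hm' hu hm hl hlu.symm hum.symm hml ?_ ?_)
  · rw [Ne, Sym2.eq_iff]
    have := hum.ne
    tauto
  · rw [Ne, Sym2.eq_iff]
    have := hum.ne
    tauto

/-- When `v` misses a core vertex, the core can be enlarged after all. -/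
lemma hasCoreRealization_of_missed (h : OptimalConfig d k v G C J) (hmax : ∀ x, d x ≤ d v)
    (hn : 5 * k + 36 ≤ Fintype.card V)
    (hσ : Fintype.card V * (2 * k + 3) + 1 ≤ ∑ x, d x + k ^ 2 + 4 * k)
    {u : V} (huW : u ∈ C ∪ J) (hvu : ¬G.Adj v u) : HasCoreRealization d (k + 1) := by
  by_contra hno
  have hu := h.mem_right_of_missed hmax hn hσ hno huW hvu
  have hdu2 := h.le_degree_missed hn hσ huW hvu
  have hduJ := h.card_neighbors_right hmax hn hσ hno huW hvu
  have hcard2 : (G.neighborFinset u ∩ J).card = 2 := by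
    refine le_antisymm ?_ (by omega)
    by_contra! hlt
    obtain ⟨S, hS, hScard⟩ := Finset.exists_subset_card_eq (show 3 ≤ _ from hlt)
    obtain ⟨a, b, c, hab, hac, hbc, rfl⟩ := Finset.card_eq_three.1 hScard
    have hmem : ∀ x ∈ ({a, b, c} : Finset V), G.Adj u x ∧ x ∈ J := fun x hx => by
      simpa using hS hx
    obtain ⟨hua, ha⟩ := hmem a (by simp)
    obtain ⟨hub, hb⟩ := hmem b (by simp)
    obtain ⟨huc, hc⟩ := hmem c (by simp)
    refine h.not_removable hmax hn hσ hno huW hvu ha hua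
      (h.core.deleteEdge_of_path hu ha hb hu hc hbc hub huc ?_ ?_) <;>
    · rw [Ne, Sym2.eq_iff]
      have := hua.ne
      tauto
  have hdu : d u = k + 2 := by omega
  obtain ⟨z, z', hzz', hNu⟩ := Finset.card_eq_two.1 hcard2
  have hmemNu : ∀ x, G.Adj u x ∧ x ∈ J ↔ x = z ∨ x = z' := fun x => by
    have : x ∈ G.neighborFinset u ∩ J ↔ x ∈ ({z, z'} : Finset V) := by rw [hNu]
    simpa using this
  obtain ⟨huz, hz⟩ := (hmemNu z).2 (.inl rfl)
  obtain ⟨huz', hz'⟩ := (hmemNu z').2 (.inr rfl)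
  set I := J.erase u with hI
  have hIcard : I.card = 3 := by rw [hI, Finset.card_erase_of_mem hu, h.core.card_right]
  have memI : ∀ x, x ∈ I ↔ x ≠ u ∧ x ∈ J := fun x => by rw [hI, mem_erase]
  obtain ⟨g, hg⟩ : ((I.erase z).erase z').Nonempty := by
    rw [← Finset.card_pos, Finset.card_erase_of_mem, Finset.card_erase_of_mem, hIcard]
    · omega
    · exact (memI z).2 ⟨huz.ne', hz⟩
    · rw [mem_erase]
      exact ⟨hzz'.symm, (memI z').2 ⟨huz'.ne', hz'⟩⟩
  have hIeq : ∀ x ∈ I, x = z ∨ x = z' ∨ x = g := by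
    have hsub : ({z, z', g} : Finset V) ⊆ I := by
      intro x hx
      simp only [mem_insert, mem_singleton] at hx
      rw [mem_erase, mem_erase] at hg
      rcases hx with rfl | rfl | rfl
      exacts [(memI _).2 ⟨huz.ne', hz⟩, (memI _).2 ⟨huz'.ne', hz'⟩, hg.2.2]
    have heq := Finset.eq_of_subset_of_card_le hsub (by
      rw [mem_erase, mem_erase] at hg
      rw [hIcard, Finset.card_eq_three.2 ⟨z, z', g, hzz', hg.2.1.symm, hg.1.symm, rfl⟩])
    intro x hx
    rw [← heq] at hx
    simpa using hx
  have hpair : ∀ i ∈ I, ∀ j ∈ I, i ≠ j → (i = z ∨ i = z') ∨ (j = z ∨ j = z') := by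
    intro i hi j hj hij
    have := hIeq i hi
    have := hIeq j hj
    by_contra! hcon
    exact hij (by rw [(this.resolve_left hcon.2.1).resolve_left hcon.2.2]; tauto)
  -- Any optimal configuration with the same core in which `u` keeps its neighbours has `I` independent.
  have hindep : ∀ G₁ : SimpleGraph V, OptimalConfig d k v G₁ C J → ¬G₁.Adj v u → G₁.Adj u z →
      G₁.Adj u z' → ∀ i ∈ I, ∀ j ∈ I, ¬G₁.Adj i j := by
    intro G₁ h₁ hvu₁ huz₁ huz₁' i hi j hj hij
    have key : ∀ i ∈ I, ∀ j ∈ I, (i = z ∨ i = z') → ¬G₁.Adj i j := by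
      rintro i hi j hj (rfl | rfl)
      · exact h₁.not_adj_of_two_neighbors hmax hn hσ hno hu hvu₁ hz hz' ((memI j).1 hj).2 hzz'
          ((memI j).1 hj).1 huz₁ huz₁'
      · exact h₁.not_adj_of_two_neighbors hmax hn hσ hno hu hvu₁ hz' hz ((memI j).1 hj).2 hzz'.symm
          ((memI j).1 hj).1 huz₁' huz₁
    rcases hpair i hi j hj hij.ne with hc | hc
    · exact key i hi j hj hc hij
    · exact key j hj i hi hc hij.symm
  have hIndep := hindep G h hvu huz huz'
  have hvC : ∀ c ∈ C, G.Adj v c := by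
    intro c hc
    by_contra hvc
    exact Finset.disjoint_left.1 h.core.disjoint hc
      (h.mem_right_of_missed hmax hn hσ hno (Finset.mem_union_left _ hc) hvc)
  have hvI : ∀ i ∈ I, G.Adj v i := by
    intro i hi
    by_contra hvi
    have hiW : i ∈ C ∪ J := Finset.mem_union_right _ ((memI i).1 hi).2
    have h1 := h.le_degree_missed hn hσ hiW hvi
    have h2 := h.card_neighbors_right hmax hn hσ hno hiW hvi
    have hsub : G.neighborFinset i ∩ J ⊆ {u} := by
      intro x hx
      rw [mem_inter, mem_neighborFinset] at hx
      rw [mem_singleton]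
      by_contra hxu
      exact hIndep i hi x ((memI x).2 ⟨hxu, hx.2⟩) hx.1
    have := Finset.card_le_card hsub
    rw [Finset.card_singleton] at this
    omega
  have hvCJ : v ∉ C ∧ v ∉ J := by
    have := h.notMem
    rwa [mem_union, not_or] at this
  have huC : u ∉ C := fun h' => Finset.disjoint_left.1 h.core.disjoint h' hu
  have hvu' : v ≠ u := by rintro rfl; exact hvCJ.2 hu
  have hCIdisj : Disjoint (insert v C) I := by
    rw [Finset.disjoint_insert_left]
    exact ⟨fun h' => hvCJ.2 ((memI v).1 h').2, h.core.disjoint.mono_right (Finset.erase_subset _ _)⟩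
  have hvCcard : (insert v C).card = k + 1 := by
    rw [Finset.card_insert_of_notMem hvCJ.1, h.core.card_left]
  set B := insert v C ∪ I with hB
  have hBcard : B.card = k + 4 := by
    rw [hB, Finset.card_union_of_disjoint hCIdisj, hvCcard, hIcard]
  have huB : u ∉ B := by
    rw [hB, mem_union, mem_insert, not_or, not_or, memI]
    exact ⟨⟨hvu'.symm, huC⟩, fun h' => h'.1 rfl⟩
  have hout : ∀ x, x ∉ B → x ≠ u → x ≠ v ∧ x ∉ C ∪ J := by
    intro x hx hxu
    rw [hB, mem_union, mem_insert, not_or, not_or, memI] at hx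
    rw [mem_union]
    tauto
  have hdout : ∀ x, x ∉ B → x ≠ u → d x ≤ k + 2 := by
    intro x hx hxu
    rw [← hdu]
    exact h.degree_le_of_missed huW hvu (hout x hx hxu).2 (hout x hx hxu).1
  have hNB : ∀ x, (G.neighborFinset x ∩ B).card ≤ d x := by
    intro x
    rw [← h.degree_eq, ← SimpleGraph.card_neighborFinset_eq_degree]
    exact Finset.card_le_card Finset.inter_subset_left
  set F : Finset V := {x ∈ Bᶜ.erase u | 2 * k + 4 ≤ d x + (G.neighborFinset x ∩ B).card} with hF
  have memF : ∀ x ∈ F, x ∉ B ∧ x ≠ u ∧ 2 * k + 4 ≤ d x + (G.neighborFinset x ∩ B).card := by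
    intro x hx
    rw [hF, mem_filter, mem_erase, mem_compl] at hx
    exact ⟨hx.1.2, hx.1.1, hx.2⟩
  have hFcard : 6 ≤ F.card := by
    have hblock := sum_degree_eq_block G B
    rw [Finset.sum_congr rfl fun x _ => h.degree_eq x,
      Finset.sum_congr (rfl : Bᶜ = Bᶜ) fun x _ => by rw [h.degree_eq x],
      ← Finset.add_sum_erase Bᶜ _ (Finset.mem_compl.2 huB)] at hblock
    have h1 : ∑ x ∈ B, (G.neighborFinset x ∩ B).card ≤ (k + 1) * (k + 3) + 3 * (k + 1) := by
      rw [hB, Finset.sum_union hCIdisj, ← hB]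
      refine add_le_add ?_ ?_
      · rw [← hvCcard, ← smul_eq_mul]
        refine Finset.sum_le_card_nsmul _ _ _ fun x hx => ?_
        have hsub : G.neighborFinset x ∩ B ⊆ B.erase x := fun y hy => by
          rw [mem_inter, mem_neighborFinset] at hy
          exact Finset.mem_erase.2 ⟨hy.1.ne', hy.2⟩
        have := Finset.card_le_card hsub
        rwa [Finset.card_erase_of_mem (Finset.mem_union_left _ hx), hBcard] at this
      · rw [← hIcard, ← smul_eq_mul]
        refine Finset.sum_le_card_nsmul _ _ _ fun x hx => ?_
        rw [← hvCcard]
        refine Finset.card_le_card fun y hy => ?_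
        rw [mem_inter, mem_neighborFinset, hB, mem_union] at hy
        exact hy.2.resolve_right fun hyI => hIndep x hx y hyI hy.1
    have h2 : ∑ x ∈ Bᶜ.erase u, (d x + (G.neighborFinset x ∩ B).card) ≤
        (Fintype.card V - (k + 4) - 1) * (2 * k + 3) + F.card := by
      calc ∑ x ∈ Bᶜ.erase u, (d x + (G.neighborFinset x ∩ B).card)
          ≤ ∑ x ∈ Bᶜ.erase u, ((2 * k + 3) +
              if 2 * k + 4 ≤ d x + (G.neighborFinset x ∩ B).card then 1 else 0) := by
            refine Finset.sum_le_sum fun x hx => ?_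
            rw [mem_erase, mem_compl] at hx
            have h3 := hdout x hx.2 hx.1
            have h4 := hNB x
            split_ifs <;> omega
        _ = _ := by
            rw [Finset.sum_add_distrib, Finset.sum_const, smul_eq_mul,
              Finset.card_erase_of_mem (Finset.mem_compl.2 huB), Finset.card_compl, hBcard,
              Finset.sum_boole, Nat.cast_id]
    have h3 := hNB u
    obtain ⟨m, hm⟩ : ∃ m, Fintype.card V = k + 5 + m := ⟨Fintype.card V - (k + 5), by omega⟩
    rw [show Fintype.card V - (k + 4) - 1 = m by omega] at h2
    rw [hm] at hσ
    nlinarith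
  have hFdeg : ∀ x ∈ F, G.neighborFinset x ⊆ B ∧ d x = k + 2 := by
    intro x hx
    obtain ⟨hxB, hxu, hxF⟩ := memF x hx
    have h3 := hdout x hxB hxu
    have h4 := hNB x
    refine ⟨?_, by omega⟩
    rw [← Finset.inter_eq_left]
    refine Finset.eq_of_subset_of_card_le Finset.inter_subset_left ?_
    rw [SimpleGraph.card_neighborFinset_eq_degree, h.degree_eq]
    omega
  have hFI : ∀ x ∈ F, ∃ i ∈ I, G.Adj x i := by
    intro x hx
    by_contra! hcon
    obtain ⟨hsub, hdx⟩ := hFdeg x hx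
    have : G.neighborFinset x ⊆ insert v C := fun y hy => by
      have := hsub hy
      rw [hB, mem_union] at this
      exact this.resolve_right fun hyI => hcon y hyI (by simpa using hy)
    have := Finset.card_le_card this
    rw [SimpleGraph.card_neighborFinset_eq_degree, h.degree_eq, hvCcard] at this
    omega
  have hcross : ∀ x ∈ F, ∀ x' ∈ F, x ≠ x' → ∀ i ∈ I, ∀ j ∈ I, G.Adj x i → G.Adj x' j → i = j := by
    intro x hx x' hx' hxx' i hi j hj hxi hxj
    by_contra hij
    have hxB := memF x hx
    have hxB' := memF x' hx'
    have hox := hout x hxB.1 hxB.2.1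
    have hox' := hout x' hxB'.1 hxB'.2.1
    have hnxx' : ¬G.Adj x' x := fun h' => hxB.1 ((hFdeg x' hx').1 (by simpa using h'))
    have hiJ := (memI i).1 hi
    have hjJ := (memI j).1 hj
    have hadj := edgeSwitch_adj G i x x' j
    have hdeg := edgeSwitch_degree hxi.symm hxj (hIndep i hi j hj) hnxx' hij hxx'.symm
    have hkeep : ∀ a b, a ≠ x → a ≠ x' → b ≠ x → b ≠ x' → G.Adj a b →
        (edgeSwitch G i x x' j).Adj a b := by
      intro a b h1 h2 h3 h4 hab
      rw [hadj]
      exact .inl ⟨hab, by tauto, by tauto⟩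
    have hW : ∀ a ∈ C ∪ J, a ≠ x ∧ a ≠ x' := fun a ha =>
      ⟨by rintro rfl; exact hox.2 ha, by rintro rfl; exact hox'.2 ha⟩
    have h₁ : OptimalConfig d k v (edgeSwitch G i x x' j) C J :=
      h.of_adj hdeg
        (fun a ha b hb hab => hkeep a b (hW a ha).1 (hW a ha).2 (hW b hb).1 (hW b hb).2 hab)
        (fun a ha hva => hkeep v a hox.1.symm hox'.1.symm (hW a ha).1 (hW a ha).2 hva)
    have huW' := hW u huW
    have hzW := hW z (Finset.mem_union_right _ hz)
    have hzW' := hW z' (Finset.mem_union_right _ hz')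
    refine hindep _ h₁ ?_ (hkeep u z huW'.1 huW'.2 hzW.1 hzW.2 huz)
      (hkeep u z' huW'.1 huW'.2 hzW'.1 hzW'.2 huz') i hi j hj ?_
    · rw [hadj]
      have := hiJ.1.symm
      have := hjJ.1.symm
      tauto
    · rw [hadj]
      exact .inr ⟨hij, .inl (.inl ⟨rfl, rfl⟩)⟩
  obtain ⟨x₁, hx₁, x₂, hx₂, hx₁₂⟩ := Finset.one_lt_card.1 (by omega : 1 < F.card)
  obtain ⟨i, hi, hx₁i⟩ := hFI x₁ hx₁
  obtain ⟨i', hi', hx₂i⟩ := hFI x₂ hx₂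
  obtain rfl := hcross x₁ hx₁ x₂ hx₂ hx₁₂ i hi i' hi' hx₁i hx₂i
  have honly : ∀ x ∈ F, ∀ j ∈ I, G.Adj x j → j = i := by
    intro x hx j hj hxj
    by_cases hxx₁ : x = x₁
    · subst hxx₁
      exact hcross x hx x₂ hx₂ hx₁₂ j hj i hi hxj hx₂i
    · exact hcross x hx x₁ hx₁ hxx₁ j hj i hi hxj hx₁i
  have hiC : i ∉ insert v C := fun h' => Finset.disjoint_left.1 hCIdisj h' hi
  have hFall : ∀ x ∈ F, ∀ y, y ∈ insert v C ∨ y = i → G.Adj x y := by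
    intro x hx y hy
    obtain ⟨hsub, hdx⟩ := hFdeg x hx
    have hsub' : G.neighborFinset x ⊆ insert i (insert v C) := by
      intro y hy
      have hyB := hsub hy
      rw [hB, mem_union] at hyB
      rw [mem_insert]
      exact hyB.symm.imp (fun hyI => honly x hx y hyI (by simpa using hy)) id
    have heq := Finset.eq_of_subset_of_card_le hsub' (by
      rw [Finset.card_insert_of_notMem hiC, hvCcard, SimpleGraph.card_neighborFinset_eq_degree,
        h.degree_eq, hdx])
    rw [← mem_neighborFinset, heq, mem_insert]
    exact hy.symm
  obtain ⟨T, hT, hTcard⟩ := Finset.exists_subset_card_eq (by omega : 3 ≤ F.card)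
  have hTB : ∀ t ∈ T, t ∉ B := fun t ht => (memF t (hT ht)).1
  refine hno ⟨G, insert v C, insert i T, h.degree_eq,
    IsCore.of_center hvCcard hTcard ?_ hiC ?_ ?_ ?_⟩
  · exact fun h' => hTB i h' (Finset.mem_union_right _ hi)
  · rw [Finset.disjoint_left]
    exact fun x hx hxT => hTB x hxT (Finset.mem_union_left _ hx)
  · intro x hx y hy hxy
    rcases hy with hy | rfl | hy
    · rcases Finset.mem_insert.1 hx with rfl | hxC
      · exact hvC y ((Finset.mem_insert.1 hy).resolve_left hxy.symm)
      · rcases Finset.mem_insert.1 hy with rfl | hyC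
        · exact (hvC x hxC).symm
        · exact h.core.adj x hxC y (Finset.mem_union_left _ hyC) hxy
    · rcases Finset.mem_insert.1 hx with rfl | hxC
      · exact hvI _ hi
      · exact h.core.adj x hxC _ (Finset.mem_union_right _ ((memI _).1 hi).2) hxy
    · exact (hFall y (hT hy) x (.inl hx)).symm
  · exact fun t ht => (hFall t (hT ht) i (.inr rfl)).symm

end OptimalConfig

section VertexDeletion

variable {V : Type*}

/-- Replace `G - v` by the graph `H`, keeping the edges at `v`. -/
def replaceDeleted (G : SimpleGraph V) (v : V) (H : SimpleGraph {x : V // x ≠ v}) :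
    SimpleGraph V where
  Adj x y := (x = v ∧ G.Adj v y) ∨ (y = v ∧ G.Adj v x) ∨
    ∃ (hx : x ≠ v) (hy : y ≠ v), H.Adj ⟨x, hx⟩ ⟨y, hy⟩
  symm := ⟨by
    rintro x y (h | h | ⟨hx, hy, h⟩)
    · exact .inr (.inl h)
    · exact .inl h
    · exact .inr (.inr ⟨hy, hx, h.symm⟩)⟩
  loopless := ⟨by
    rintro x (⟨rfl, h⟩ | ⟨rfl, h⟩ | ⟨hx, hy, h⟩)
    · exact h.ne rfl
    · exact h.ne rfl
    · exact h.ne rfl⟩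

lemma replaceDeleted_adj (G : SimpleGraph V) (v : V) (H : SimpleGraph {x : V // x ≠ v})
    (x y : V) : (replaceDeleted G v H).Adj x y ↔ (x = v ∧ G.Adj v y) ∨ (y = v ∧ G.Adj v x) ∨
      ∃ (hx : x ≠ v) (hy : y ≠ v), H.Adj ⟨x, hx⟩ ⟨y, hy⟩ :=
  Iff.rfl

lemma replaceDeleted_comap (G : SimpleGraph V) (v : V) :
    replaceDeleted G v (G.comap Subtype.val) = G := by
  ext x y
  simp only [replaceDeleted_adj, SimpleGraph.comap_adj]
  by_cases hx : x = v <;> by_cases hy : y = v <;> simp_all [SimpleGraph.adj_comm]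

lemma replaceDeleted_adj_val (G : SimpleGraph V) (v : V) (H : SimpleGraph {x : V // x ≠ v})
    (x y : {x : V // x ≠ v}) : (replaceDeleted G v H).Adj x y ↔ H.Adj x y := by
  simp [replaceDeleted_adj, x.2, y.2]

variable [Fintype V]

lemma replaceDeleted_degree_self (G : SimpleGraph V) (v : V) (H : SimpleGraph {x : V // x ≠ v}) :
    (replaceDeleted G v H).degree v = G.degree v := by
  rw [← SimpleGraph.card_neighborFinset_eq_degree, ← SimpleGraph.card_neighborFinset_eq_degree]
  congr 1
  ext y
  rw [mem_neighborFinset, mem_neighborFinset, replaceDeleted_adj]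
  simp

lemma replaceDeleted_degree (G : SimpleGraph V) (v : V) (H : SimpleGraph {x : V // x ≠ v})
    (x : {x : V // x ≠ v}) :
    (replaceDeleted G v H).degree x = H.degree x + if G.Adj v x then 1 else 0 := by
  have : (replaceDeleted G v H).neighborFinset x =
      (H.neighborFinset x).map (Function.Embedding.subtype _) ∪ if G.Adj v x then {v} else ∅ := by
    ext y
    rw [mem_neighborFinset, Finset.mem_union]
    by_cases hy : y = v
    · subst hy
      rw [replaceDeleted_adj]
      split_ifs with h <;> simp [h, x.2]
    · have := replaceDeleted_adj_val G v H x ⟨y, hy⟩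
      split_ifs <;> simp [this, hy]
  rw [← SimpleGraph.card_neighborFinset_eq_degree, this, Finset.card_union_of_disjoint,
    Finset.card_map, SimpleGraph.card_neighborFinset_eq_degree]
  · split_ifs <;> simp
  · split_ifs <;> simp

lemma degree_eq_degree_comap_add (G : SimpleGraph V) (v : V) (x : {x : V // x ≠ v}) :
    G.degree x = (G.comap (Subtype.val : {x : V // x ≠ v} → V)).degree x +
      if G.Adj v x then 1 else 0 := by
  have h := replaceDeleted_degree G v (G.comap Subtype.val) x
  have hcongr : ∀ G' : SimpleGraph V, G' = G → G'.degree (x : V) = G.degree x := by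
    rintro _ rfl
    rfl
  rw [hcongr _ (replaceDeleted_comap G v)] at h
  exact h.trans (by congr!)

lemma sum_degree_deleted (G : SimpleGraph V) (v : V) :
    ∑ x, G.degree x = 2 * G.degree v +
      ∑ x, (G.comap (Subtype.val : {x : V // x ≠ v} → V)).degree x := by
  have h2 : G.degree v = ∑ x : {x : V // x ≠ v}, if G.Adj v x then 1 else 0 := by
    have h3 := Fintype.sum_eq_add_sum_subtype_ne (fun x => if G.Adj v x then 1 else 0) v
    rw [← SimpleGraph.card_neighborFinset_eq_degree]
    simp only [SimpleGraph.irrefl, if_false, zero_add] at h3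
    rw [← h3, Finset.sum_boole, Nat.cast_id]
    congr 1
    ext y
    simp
  rw [Fintype.sum_eq_add_sum_subtype_ne (fun x => G.degree x) v,
    Finset.sum_congr rfl fun x _ => degree_eq_degree_comap_add G v x, Finset.sum_add_distrib, ← h2]
  ring

end VertexDeletion

lemma hasCoreRealization_zero {V : Type*} [Fintype V] (G : SimpleGraph V)
    (hn : 4 ≤ Fintype.card V) (hσ : Fintype.card V < ∑ x, G.degree x) :
    HasCoreRealization (fun x => G.degree x) 0 := by
  obtain ⟨b, hb⟩ : ∃ b, 1 < G.degree b := by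
    by_contra! hcon
    have := Finset.sum_le_card_nsmul univ (fun x => G.degree x) 1 fun x _ => hcon x
    rw [Finset.card_univ, smul_eq_mul, mul_one] at this
    omega
  rw [← SimpleGraph.card_neighborFinset_eq_degree] at hb
  obtain ⟨a, ha, c, hc, hac⟩ := Finset.one_lt_card.1 hb
  rw [mem_neighborFinset] at ha hc
  obtain ⟨J, hJ, hJcard⟩ := Finset.exists_superset_card_eq (s := {a, b, c}) (n := 4)
    (Finset.card_le_three.trans (by omega)) hn
  exact ⟨G, ∅, J, fun _ => rfl, rfl, hJcard, Finset.disjoint_empty_left _, by simp,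
    a, hJ (by simp), b, hJ (by simp), c, hJ (by simp), hac, ha, hc⟩

/-- A sufficiently large degree sum forces a realization with a core. -/
theorem hasCoreRealization_of_sum_degree (s : ℕ) :
    ∀ {V : Type*} [Fintype V] (G : SimpleGraph V), 5 * s + 31 ≤ Fintype.card V →
      Fintype.card V * (2 * s + 1) + 4 ≤ ∑ x, G.degree x + s ^ 2 + 2 * s →
      HasCoreRealization (fun x => G.degree x) s := by
  induction s with
  | zero => exact fun G hn hσ => hasCoreRealization_zero G (by omega) (by omega)
  | succ k ih =>
    intro V _ G hn hσ
    have : Nonempty V := Fintype.card_pos_iff.1 (by omega)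
    obtain ⟨v, -, hv⟩ := Finset.exists_max_image univ (fun x => G.degree x) univ_nonempty
    have hmax : ∀ x, G.degree x ≤ G.degree v := fun x => hv x (mem_univ x)
    have hn' : 5 * k + 36 ≤ Fintype.card V := by omega
    have hσ' : Fintype.card V * (2 * k + 3) + 1 ≤ ∑ x, G.degree x + k ^ 2 + 4 * k := by
      nlinarith
    have hcard : Fintype.card {x : V // x ≠ v} + 1 = Fintype.card V := by
      rw [Fintype.card_subtype_compl, Fintype.card_subtype_eq]
      omega
    have hDlt := G.degree_lt_card_verts v
    have hsum := sum_degree_deleted G v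
    rw [← hcard] at hDlt
    have hσ'' : Fintype.card {x : V // x ≠ v} * (2 * k + 1) + 4 ≤
        ∑ x, (G.comap (Subtype.val : {x : V // x ≠ v} → V)).degree x + k ^ 2 + 2 * k := by
      rw [hsum, ← hcard] at hσ'
      nlinarith
    obtain ⟨H, C, J, hH, hcore⟩ := ih (G.comap (Subtype.val : {x : V // x ≠ v} → V)) (by omega)
      (by convert hσ'')
    have hdeg : ∀ x, (replaceDeleted G v H).degree x = G.degree x := by
      intro x
      by_cases hx : x = v
      · rw [hx]; exact replaceDeleted_degree_self G v H
      · have h1 := replaceDeleted_degree G v H ⟨x, hx⟩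
        have h2 := degree_eq_degree_comap_add G v ⟨x, hx⟩
        rw [hH] at h1
        exact h1.trans h2.symm
    have hconfig : CoreConfig (fun x => G.degree x) k v (replaceDeleted G v H)
        (C.map (Function.Embedding.subtype _)) (J.map (Function.Embedding.subtype _)) := by
      refine ⟨hdeg, ⟨?_, ?_, ?_, ?_, ?_⟩, ?_⟩
      · rw [Finset.card_map, hcore.card_left]
      · rw [Finset.card_map, hcore.card_right]
      · rw [Finset.disjoint_map]; exact hcore.disjoint
      · intro x hx y' hy hxy
        simp only [Finset.mem_union, Finset.mem_map] at hx hy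
        obtain ⟨x, hxC, rfl⟩ := hx
        obtain ⟨y, hyC, rfl⟩ : ∃ y, y ∈ C ∪ J ∧ Function.Embedding.subtype _ y = y' := by
          rcases hy with ⟨y, hy, rfl⟩ | ⟨y, hy, rfl⟩
          exacts [⟨y, Finset.mem_union_left _ hy, rfl⟩, ⟨y, Finset.mem_union_right _ hy, rfl⟩]
        exact (replaceDeleted_adj_val G v H x y).2
          (hcore.adj x hxC y (by convert hyC) fun e => hxy (by rw [e]))
      · obtain ⟨a, ha, b, hb, c, hc, hac, hba, hbc⟩ := hcore.path
        exact ⟨a, Finset.mem_map_of_mem _ ha, b, Finset.mem_map_of_mem _ hb, c,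
          Finset.mem_map_of_mem _ hc, fun e => hac (Subtype.ext e),
          (replaceDeleted_adj_val G v H b a).2 hba, (replaceDeleted_adj_val G v H b c).2 hbc⟩
      · rw [← Finset.map_union]
        intro hmem
        obtain ⟨x, -, hx⟩ := Finset.mem_map.1 hmem
        exact x.2 hx
    obtain ⟨G', C', J', hopt⟩ := hconfig.exists_optimal
    by_cases hall : ∀ x ∈ C' ∪ J', G'.Adj v x
    · exact ⟨G', insert v C', J', hopt.degree_eq, hopt.core.insert_left hopt.notMem hall⟩
    · push Not at hall
      obtain ⟨u, hu, hvu⟩ := hall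
      exact hopt.hasCoreRealization_of_missed hmax hn' hσ' hu hvu

lemma eq_of_not_adj_Z4 (i j : Fin 4) (hij : i ≠ j) (h : ¬Z4.Adj i j) :
    (i = 1 ∧ (j = 0 ∨ j = 2)) ∨ (j = 1 ∧ (i = 0 ∨ i = 2)) := by
  revert hij h
  simp only [Z4, SimpleGraph.sdiff_adj, SimpleGraph.top_adj, SimpleGraph.fromEdgeSet_adj,
    Set.mem_insert_iff, Set.mem_singleton_iff, Sym2.eq_iff]
  revert i j
  decide

/-- A core carries a copy of `K_{s+4} - Z₄`. -/
lemma IsCore.containsCopy {V : Type*} {G : SimpleGraph V} {C J : Finset V} {s m : ℕ}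
    (h : IsCore G C J s) (hm : m = s + 4) : ContainsCopy G (KsubH m 4 (by omega) Z4) := by
  obtain ⟨a, ha, b, hb, c, hc, hac, hba, hbc⟩ := h.path
  obtain ⟨e, heJ, he⟩ := Finset.exists_mem_notMem_of_card_lt_card (s := {a, b, c}) (t := J)
    (by rw [h.card_right]; exact Nat.lt_succ_of_le Finset.card_le_three)
  simp only [mem_insert, mem_singleton, not_or] at he
  let g : Fin 4 → V := ![a, b, c, e]
  have hgJ : ∀ i, g i ∈ J := by
    intro i; fin_cases i <;> assumption
  have hginj : Function.Injective g := by
    have h1 := hba.ne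
    have h2 := hbc.ne
    obtain ⟨h3, h4, h5⟩ := he
    intro i j hij
    fin_cases i <;> fin_cases j <;> simp_all [g]
  have hgadj : ∀ i j, i ≠ j → ¬Z4.Adj i j → G.Adj (g i) (g j) := by
    intro i j hij hZ
    rcases eq_of_not_adj_Z4 i j hij hZ with ⟨rfl, rfl | rfl⟩ | ⟨rfl, rfl | rfl⟩
    exacts [hba, hbc, hba.symm, hbc.symm]
  let t : Fin s → V := fun i => (C.equivFinOfCardEq h.card_left).symm i
  have htC : ∀ i, t i ∈ C := fun i => ((C.equivFinOfCardEq h.card_left).symm i).2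
  have htinj : Function.Injective t :=
    Subtype.val_injective.comp (C.equivFinOfCardEq h.card_left).symm.injective
  have hgt : ∀ i j, g i ≠ t j := fun i j e =>
    Finset.disjoint_left.1 h.disjoint (htC j) (e ▸ hgJ i)
  let f : Fin m → V := fun i =>
    if hi : i.val < 4 then g ⟨i, hi⟩ else t ⟨i - 4, by have := i.2; omega⟩
  have hfinj : Function.Injective f := by
    intro i j hij
    simp only [f] at hij
    split_ifs at hij with hi hj hj
    · exact Fin.ext (by simpa using hginj hij)
    · exact absurd hij (hgt _ _)
    · exact absurd hij.symm (hgt _ _)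
    · have := htinj hij
      rw [Fin.mk.injEq] at this
      exact Fin.ext (by omega)
  have hfW : ∀ i, f i ∈ C ∪ J := by
    intro i
    simp only [f]
    split_ifs
    exacts [Finset.mem_union_right _ (hgJ _), Finset.mem_union_left _ (htC _)]
  have hfC : ∀ i : Fin m, ¬i.val < 4 → f i ∈ C := by
    intro i hi
    simp only [f, hi, dif_neg, not_false_eq_true]
    exact htC _
  refine ⟨⟨f, hfinj⟩, fun i j hij => ?_⟩
  rw [KsubH, SimpleGraph.sdiff_adj, SimpleGraph.top_adj] at hij
  change G.Adj (f i) (f j)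
  have hne : f i ≠ f j := fun e => hij.1 (hfinj e)
  by_cases hi : i.val < 4
  · by_cases hj : j.val < 4
    · have hfi : f i = g ⟨i, hi⟩ := dif_pos hi
      have hfj : f j = g ⟨j, hj⟩ := dif_pos hj
      rw [hfi, hfj]
      refine hgadj _ _ (fun e => hij.1 (Fin.ext (by simpa using e))) fun hZ => hij.2 ?_
      rw [SimpleGraph.map_adj]
      exact ⟨_, _, hZ, rfl, rfl⟩
    · exact (h.adj _ (hfC j hj) _ (hfW i) hne.symm).symm
  · exact h.adj _ (hfC i hi) _ (hfW j) hne

/-- If `r ≥ 4`, `n ≥ 5r + 16` and `π` is an `n`-term graphic sequence with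
`σ(π) ≥ (r-1)(2n-r) - 3(n-r) + 1` if `n - r` is odd, and
`σ(π) ≥ (r-1)(2n-r) - 3(n-r) + 2` if `n - r` is even, then `π` is potentially
`K_{r+1} - Z₄`-graphic. -/
theorem stmt1 (r n : ℕ) (hr : 4 ≤ r) (hn : 5 * r + 16 ≤ n)
    (d : Fin n → ℕ) (hgraphic : IsGraphic d)
    (hσ : (if Odd (n - r)
        then ((r : ℤ) - 1) * (2 * (n : ℤ) - r) - 3 * ((n : ℤ) - r) + 1
        else ((r : ℤ) - 1) * (2 * (n : ℤ) - r) - 3 * ((n : ℤ) - r) + 2)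
      ≤ ∑ i, (d i : ℤ)) :
    PotentiallyGraphic d (KsubH (r + 1) 4 (by omega) Z4) := by
  obtain ⟨-, G, hG⟩ := hgraphic
  obtain ⟨s, rfl⟩ : ∃ s, r = s + 3 := ⟨r - 3, by omega⟩
  have hsum : ∑ i, G.degree i = ∑ i, d i := Finset.sum_congr rfl fun i _ => hG i
  have hσ' : n * (2 * s + 1) + 4 ≤ ∑ i, G.degree i + s ^ 2 + 2 * s := by
    rw [hsum]
    zify
    push_cast at hσ
    split_ifs at hσ <;> nlinarith
  obtain ⟨G', C, J, hdeg, hcore⟩ := hasCoreRealization_of_sum_degree s G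
    (by rw [Fintype.card_fin]; omega) (by rwa [Fintype.card_fin])
  exact ⟨G', fun i => (hdeg i).trans (hG i), hcore.containsCopy (by omega)⟩
end
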